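/- Let G be a finite group whose character graph Δ(G) is K₄-free with exactly seven vertices, and let M be a normal subgroup of G with R(G) < M such that S := M/R(G) ≅ PSL₂(2^f) for some integer f ≥ 2, the centralizer of M/R(G) in G/R(G) is trivial, and the complement of the induced subgraph of Δ(G) on π(S) is not bipartite. If |π(2^f − 1)| = |π(2^f + 1)| = 3, then G ≅ PSL₂(2^f) × R(G), R(G) is abelian, and Δ(G) ≅ K₃ ∪ K₁ ∪ K₃. -/

import Mathlib

open CategoryTheory

/-- `cd(G)`: the set of character degrees of `G`, i.e. the dimensions of the simple
finite-dimensional complex representations of `G`. -/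
def charDegrees (G : Type) [Group G] : Set ℕ :=
  { n | ∃ V : FDRep ℂ G, Simple V ∧ Module.finrank ℂ V = n }

/-- `ρ(G)`: the set of primes dividing some character degree of `G`. -/
def charPrimes (G : Type) [Group G] : Set ℕ :=
  { p | p.Prime ∧ ∃ n ∈ charDegrees G, p ∣ n }

/-- The character graph `Δ(G)`, on vertex set `ρ(G)`: two distinct primes `p`, `q`
are adjacent iff `p * q` divides some character degree of `G`. -/
def charGraph (G : Type) [Group G] : SimpleGraph (charPrimes G) where
  Adj p q := (p : ℕ) ≠ (q : ℕ) ∧ ∃ n ∈ charDegrees G, (p : ℕ) * (q : ℕ) ∣ n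
  symm := by
    constructor; rintro p q ⟨h, n, hn, hd⟩
    exact ⟨fun e => h e.symm, n, hn, by rwa [mul_comm]⟩
  loopless := by constructor; rintro p ⟨h, -⟩; exact h rfl

/-- The solvable radical `R(G)` of `G`: the largest solvable normal subgroup of `G`
(realized as the join of all solvable normal subgroups). -/
def solvableRadical (G : Type*) [Group G] : Subgroup G :=
  ⨆ N : { N : Subgroup G // N.Normal ∧ IsSolvable ↥N }, (N : Subgroup G)

instance solvableRadical_normal (G : Type*) [Group G] : (solvableRadical G).Normal := by
  constructor
  intro n hn g
  refine Subgroup.iSup_induction (C := fun x => g * x * g⁻¹ ∈ solvableRadical G)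
    (fun N : { N : Subgroup G // N.Normal ∧ IsSolvable ↥N } => (N : Subgroup G)) hn ?_ ?_ ?_
  · intro N x hx
    exact Subgroup.mem_iSup_of_mem N (N.2.1.conj_mem x hx g)
  · simpa using Subgroup.one_mem _
  · intro x y hx hy
    have h : g * (x * y) * g⁻¹ = (g * x * g⁻¹) * (g * y * g⁻¹) := by group
    rw [h]; exact Subgroup.mul_mem _ hx hy

/-- `PSL₂(F)`: the special linear group `SL₂(F)` modulo its center. -/
abbrev PSL2 (F : Type) [Field F] :=
  Matrix.SpecialLinearGroup (Fin 2) F ⧸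
    Subgroup.center (Matrix.SpecialLinearGroup (Fin 2) F)

/-- The join `Γ ⋆ Δ` of two simple graphs: the disjoint union together with all
edges between the two vertex sets. -/
def graphJoin {α β : Type*} (G : SimpleGraph α) (H : SimpleGraph β) :
    SimpleGraph (α ⊕ β) :=
  (G ⊕g H) ⊔
    { Adj := fun u v => u.isLeft ≠ v.isLeft
      symm := ⟨fun _ _ h => h.symm⟩
      loopless := ⟨fun _ h => h rfl⟩ }

/-- The image of a subgroup `M` of `G` in `G/R(G)`; when `R(G) ≤ M` this is `M/R(G)`. -/
def radicalQuotImage {G : Type*} [Group G] (M : Subgroup G) :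
    Subgroup (G ⧸ solvableRadical G) :=
  M.map (QuotientGroup.mk' (solvableRadical G))



structure Irr {G X : Type} [Group G] [AddCommGroup X] [Module ℂ X] (ρ : Representation ℂ G X) :
    Prop where
  nontriv : Nontrivial X
  eq : ∀ W : Submodule ℂ X, (∀ g, ∀ x ∈ W, ρ g x ∈ W) → W = ⊥ ∨ W = ⊤

section bridge
variable {G X : Type} [Group G] [AddCommGroup X] [Module ℂ X] [FiniteDimensional ℂ X]

lemma Irr.scalar {ρ : Representation ℂ G X} (h : Irr ρ) (T : Module.End ℂ X)
    (hT : ∀ g, ρ g * T = T * ρ g) : ∃ c : ℂ, T = c • 1 := by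
  have := h.nontriv
  obtain ⟨c, hc⟩ := Module.End.exists_eigenvalue T
  refine ⟨c, ?_⟩
  have hinv : ∀ g, ∀ x ∈ Module.End.eigenspace T c, ρ g x ∈ Module.End.eigenspace T c := by
    intro g x hx
    rw [Module.End.mem_eigenspace_iff] at hx ⊢
    have := congrArg (fun S => S x) (hT g)
    simp only [Module.End.mul_apply] at this
    rw [← this, hx, map_smul]
  rcases h.eq (Module.End.eigenspace T c) hinv with h1 | h1
  · exact absurd h1 hc
  · ext x
    have : x ∈ Module.End.eigenspace T c := by rw [h1]; trivial
    simpa using Module.End.mem_eigenspace_iff.mp this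

lemma br1 [Finite G] {ρ : Representation ℂ G X} (h : Irr ρ) : Module.finrank ℂ X ∈ charDegrees G := by
  refine ⟨FDRep.of ρ, ?_, rfl⟩
  have := h.nontriv
  rw [FDRep.simple_iff_end_is_rank_one]
  rw [finrank_eq_one_iff']
  refine ⟨𝟙 _, ?_, ?_⟩
  · intro h0
    obtain ⟨x, hx⟩ := exists_ne (0 : X)
    apply hx
    have := congrArg (fun (f : FDRep.of ρ ⟶ FDRep.of ρ) => f.hom.hom.hom x) h0
    exact this
  · intro w
    obtain ⟨c, hc⟩ := h.scalar (w.hom.hom.hom : X →ₗ[ℂ] X) (by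
      intro g
      have := w.comm g
      have := congrArg (fun f => f.hom.hom) this
      exact this.symm)
    refine ⟨c, ?_⟩
    apply Action.Hom.ext
    ext x
    have := congrArg (fun f => f x) hc
    exact this.symm

lemma br2 {n : ℕ} (h : n ∈ charDegrees G) : ∃ (X : Type) (_ : AddCommGroup X) (_ : Module ℂ X)
    (_ : FiniteDimensional ℂ X) (ρ : Representation ℂ G X), Irr ρ ∧ Module.finrank ℂ X = n := by
  obtain ⟨V, hV, hn⟩ := h
  refine ⟨V, inferInstance, inferInstance, inferInstance, V.ρ, ⟨?_, ?_⟩, hn⟩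
  · by_contra hcon
    rw [not_nontrivial_iff_subsingleton] at hcon
    apply CategoryTheory.id_nonzero V
    apply Action.Hom.ext
    ext x
    exact hcon.elim _ _
  · intro W hW
    let σ : Representation ℂ G W :=
      { toFun := fun g => (V.ρ g).restrict (hW g)
        map_one' := by ext; simp
        map_mul' := fun x y => by ext; simp }
    let i : FDRep.of σ ⟶ V :=
      ⟨InducedCategory.homMk (ModuleCat.ofHom W.subtype), fun g ↦ by
        ext1
        rfl⟩
    have hmono : Mono i := by
      constructor
      intro Z a b hab
      apply Action.Hom.ext
      ext x
      have := congrArg (fun f => f.hom.hom.hom x) hab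
      exact this
    by_cases hi : i = 0
    · left
      rw [Submodule.eq_bot_iff]
      intro x hx
      have := congrArg (fun f => f.hom.hom.hom (⟨x, hx⟩ : W)) hi
      exact this
    · right
      have hiso := (Simple.mono_isIso_iff_nonzero i).mpr hi
      rw [Submodule.eq_top_iff']
      intro x
      have h1 : inv i ≫ i = 𝟙 _ := IsIso.inv_hom_id i
      have h2 := congrArg (fun f => f.hom.hom.hom x) h1
      have h3 : ((inv i).hom.hom.hom x : W).1 = x := h2
      rw [← h3]
      exact ((inv i).hom.hom.hom x : W).2
end bridge

lemma faith {G : Type} [Group G] [Fintype G] (c : G → ℂ) (hc : c ≠ 0) :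
    ∃ (X : Type) (_ : AddCommGroup X) (_ : Module ℂ X)
    (_ : FiniteDimensional ℂ X) (ρ : Representation ℂ G X), Irr ρ ∧ ∑ g, c g • ρ g ≠ 0 := by
  by_contra hcon
  push Not at hcon
  apply hc
  let A := MonoidAlgebra ℂ G
  let a : A := ∑ g, c g • MonoidAlgebra.of ℂ G g
  have key : ∀ m : Submodule A A, IsSimpleModule A m → ∀ x ∈ m, a * x = 0 := by
    intro m hm x hx
    have : Module.Finite ℂ A := inferInstance
    have : Module.Finite ℂ (m.restrictScalars ℂ) := inferInstance
    have : Module.Finite ℂ m := this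
    let ρ : Representation ℂ G m := (Algebra.lsmul ℂ ℂ m : A →ₐ[ℂ] _).toMonoidHom.comp (MonoidAlgebra.of ℂ G)
    have hρ : ∀ g (y : m), ρ g y = MonoidAlgebra.of ℂ G g • y := fun g y => rfl
    have := hcon m inferInstance inferInstance inferInstance ρ ?_
    · have := congrArg (fun f => (f (⟨x, hx⟩ : m) : A)) this
      simp only [LinearMap.sum_apply, LinearMap.smul_apply, hρ] at this
      rw [← Finset.sum_congr rfl (fun g _ => smul_assoc (c g) (MonoidAlgebra.of ℂ G g) (⟨x, hx⟩ : m)), ← Finset.sum_smul] at this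
      exact this
    · refine ⟨IsSimpleModule.nontrivial A m, ?_⟩
      intro W hW
      have hsm : ∀ (b : A) (y : m), y ∈ W → b • y ∈ W := by
        intro b y hy
        induction b using MonoidAlgebra.induction_on with
        | of g => exact hW g y hy
        | add b1 b2 h1 h2 => rw [add_smul]; exact W.add_mem h1 h2
        | smul r b h => rw [smul_assoc]; exact W.smul_mem r h
      let W' : Submodule A m := { W with smul_mem' := hsm }
      rcases eq_bot_or_eq_top W' with h | h
      · left
        rw [Submodule.eq_bot_iff] at h ⊢
        exact h
      · right
        rw [Submodule.eq_top_iff'] at h ⊢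
        exact h
  have hA : IsSemisimpleModule A A := inferInstance
  have htop := IsSemisimpleModule.sSup_simples_eq_top A A
  have h1 : (⊤ : Submodule A A) ≤ LinearMap.ker (LinearMap.toSpanSingleton A A 1) ⊔ ⊤ := le_sup_right
  have hall : ∀ x : A, a * x = 0 := by
    intro x
    have hx : x ∈ sSup {m : Submodule A A | IsSimpleModule A m} := by rw [htop]; trivial
    rw [sSup_eq_iSup'] at hx
    induction hx using Submodule.iSup_induction' with
    | mem i x hx => exact key i.1 i.2 x hx
    | zero => simp
    | add x y _ _ h1 h2 => rw [mul_add, h1, h2, add_zero]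
  have ha : a = 0 := by simpa using hall 1
  funext g
  have h0 := congrArg (fun b : A => (MonoidAlgebra.coeffLinearEquiv ℂ b) g) ha
  simp only [a, map_sum, map_smul, Finsupp.coe_finsetSum, Finset.sum_apply] at h0
  rw [Finset.sum_eq_single g] at h0
  · simpa [MonoidAlgebra.of_apply] using h0
  · intro b _ hb
    simp [MonoidAlgebra.of_apply, hb]
  · simp


lemma faith2 {G : Type} [Group G] [Finite G] {κ : Type} [Fintype κ] (i : κ → G) (c : κ → ℂ) (g0 : G)
    (h0 : (letI := Classical.decEq G; ∑ k, if i k = g0 then c k else 0) ≠ 0) :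
    ∃ (X : Type) (_ : AddCommGroup X) (_ : Module ℂ X)
    (_ : FiniteDimensional ℂ X) (ρ : Representation ℂ G X), Irr ρ ∧ ∑ k, c k • ρ (i k) ≠ 0 := by
  classical
  have := Fintype.ofFinite G
  obtain ⟨X, i1, i2, i3, ρ, hρ, h⟩ := faith (fun g => ∑ k, if i k = g then c k else 0) (by
    intro h; apply h0; convert congrFun h g0; rfl)
  refine ⟨X, i1, i2, i3, ρ, hρ, ?_⟩
  intro h1; apply h
  rw [← h1]
  simp only [Finset.sum_smul, ite_smul, zero_smul]
  rw [Finset.sum_comm]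
  simp

section gen
variable {G X : Type} [Group G] [AddCommGroup X] [Module ℂ X]

lemma Irr.ker_bot {ρ : Representation ℂ G X} (h : Irr ρ) (Z : Module.End ℂ X) (hZ : Z ≠ 0)
    (hc : ∀ g, ∃ c : ℂ, Z * ρ g = c • (ρ g * Z)) : LinearMap.ker Z = ⊥ := by
  rcases h.eq (LinearMap.ker Z) (by
    intro g x hx
    obtain ⟨c, hc⟩ := hc g
    have := congrArg (fun f => f x) hc
    rw [LinearMap.mem_ker] at hx ⊢
    simpa [hx] using this) with h | h
  · exact h
  · exact absurd (LinearMap.ker_eq_top.mp h) hZ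

lemma Irr.cancel {ρ : Representation ℂ G X} (h : Irr ρ) (Z : Module.End ℂ X) (hZ : Z ≠ 0)
    (hc : ∀ g, ∃ c : ℂ, Z * ρ g = c • (ρ g * Z)) (e : Module.End ℂ X) (he : Z * e = 0) : e = 0 := by
  have := h.ker_bot Z hZ hc
  ext x
  have h1 : e x ∈ LinearMap.ker Z := by
    rw [LinearMap.mem_ker]; exact congrArg (fun f => f x) he
  rw [this] at h1
  simpa using h1

lemma trace_idem [FiniteDimensional ℂ X] (e : Module.End ℂ X) (he : e * e = e) :
    LinearMap.trace ℂ X e = (Module.finrank ℂ (LinearMap.range e) : ℂ) :=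
  LinearMap.IsProj.trace ((LinearMap.isProj_range_iff_isIdempotentElem e).mpr he)

lemma Irr.index_dvd [Finite G] [FiniteDimensional ℂ X] {ρ : Representation ℂ G X} (h : Irr ρ) (J : Subgroup G)
    (e : Module.End ℂ X) (he : e * e = e) (h1 : ∀ j ∈ J, ρ j * e = e * ρ j)
    (h2 : ∀ g, g ∉ J → e * ρ g * e = 0) (h0 : e ≠ 0) : J.index ∣ Module.finrank ℂ X := by
  classical
  have := Fintype.ofFinite G
  have inv1 : ∀ g, ρ g * ρ g⁻¹ = 1 := fun g => by rw [← map_mul, mul_inv_cancel, map_one]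
  have inv2 : ∀ g, ρ g⁻¹ * ρ g = 1 := fun g => by rw [← map_mul, inv_mul_cancel, map_one]
  obtain ⟨c, hc⟩ := h.scalar (∑ g, ρ g * e * ρ g⁻¹) (by
    intro k
    rw [Finset.mul_sum, Finset.sum_mul]
    apply Fintype.sum_equiv (Equiv.mulLeft k)
    intro g
    simp only [Equiv.coe_mulLeft, mul_inv_rev, map_mul]
    simp only [mul_assoc, inv2, mul_one])
  have hce : c • e = (Nat.card J : ℂ) • e := by
    have h3 : e * (∑ g, ρ g * e * ρ g⁻¹) = c • e := by rw [hc]; simp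
    rw [← h3, Finset.mul_sum]
    have h4 : ∀ g, e * (ρ g * e * ρ g⁻¹) = if g ∈ J then e else 0 := by
      intro g
      split_ifs with hg
      · rw [h1 g hg, mul_assoc e, inv1, mul_one, he]
      · rw [← mul_assoc, ← mul_assoc, h2 g hg, zero_mul]
    simp only [h4]
    rw [Finset.sum_ite, Finset.sum_const, Finset.sum_const_zero, add_zero, ← Nat.cast_smul_eq_nsmul ℂ]
    congr 2
    rw [Nat.card_eq_fintype_card, Fintype.card_subtype]
  have hcJ : c = Nat.card J := by
    have : (c - Nat.card J) • e = 0 := by rw [sub_smul, hce, sub_self]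
    rcases smul_eq_zero.mp this with h | h
    · exact sub_eq_zero.mp h
    · exact absurd h h0
  have ht := congrArg (LinearMap.trace ℂ X) hc
  rw [map_sum, map_smul, LinearMap.trace_one] at ht
  have h5 : ∀ g, LinearMap.trace ℂ X (ρ g * e * ρ g⁻¹) = LinearMap.trace ℂ X e := by
    intro g
    rw [mul_assoc, LinearMap.trace_mul_comm, mul_assoc, inv2, mul_one]
  simp only [h5, Finset.sum_const, Finset.card_univ, trace_idem e he] at ht
  rw [hcJ] at ht
  rw [nsmul_eq_mul, smul_eq_mul] at ht
  norm_cast at ht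
  rw [← Nat.card_eq_fintype_card, ← J.card_mul_index, mul_assoc] at ht
  have := Nat.eq_of_mul_eq_mul_left (Nat.card_pos (α := J)) ht
  exact ⟨_, this.symm⟩

lemma Irr.rank_le_one [FiniteDimensional ℂ X] {ρ : Representation ℂ G X} (h : Irr ρ)
    (e : Module.End ℂ X) (he : e * e = e)
    (hcom : ∀ g k, (e * ρ g * e) * (e * ρ k * e) = (e * ρ k * e) * (e * ρ g * e)) :
    Module.finrank ℂ (LinearMap.range e) ≤ 1 := by
  by_cases h0 : e = 0
  · rw [h0, LinearMap.range_zero, finrank_bot]; exact Nat.zero_le 1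
  have he' : ∀ x, e (e x) = e x := fun x => congrArg (fun f => f x) he
  have hcom' : ∀ g k x, e (ρ g (e (e (ρ k (e x))))) = e (ρ k (e (e (ρ g (e x))))) :=
    fun g k x => congrArg (fun f => f x) (hcom g k)
  have hne : Nontrivial (LinearMap.range e) := by
    rw [Submodule.nontrivial_iff_ne_bot]
    intro hb; exact h0 (LinearMap.range_eq_bot.mp hb)
  have key : ∀ k, ∃ c : ℂ, ∀ x, e (ρ k (e x)) = c • e x := by
    intro k
    let T : Module.End ℂ (LinearMap.range e) :=
      LinearMap.codRestrict (LinearMap.range e) (e ∘ₗ (ρ k) ∘ₗ (LinearMap.range e).subtype)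
        (fun x => ⟨_, rfl⟩)
    obtain ⟨c, hc⟩ := Module.End.exists_eigenvalue T
    obtain ⟨v, hv⟩ := hc.exists_hasEigenvector
    have hv1 : e (ρ k v.1) = c • v.1 := by
      have := congrArg Subtype.val (Module.End.mem_eigenspace_iff.mp hv.1)
      exact this
    have hv2 : e v.1 = v.1 := by
      obtain ⟨y, hy⟩ := v.2
      rw [← hy, he']
    refine ⟨c, ?_⟩
    let W : Submodule ℂ X :=
      { carrier := {x | ∀ g, e (ρ k (e (ρ g x))) = c • e (ρ g x)}
        add_mem' := by
          intro a b ha hb g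
          simp only [map_add, smul_add]; rw [ha, hb]
        zero_mem' := by intro g; simp
        smul_mem' := by
          intro r a ha g
          simp only [map_smul]; rw [ha, smul_comm] }
    have hvW : v.1 ∈ W := by
      intro g
      have := hcom' k g v.1
      rw [hv2, he', he', hv1] at this
      rw [this]; simp
    rcases h.eq W (by
      intro g x hx k'
      have := hx (k' * g)
      simpa [map_mul] using this) with hW | hW
    · rw [hW] at hvW
      exact absurd (Subtype.ext ((Submodule.mem_bot ℂ).mp hvW)) hv.2
    · intro x
      have hx : x ∈ W := by rw [hW]; trivial
      simpa using hx 1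
  obtain ⟨v, hv⟩ := exists_ne (0 : LinearMap.range e)
  have hv2 : e v.1 = v.1 := by
    obtain ⟨y, hy⟩ := v.2
    rw [← hy, he']
  let W : Submodule ℂ X :=
      { carrier := {x | ∀ g, ∃ c : ℂ, e (ρ g x) = c • v.1}
        add_mem' := by
          intro a b ha hb g
          obtain ⟨c, hc⟩ := ha g
          obtain ⟨d, hd⟩ := hb g
          exact ⟨c + d, by rw [map_add, map_add, hc, hd, add_smul]⟩
        zero_mem' := by intro g; exact ⟨0, by simp⟩
        smul_mem' := by
          intro r a ha g
          obtain ⟨c, hc⟩ := ha g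
          exact ⟨r * c, by rw [map_smul, map_smul, hc, smul_smul]⟩ }
  have hvW : v.1 ∈ W := by
    intro g
    obtain ⟨c, hc⟩ := key g
    have := hc v.1
    rw [hv2] at this
    exact ⟨c, this⟩
  rcases h.eq W (by
      intro g x hx k'
      have := hx (k' * g)
      simpa [map_mul] using this) with hW | hW
  · rw [hW] at hvW
    exact absurd (Subtype.ext ((Submodule.mem_bot ℂ).mp hvW)) hv
  · apply finrank_le_one v
    rintro ⟨w, y, rfl⟩
    have hx : y ∈ W := by rw [hW]; trivial
    obtain ⟨c, hc⟩ := hx 1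
    refine ⟨c, Subtype.ext ?_⟩
    simpa using hc.symm

noncomputable def eop {N : Type} [Group N] [Fintype N] (ρ : Representation ℂ G X) (j : N →* G) (l : N →* ℂˣ) :
    Module.End ℂ X := (Fintype.card N : ℂ)⁻¹ • ∑ n, ((l n)⁻¹ : ℂˣ).val • ρ (j n)

variable {N : Type} [Group N] [Fintype N] (ρ : Representation ℂ G X) (j : N →* G) (l : N →* ℂˣ)

lemma eop_left (n : N) : ρ (j n) * eop ρ j l = (l n).val • eop ρ j l := by
  unfold eop
  rw [mul_smul_comm, smul_comm (l n).val, Finset.mul_sum, Finset.smul_sum (r := (l n).val)]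
  congr 1
  apply Fintype.sum_equiv (Equiv.mulLeft n)
  intro m
  simp only [Equiv.coe_mulLeft, map_mul, mul_smul_comm, smul_smul]
  congr 1
  simp [mul_comm (l m).val⁻¹, (l n).ne_zero]

lemma eop_right (n : N) : eop ρ j l * ρ (j n) = (l n).val • eop ρ j l := by
  unfold eop
  rw [smul_mul_assoc, smul_comm (l n).val, Finset.sum_mul, Finset.smul_sum (r := (l n).val)]
  congr 1
  apply Fintype.sum_equiv (Equiv.mulRight n)
  intro m
  simp only [Equiv.coe_mulRight, map_mul, smul_mul_assoc, smul_smul]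
  congr 1
  simp [mul_comm]

lemma eop_mul (l' : N →* ℂˣ) (h : l ≠ l') : eop ρ j l * eop ρ j l' = 0 := by
  obtain ⟨n, hn⟩ : ∃ n, l n ≠ l' n := by
    by_contra hh; push Not at hh; exact h (MonoidHom.ext hh)
  have h1 : eop ρ j l * ρ (j n) * eop ρ j l' = (l n).val • (eop ρ j l * eop ρ j l') := by
    rw [eop_right, smul_mul_assoc]
  rw [mul_assoc, eop_left, mul_smul_comm] at h1
  rw [← sub_eq_zero, ← sub_smul] at h1
  rcases smul_eq_zero.mp h1 with h2 | h2
  · exact absurd (Units.ext (sub_eq_zero.mp h2)).symm hn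
  · exact h2

lemma eop_idem : eop ρ j l * eop ρ j l = eop ρ j l := by
  conv_lhs => enter [1]; unfold eop
  rw [smul_mul_assoc, Finset.sum_mul]
  have : ∀ n, ((l n)⁻¹ : ℂˣ).val • ρ (j n) * eop ρ j l = eop ρ j l := by
    intro n
    rw [smul_mul_assoc, eop_left, smul_smul]; simp
  simp only [this, Finset.sum_const, Finset.card_univ]
  rw [← Nat.cast_smul_eq_nsmul ℂ, smul_smul, inv_mul_cancel₀, one_smul]
  exact_mod_cast Fintype.card_ne_zero

lemma eop_conj (l' : N →* ℂˣ) (g : G) (τ : N ≃ N) (h : ∀ n, g * j n = j (τ n) * g)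
    (hl : ∀ n, l n = l' (τ n)) : ρ g * eop ρ j l = eop ρ j l' * ρ g := by
  unfold eop
  rw [mul_smul_comm, smul_mul_assoc, Finset.mul_sum, Finset.sum_mul]
  congr 1
  apply Fintype.sum_equiv τ
  intro n
  rw [mul_smul_comm, smul_mul_assoc, ← map_mul, ← map_mul, h, hl]

lemma eop_vanish (g : G) (n m : N) (h : j n * g = g * j m) (hl : l n ≠ l m) :
    eop ρ j l * ρ g * eop ρ j l = 0 := by
  have h1 : eop ρ j l * ρ (j n * g) * eop ρ j l = (l n).val • (eop ρ j l * ρ g * eop ρ j l) := by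
    rw [map_mul, ← mul_assoc, eop_right]; simp only [smul_mul_assoc]
  rw [h, map_mul, mul_assoc, mul_assoc, eop_left] at h1
  simp only [mul_smul_comm] at h1
  rw [← mul_assoc, ← sub_eq_zero, ← sub_smul] at h1
  rcases smul_eq_zero.mp h1 with h2 | h2
  · exact absurd (Units.ext (sub_eq_zero.mp h2)).symm hl
  · exact h2
end gen

lemma faith_eop {G N : Type} [Group G] [Finite G] [Group N] [Fintype N] (j : N →* G)
    (hj : Function.Injective j) (l : N →* ℂˣ) :
    ∃ (X : Type) (_ : AddCommGroup X) (_ : Module ℂ X)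
    (_ : FiniteDimensional ℂ X) (ρ : Representation ℂ G X), Irr ρ ∧ eop ρ j l ≠ 0 := by
  classical
  obtain ⟨X, i1, i2, i3, ρ, hρ, h⟩ := faith2 j (fun n => ((l n)⁻¹ : ℂˣ).val) 1 (by
    rw [Finset.sum_eq_single 1]
    · simp
    · intro b _ hb
      rw [if_neg]
      intro h; exact hb (hj (by rw [h, map_one]))
    · simp)
  refine ⟨X, i1, i2, i3, ρ, hρ, ?_⟩
  intro h1; apply h
  unfold eop at h1
  rcases smul_eq_zero.mp h1 with h2 | h2
  · simp at h2
  · exact h2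

/-- Combination: degree divisible by index. -/
lemma deg_index {G N : Type} [Group G] [Finite G] [Group N] [Finite N] (j : N →* G)
    (hj : Function.Injective j) (l : N →* ℂˣ) (J : Subgroup G)
    (h1 : ∀ g ∈ J, ∃ τ : N ≃ N, (∀ n, g * j n = j (τ n) * g) ∧ ∀ n, l n = l (τ n))
    (h2 : ∀ g, g ∉ J → ∃ n m, j n * g = g * j m ∧ l n ≠ l m) :
    ∃ d ∈ charDegrees G, J.index ∣ d := by
  have := Fintype.ofFinite N
  obtain ⟨X, i1, i2, i3, ρ, hρ, h⟩ := faith_eop j hj l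
  refine ⟨_, br1 hρ, hρ.index_dvd J (eop ρ j l) (eop_idem _ _ _) ?_ ?_ h⟩
  · intro g hg
    obtain ⟨τ, ht, hl⟩ := h1 g hg
    exact eop_conj ρ j l l g τ ht hl
  · intro g hg
    obtain ⟨n, m, h3, h4⟩ := h2 g hg
    exact eop_vanish ρ j l g n m h3 h4

lemma deg_stab {G : Type} [Group G] [Finite G] (N : Subgroup G) [hN : N.Normal] (l : N →* ℂˣ) (J : Subgroup G)
    (hJ : ∀ g, g ∈ J ↔ ∀ n, l (MulAut.conjNormal g n) = l n) :
    ∃ d ∈ charDegrees G, J.index ∣ d := by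
  apply deg_index N.subtype N.subtype_injective l J
  · intro g hg
    refine ⟨(MulAut.conjNormal g : MulAut N).toEquiv, ?_, ?_⟩
    · intro n
      simp
    · intro n
      exact ((hJ g).mp hg n).symm
  · intro g hg
    rw [hJ] at hg
    push Not at hg
    obtain ⟨n, hn⟩ := hg
    exact ⟨MulAut.conjNormal g n, n, by simp, hn⟩

lemma inflate {G H : Type} [Group G] [Finite G] [Group H] (π : G →* H)
    (hπ : Function.Surjective π) {d : ℕ} (hd : d ∈ charDegrees H) : d ∈ charDegrees G := by
  obtain ⟨X, i1, i2, i3, ρ, hρ, rfl⟩ := br2 hd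
  have : Irr (ρ.comp π : Representation ℂ G X) := by
    refine ⟨hρ.nontriv, ?_⟩
    intro W hW
    apply hρ.eq
    intro h x hx
    obtain ⟨g, rfl⟩ := hπ h
    exact hW g x hx
  exact br1 this

lemma tensor_deg {S R : Type} [Group S] [Group R] [Finite S] [Finite R] {a b : ℕ}
    (ha : a ∈ charDegrees S) (hb : b ∈ charDegrees R) : a * b ∈ charDegrees (S × R) := by
  classical
  have := Fintype.ofFinite S
  have := Fintype.ofFinite R
  obtain ⟨V, hV, rfl⟩ := ha
  obtain ⟨W, hW, rfl⟩ := hb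
  rw [FDRep.simple_iff_char_is_norm_one] at hV hW
  let ρ1 : Representation ℂ (S × R) V := V.ρ.comp (MonoidHom.fst S R)
  let ρ2 : Representation ℂ (S × R) W := W.ρ.comp (MonoidHom.snd S R)
  refine ⟨FDRep.of (ρ1.tprod ρ2), ?_, ?_⟩
  · rw [FDRep.simple_iff_char_is_norm_one]
    have h : ∀ g : S × R, (FDRep.of (ρ1.tprod ρ2)).character g = V.character g.1 * W.character g.2 := by
      intro g
      have := congrFun (Representation.char_tensor ρ1 ρ2) g
      exact this
    simp only [h]
    rw [Fintype.sum_prod_type, Nat.card_prod, Nat.cast_mul, ← hV, ← hW, Finset.sum_mul]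
    apply Finset.sum_congr rfl
    intro s _
    rw [Finset.mul_sum]
    apply Finset.sum_congr rfl
    intro r _
    simp only [Prod.fst_inv, Prod.snd_inv]
    ring
  · exact Module.finrank_tensorProduct

lemma comm_of_deg {R : Type} [Group R] [Finite R] (h : ∀ d ∈ charDegrees R, d = 1) (x y : R) :
    x * y = y * x := by
  classical
  by_contra hxy
  obtain ⟨X, i1, i2, i3, ρ, hρ, h1⟩ := faith2 (fun k : Bool => if k then x * y else y * x)
    (fun k => if k then 1 else -1) (x * y) (by simp [Ne.symm hxy])
  apply h1
  simp only [Fintype.sum_bool, if_true, map_mul, Bool.false_eq_true, if_false, one_smul, neg_smul]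
  rw [← sub_eq_add_neg, sub_eq_zero]
  have hd := h _ (br1 hρ)
  obtain ⟨v, hv, hv2⟩ := finrank_eq_one_iff'.mp hd
  have : ∀ T : Module.End ℂ X, ∃ c : ℂ, T = c • 1 := by
    intro T
    obtain ⟨c, hc⟩ := hv2 (T v)
    refine ⟨c, ?_⟩
    ext w
    obtain ⟨d, rfl⟩ := hv2 w
    rw [map_smul, ← hc, smul_comm]; rfl
  obtain ⟨c, hc⟩ := this (ρ x)
  rw [hc]; simp


abbrev SL2 (F : Type) [Field F] := Matrix.SpecialLinearGroup (Fin 2) F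

section sl
variable {F : Type} [Field F]

lemma sl_ext {s t : SL2 F} (h1 : s 0 0 = t 0 0) (h2 : s 0 1 = t 0 1) (h3 : s 1 0 = t 1 0)
    (h4 : s 1 1 = t 1 1) : s = t := by
  ext i j; fin_cases i <;> fin_cases j <;> assumption

lemma m00 (s t : SL2 F) : (s * t) 0 0 = s 0 0 * t 0 0 + s 0 1 * t 1 0 := by
  rw [Matrix.SpecialLinearGroup.coe_mul, Matrix.mul_apply, Fin.sum_univ_two]
lemma m01 (s t : SL2 F) : (s * t) 0 1 = s 0 0 * t 0 1 + s 0 1 * t 1 1 := by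
  rw [Matrix.SpecialLinearGroup.coe_mul, Matrix.mul_apply, Fin.sum_univ_two]
lemma m10 (s t : SL2 F) : (s * t) 1 0 = s 1 0 * t 0 0 + s 1 1 * t 1 0 := by
  rw [Matrix.SpecialLinearGroup.coe_mul, Matrix.mul_apply, Fin.sum_univ_two]
lemma m11 (s t : SL2 F) : (s * t) 1 1 = s 1 0 * t 0 1 + s 1 1 * t 1 1 := by
  rw [Matrix.SpecialLinearGroup.coe_mul, Matrix.mul_apply, Fin.sum_univ_two]
lemma sl_det (s : SL2 F) : s 0 0 * s 1 1 - s 0 1 * s 1 0 = 1 := by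
  have := s.2; rwa [Matrix.det_fin_two] at this
lemma i00 (s : SL2 F) : s⁻¹ 0 0 = s 1 1 := by
  rw [Matrix.SpecialLinearGroup.SL2_inv_expl]; rfl
lemma i01 (s : SL2 F) : s⁻¹ 0 1 = - s 0 1 := by
  rw [Matrix.SpecialLinearGroup.SL2_inv_expl]; rfl
lemma i10 (s : SL2 F) : s⁻¹ 1 0 = - s 1 0 := by
  rw [Matrix.SpecialLinearGroup.SL2_inv_expl]; rfl
lemma i11 (s : SL2 F) : s⁻¹ 1 1 = s 0 0 := by
  rw [Matrix.SpecialLinearGroup.SL2_inv_expl]; rfl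
lemma o00 : (1 : SL2 F) 0 0 = 1 := rfl
lemma o01 : (1 : SL2 F) 0 1 = 0 := rfl
lemma o10 : (1 : SL2 F) 1 0 = 0 := rfl
lemma o11 : (1 : SL2 F) 1 1 = 1 := rfl

lemma ones (F : Type) [Field F] : (1 : SL2 F) 0 0 = 1 ∧ (1 : SL2 F) 0 1 = 0 ∧ (1 : SL2 F) 1 0 = 0 ∧
    (1 : SL2 F) 1 1 = 1 := ⟨rfl, rfl, rfl, rfl⟩

def mk4 (a b c d : F) (h : a * d - b * c = 1) : SL2 F :=
  ⟨!![a, b; c, d], by rw [Matrix.det_fin_two_of]; exact h⟩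

def uu (x : F) : SL2 F := mk4 1 x 0 1 (by ring)
def vv (x : F) : SL2 F := mk4 1 0 x 1 (by ring)
def dg (t : Fˣ) : SL2 F := mk4 t 0 0 (t⁻¹ : Fˣ) (by simp)
def ww : SL2 F := mk4 0 (-1) 1 0 (by ring)

lemma uu00 (x : F) : uu x 0 0 = 1 := rfl
lemma uu01 (x : F) : uu x 0 1 = x := rfl
lemma uu10 (x : F) : uu x 1 0 = 0 := rfl
lemma uu11 (x : F) : uu x 1 1 = 1 := rfl
lemma vv00 (x : F) : vv x 0 0 = 1 := rfl
lemma vv01 (x : F) : vv x 0 1 = 0 := rfl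
lemma vv10 (x : F) : vv x 1 0 = x := rfl
lemma vv11 (x : F) : vv x 1 1 = 1 := rfl
lemma dg00 (t : Fˣ) : dg t 0 0 = t := rfl
lemma dg01 (t : Fˣ) : dg t 0 1 = 0 := rfl
lemma dg10 (t : Fˣ) : dg t 1 0 = 0 := rfl
lemma dg11 (t : Fˣ) : dg t 1 1 = (t : F)⁻¹ := by rw [← Units.val_inv_eq_inv_val]; rfl
lemma ww00 : (ww : SL2 F) 0 0 = 0 := rfl
lemma ww01 : (ww : SL2 F) 0 1 = -1 := rfl
lemma ww10 : (ww : SL2 F) 1 0 = 1 := rfl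
lemma ww11 : (ww : SL2 F) 1 1 = 0 := rfl
lemma k00 (a b c d : F) (h) : mk4 a b c d h 0 0 = a := rfl
lemma k01 (a b c d : F) (h) : mk4 a b c d h 0 1 = b := rfl
lemma k10 (a b c d : F) (h) : mk4 a b c d h 1 0 = c := rfl
lemma k11 (a b c d : F) (h) : mk4 a b c d h 1 1 = d := rfl

attribute [grind =] m00 m01 m10 m11 i00 i01 i10 i11 uu00 uu01 uu10 uu11 vv00 vv01 vv10 vv11
  dg00 dg01 dg10 dg11 ww00 ww01 ww10 ww11 k00 k01 k10 k11

lemma uu_add (x y : F) : uu (x + y) = uu x * uu y := by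
  apply sl_ext <;> grind
lemma uu_zero : uu (0 : F) = 1 := by
  have := ones F
  apply sl_ext <;> grind
lemma vv_zero : vv (0 : F) = 1 := by
  have := ones F
  apply sl_ext <;> grind
lemma vv_add (x y : F) : vv (x + y) = vv x * vv y := by
  apply sl_ext <;> grind
lemma dg_mul (x y : Fˣ) : dg (x * y) = dg x * dg y := by
  apply sl_ext
  · simp only [m00, dg00, dg01, Units.val_mul]; ring
  · simp only [m01, dg00, dg01]; ring
  · simp only [m10, dg10, dg11]; ring
  · simp only [m11, dg10, dg11, Units.val_mul, mul_inv]; ring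
lemma dg_one : dg (1 : Fˣ) = 1 := by
  apply sl_ext <;> simp [dg00, dg01, dg10, dg11]
lemma uu_inj {x y : F} (h : uu x = uu y) : x = y := by
  rw [← uu01 x, h, uu01]
lemma vv_inj {x y : F} (h : vv x = vv y) : x = y := by
  rw [← vv10 x, h, vv10]
lemma uu_neg (x : F) : (uu x)⁻¹ = uu (-x) := by
  apply sl_ext <;> grind
lemma vv_neg (x : F) : (vv x)⁻¹ = vv (-x) := by
  apply sl_ext <;> grind
lemma dg_uu (t : Fˣ) (x : F) : dg t * uu x = uu (t ^ 2 * x) * dg t := by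
  have := t.ne_zero
  apply sl_ext <;> grind
lemma dg_vv (t : Fˣ) (x : F) : dg t * vv (t ^ 2 * x) = vv x * dg t := by
  have := t.ne_zero
  apply sl_ext <;> grind
lemma ww_uu (x : F) : ww * uu x = vv (-x) * ww := by
  apply sl_ext <;> grind
lemma ww_vv (x : F) : ww * vv x = uu (-x) * ww := by
  apply sl_ext <;> grind
lemma ww_dg (t : Fˣ) : ww * dg t = dg t⁻¹ * ww := by
  have := t.ne_zero
  apply sl_ext
  · simp only [m00, ww00, ww01, dg10, dg00, dg01, ww10]; ring
  · simp [m01, ww01, ww00, ww11, dg00, dg01, dg11]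
  · simp [m10, ww01, ww00, ww11, ww10, dg00, dg01, dg11, dg10]
  · simp [m11, ww01, ww00, ww11, ww10, dg00, dg01, dg11, dg10]

lemma bruhat (s : SL2 F) (c : Fˣ) (h : s 1 0 = c) :
    s = uu (s 0 0 / c) * ww * dg c * uu (s 1 1 / c) := by
  have := c.ne_zero
  have := sl_det s
  apply sl_ext <;> grind

def bor (F : Type) [Field F] : Subgroup (SL2 F) where
  carrier := {s | s 1 0 = 0}
  one_mem' := rfl
  mul_mem' := by
    intro a b ha hb
    simp only [Set.mem_ofPred_eq] at *
    rw [m10, ha, hb]; ring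
  inv_mem' := by
    intro a ha
    simp only [Set.mem_ofPred_eq] at *
    rw [i10, ha, neg_zero]

lemma mem_bor {s : SL2 F} : s ∈ bor F ↔ s 1 0 = 0 := Iff.rfl

lemma bor_ne {s : SL2 F} (h : s ∈ bor F) : s 0 0 ≠ 0 := by
  have := sl_det s
  rw [mem_bor.mp h] at this
  intro h0; rw [h0] at this; simp at this

lemma bor_dec {s : SL2 F} (h : s ∈ bor F) (t : Fˣ) (ht : s 0 0 = t) :
    s = dg t * uu (s 0 1 / t) := by
  have := t.ne_zero
  have h1 := sl_det s
  rw [mem_bor] at h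
  apply sl_ext <;> grind

lemma uu_bor (x : F) : uu x ∈ bor F := rfl
lemma dg_bor (t : Fˣ) : dg t ∈ bor F := rfl

def borDiag (F : Type) [Field F] : bor F →* Fˣ where
  toFun s := Units.mk0 (s.1 0 0) (bor_ne s.2)
  map_one' := by ext; rfl
  map_mul' := by
    rintro ⟨a, ha⟩ ⟨b, hb⟩
    ext
    simp only [Subgroup.coe_mul, Units.val_mk0, Units.val_mul]
    simp only [MulMemClass.mk_mul_mk, m00, mem_bor.mp hb]; ring

lemma borDiag_val (s : bor F) : (borDiag F s : F) = s.1 0 0 := rfl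

def borEquiv (F : Type) [Field F] : bor F ≃ Fˣ × F where
  toFun s := (borDiag F s, s.1 0 1 / s.1 0 0)
  invFun p := ⟨dg p.1 * uu p.2, (bor F).mul_mem (dg_bor _) (uu_bor _)⟩
  left_inv := by
    rintro ⟨s, hs⟩
    ext1
    exact (bor_dec hs _ rfl).symm
  right_inv := by
    rintro ⟨t, x⟩
    have := t.ne_zero
    ext
    · simp only [borDiag_val]
      rw [m00, dg00, uu00, dg01]; ring
    · simp only
      rw [m00, dg00, uu00, dg01, m01, dg00, uu01, dg01]; field_simp; ring

noncomputable def bigEquiv (F : Type) [Field F] : {s : SL2 F // s ∉ bor F} ≃ F × Fˣ × F where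
  toFun s := (s.1 0 0 / s.1 1 0, Units.mk0 (s.1 1 0) s.2, s.1 1 1 / s.1 1 0)
  invFun p := ⟨uu p.1 * ww * dg p.2.1 * uu p.2.2, by
    have := p.2.1.ne_zero
    rw [mem_bor]; grind⟩
  left_inv := by
    rintro ⟨s, hs⟩
    ext1
    exact (bruhat s (Units.mk0 _ hs) rfl).symm
  right_inv := by
    rintro ⟨x, t, y⟩
    have := t.ne_zero
    have h1 : (uu x * ww * dg t * uu y : SL2 F) 1 0 = t := by grind
    have h2 : (uu x * ww * dg t * uu y : SL2 F) 0 0 = x * t := by grind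
    have h3 : (uu x * ww * dg t * uu y : SL2 F) 1 1 = t * y := by grind
    ext
    · simp only [h1, h2]; field_simp
    · simp only [h1, Units.val_mk0]
    · simp only [h1, h3]; field_simp

instance [Finite F] : Finite (SL2 F) := by
  unfold SL2; infer_instance

lemma card_bor [Finite F] : Nat.card (bor F) = (Nat.card F - 1) * Nat.card F := by
  have := Fintype.ofFinite F
  classical
  rw [Nat.card_congr (borEquiv F), Nat.card_prod, Nat.card_units]

lemma index_bor [Finite F] : (bor F).index = Nat.card F + 1 := by
  have := Fintype.ofFinite F
  classical
  have h1 : Nat.card (SL2 F) = Nat.card (bor F) + Nat.card {s : SL2 F // s ∉ bor F} := by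
    rw [← Nat.card_sum]
    exact Nat.card_congr (Equiv.sumCompl (fun s => s ∈ bor F)).symm
  rw [Nat.card_congr (bigEquiv F), Nat.card_prod, Nat.card_prod, Nat.card_units] at h1
  rw [← (bor F).card_mul_index, card_bor] at h1
  have hq : 0 < (Nat.card F - 1) * Nat.card F := by
    have := Finite.one_lt_card (α := F)
    have h2 : 0 < Nat.card F - 1 := by omega
    positivity
  apply Nat.eq_of_mul_eq_mul_left hq
  rw [h1]; ring

lemma card_sl [Finite F] : Nat.card (SL2 F) = (Nat.card F - 1) * Nat.card F * (Nat.card F + 1) := by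
  rw [← (bor F).card_mul_index, card_bor, index_bor]

section char2
variable [CharP F 2]

lemma ww_sq : (ww : SL2 F) * ww = 1 := by
  have := ones F
  have h : (-1 : F) = 1 := CharTwo.neg_eq 1
  apply sl_ext <;> grind

lemma ww_eq : (ww : SL2 F) = uu 1 * vv 1 * uu 1 := by
  have h : (-1 : F) = 1 := CharTwo.neg_eq 1
  apply sl_ext <;> grind

lemma dg_eq (t : Fˣ) : dg t = uu (t : F) * vv (t : F)⁻¹ * uu (t : F) * ww := by
  have h : (-1 : F) = 1 := CharTwo.neg_eq 1
  have := t.ne_zero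
  apply sl_ext <;> grind

lemma sl_gen (T : Subgroup (SL2 F)) (h1 : ∀ x : F, uu x ∈ T) (h2 : ∀ x : F, vv x ∈ T) : T = ⊤ := by
  have hw : ww ∈ T := by
    rw [ww_eq]; exact T.mul_mem (T.mul_mem (h1 _) (h2 _)) (h1 _)
  have hd : ∀ t, dg t ∈ T := by
    intro t
    rw [dg_eq]; exact T.mul_mem (T.mul_mem (T.mul_mem (h1 _) (h2 _)) (h1 _)) hw
  rw [Subgroup.eq_top_iff']
  intro s
  by_cases hs : s 1 0 = 0
  · rw [bor_dec (s := s) hs (Units.mk0 _ (bor_ne hs)) rfl]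
    exact T.mul_mem (hd _) (h1 _)
  · rw [bruhat s (Units.mk0 _ hs) rfl]
    exact T.mul_mem (T.mul_mem (T.mul_mem (h1 _) hw) (hd _)) (h1 _)

lemma sl_gen2 (T : Subgroup (SL2 F)) (h1 : ∀ x : F, uu x ∈ T) (h2 : ww ∈ T) : T = ⊤ := by
  apply sl_gen T h1
  intro x
  have := ww_uu (-x)
  rw [neg_neg] at this
  rw [eq_mul_inv_of_mul_eq this.symm]
  exact T.mul_mem (T.mul_mem h2 (h1 _)) (T.inv_mem h2)

/-- subgroups containing U are in the Borel or everything -/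
lemma sl_over_U (T : Subgroup (SL2 F)) (h1 : ∀ x : F, uu x ∈ T) : T ≤ bor F ∨ T = ⊤ := by
  by_cases h : T ≤ bor F
  · exact Or.inl h
  right
  obtain ⟨s, hs, hsb⟩ := Set.not_subset.mp h
  have hc : s 1 0 ≠ 0 := hsb
  have hb := bruhat s (Units.mk0 _ hc) rfl
  have h3 : ww * dg (Units.mk0 _ hc) ∈ T := by
    have : ww * dg (Units.mk0 _ hc) = (uu (s 0 0 / (Units.mk0 _ hc : Fˣ)))⁻¹ * s * (uu (s 1 1 / (Units.mk0 _ hc : Fˣ)))⁻¹ := by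
      rw [eq_mul_inv_iff_mul_eq, eq_inv_mul_iff_mul_eq, ← mul_assoc, ← mul_assoc]
      exact hb.symm
    rw [this]
    exact T.mul_mem (T.mul_mem (T.inv_mem (h1 _)) hs) (T.inv_mem (h1 _))
  set c := Units.mk0 _ hc
  apply sl_gen T h1
  intro x
  have h4 : vv x = (ww * dg c) * uu (- ((c : F)⁻¹ ^ 2 * x)) * (ww * dg c)⁻¹ := by
    have := c.ne_zero
    apply eq_mul_inv_of_mul_eq
    rw [mul_assoc ww, dg_uu, ← mul_assoc ww, ww_uu, ← mul_assoc]
    congr 3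
    field_simp
  rw [h4]
  exact T.mul_mem (T.mul_mem h3 (h1 _)) (T.inv_mem h3)

end char2
end sl

/-- orbit of infinity -/
def orbF {F : Type} [Field F] (T : Subgroup (SL2 F)) : Set F :=
  {x | ∃ s ∈ T, s 1 0 ≠ 0 ∧ x = s 0 0 / s 1 0}

lemma card_orb {F : Type} [Field F] [Finite F] (T : Subgroup (SL2 F)) :
    Nat.card T = Nat.card (T ⊓ bor F : Subgroup (SL2 F)) * (1 + Nat.card (orbF T)) := by
  classical
  let φ : T → Option (orbF T) := fun s =>
    if h : s.1 1 0 = 0 then none else some ⟨s.1 0 0 / s.1 1 0, s.1, s.2, h, rfl⟩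
  have hφ : Function.Surjective φ := by
    rintro (_ | ⟨x, s, hs, h, rfl⟩)
    · exact ⟨1, by simp [φ, o10]⟩
    · exact ⟨⟨s, hs⟩, by simp [φ, h]⟩
  have hrel : ∀ s t : T, φ s = φ t ↔ s⁻¹ * t ∈ (bor F).subgroupOf T := by
    intro s t
    rw [Subgroup.mem_subgroupOf, mem_bor]
    simp only [Subgroup.coe_mul, Subgroup.coe_inv, m10, i10, i11]
    have h1 := sl_det s.1
    have h2 := sl_det t.1
    by_cases hs : s.1 1 0 = 0 <;> by_cases ht : t.1 1 0 = 0
    · simp [φ, hs, ht]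
    · have : s.1 0 0 ≠ 0 := bor_ne hs
      simp [φ, hs, ht, this]
    · have : t.1 0 0 ≠ 0 := bor_ne ht
      simp [φ, hs, ht, this]
    · simp only [φ, hs, ht, dif_neg, not_false_eq_true, Option.some.injEq]
      refine Iff.trans Subtype.ext_iff ?_
      refine Iff.trans (div_eq_div_iff hs ht) ?_
      constructor
      · intro h; linear_combination h
      · intro h; linear_combination h
  have e : (T ⧸ (bor F).subgroupOf T) ≃ Option (orbF T) :=
    (Quotient.congrRight (fun s t => by
      rw [QuotientGroup.leftRel_apply, ← hrel]; exact (Setoid.ker_def (f := φ)).symm)).trans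
      (Setoid.quotientKerEquivOfSurjective φ hφ)
  rw [Subgroup.card_eq_card_quotient_mul_card_subgroup ((bor F).subgroupOf T), Nat.card_congr e,
    Finite.card_option, mul_comm, add_comm]
  congr 1
  rw [← Subgroup.inf_subgroupOf_left]
  exact Nat.card_congr (Subgroup.subgroupOfEquivOfLe inf_le_left).toEquiv


section comb
variable {F : Type} [Field F] [Finite F] [CharP F 2]

lemma exists_sqrt (y : F) : ∃ t : F, t ^ 2 = y := by
  have hi : Function.Injective (fun t : F => t ^ 2) := frobenius_inj F 2
  exact (Finite.surjective_of_injective hi) y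

lemma exists_scale {x y : F} (hx : x ≠ 0) (hy : y ≠ 0) : ∃ t : Fˣ, (t : F) ^ 2 * x = y := by
  obtain ⟨t, ht⟩ := exists_sqrt (y / x)
  have : t ≠ 0 := by
    rintro rfl
    have : y / x ≠ 0 := div_ne_zero hy hx
    apply this; rw [← ht]; simp
  exact ⟨Units.mk0 t this, by rw [Units.val_mk0, ht]; field_simp⟩

lemma add_self0 (x : F) : x + x = 0 := CharTwo.add_self_eq_zero x

def uHom (F : Type) [Field F] : Multiplicative F →* SL2 F where
  toFun x := uu x.toAdd
  map_one' := uu_zero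
  map_mul' x y := uu_add _ _

lemma uHom_inj : Function.Injective (uHom F) := fun x y h =>
  Multiplicative.toAdd.injective (uu_inj (x := x.toAdd) (y := y.toAdd) h)

variable {V : Type} [CommGroup V] [Finite V] [MulDistribMulAction (SL2 F) V]

lemma comb1 (h8 : 4 ∣ Nat.card F)
    (hfix : ∀ v : V, (∀ s : SL2 F, s • v = v) → v = 1) (b0 : ℕ)
    (hb1 : b0 ∣ Nat.card F + 1)
    (hi2 : ∀ v : V, ¬ 2 * b0 ∣ (MulAction.stabilizer (SL2 F) v).index)
    (hi3 : ∀ v : V, ∀ a : ℕ, a.Prime → a ∣ Nat.card F - 1 →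
      Nat.card F + 1 ∣ (MulAction.stabilizer (SL2 F) v).index →
      ¬ a ∣ (MulAction.stabilizer (SL2 F) v).index)
    (l : V) (hl : l ≠ 1) (hu : ∀ x : F, uu x • l = l) : False := by
  have hq1 := Finite.one_lt_card (α := F)
  set q := Nat.card F with hq
  set T := MulAction.stabilizer (SL2 F) l with hT
  have huT : ∀ x : F, uu x ∈ T := fun x => MulAction.mem_stabilizer_iff.mpr (hu x)
  have hTb : T ≤ bor F := by
    rcases sl_over_U T huT with h | h
    · exact h
    · exfalso; apply hl; apply hfix
      intro s
      have : s ∈ T := by rw [h]; trivial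
      exact this
  have hidx : T.relIndex (bor F) * (q + 1) = T.index := by
    rw [hq, ← index_bor]; exact Subgroup.relIndex_mul_index hTb
  have hUT : q ∣ Nat.card T := by
    have h1 : (uHom F).range ≤ T := by
      rintro _ ⟨x, rfl⟩; exact huT _
    have h2 := Subgroup.card_dvd_of_le h1
    rwa [← Nat.card_congr (MonoidHom.ofInjective (uHom_inj (F := F))).toEquiv,
      Nat.card_congr Multiplicative.toAdd] at h2
  have hrel : T.relIndex (bor F) ∣ q - 1 := by
    have h1 := T.card_mul_index
    rw [card_sl, ← hq, ← hidx] at h1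
    obtain ⟨k, hk⟩ := hUT
    rw [hk] at h1
    refine ⟨k, ?_⟩
    apply Nat.eq_of_mul_eq_mul_right (show 0 < q * (q + 1) by positivity)
    rw [← mul_assoc, ← h1]; ring
  have hone : T.relIndex (bor F) = 1 := by
    by_contra hne
    obtain ⟨a, ha, had⟩ := Nat.exists_prime_and_dvd hne
    exact hi3 l a ha (had.trans hrel) ⟨_, by rw [mul_comm]; exact hidx.symm⟩
      (had.trans ⟨_, hidx.symm⟩)
  have hbT : bor F ≤ T := Subgroup.relIndex_eq_one.mp hone
  have hdT : ∀ t : Fˣ, dg t • l = l := fun t => hbT (dg_bor t)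
  -- second character
  set n : V := l * (ww : SL2 F) • l with hn
  have hn1 : n ≠ 1 := by
    intro h
    have h1 : (ww : SL2 F) • l = l⁻¹ := (eq_inv_of_mul_eq_one_right h)
    have h2 : vv (1 : F) ∈ T := by
      rw [hT, MulAction.mem_stabilizer_iff]
      have h3 : (ww : SL2 F) • vv (1 : F) • l = (ww : SL2 F) • l := by
        rw [← mul_smul, ww_vv, mul_smul, h1, smul_inv', hu]
      exact MulAction.injective _ h3
    have := hTb h2
    rw [mem_bor, vv10] at this
    exact one_ne_zero this
  set T' := MulAction.stabilizer (SL2 F) n with hT'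
  have hwT : ww ∈ T' := by
    rw [hT', MulAction.mem_stabilizer_iff, hn, smul_mul', ← mul_smul, ww_sq, one_smul, mul_comm]
  have hdT' : ∀ t : Fˣ, dg t ∈ T' := by
    intro t
    rw [hT', MulAction.mem_stabilizer_iff, hn, smul_mul', hdT]
    congr 1
    have := ww_dg (F := F) t⁻¹
    rw [inv_inv] at this
    rw [← mul_smul, ← this, mul_smul, hdT]
  have hT'top : T' ≠ ⊤ := by
    intro h
    apply hn1; apply hfix
    intro s
    have : s ∈ T' := by rw [h]; trivial
    exact this
  have huT' : ∀ x : F, uu x ∈ T' → x = 0 := by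
    intro x hx
    by_contra hx0
    apply hT'top
    apply sl_gen2 T' _ hwT
    intro y
    by_cases hy : y = 0
    · rw [hy, uu_zero]; exact T'.one_mem
    obtain ⟨t, ht⟩ := exists_scale hx0 hy
    rw [← ht, eq_mul_inv_of_mul_eq (dg_uu t x).symm]
    exact T'.mul_mem (T'.mul_mem (hdT' t) hx) (T'.inv_mem (hdT' t))
  have hcb : Nat.card (T' ⊓ bor F : Subgroup (SL2 F)) = q - 1 := by
    rw [hq, ← Nat.card_units]
    symm
    refine Nat.card_congr (Equiv.ofBijective (fun t : Fˣ => ⟨dg t, hdT' t, dg_bor t⟩) ⟨?_, ?_⟩)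
    · intro t t' h
      have h1 := congrArg (fun s : (T' ⊓ bor F : Subgroup (SL2 F)) => s.1 0 0) h
      exact Units.ext h1
    · rintro ⟨s, hs1, hs2⟩
      have hd := bor_dec hs2 (Units.mk0 _ (bor_ne hs2)) rfl
      refine ⟨Units.mk0 _ (bor_ne hs2), Subtype.ext ?_⟩
      have h1 : uu (s 0 1 / (Units.mk0 _ (bor_ne hs2) : Fˣ)) ∈ T' := by
        rw [eq_inv_mul_of_mul_eq hd.symm]
        exact T'.mul_mem (T'.inv_mem (hdT' _)) hs1
      have h2 := huT' _ h1
      rw [h2, uu_zero, mul_one] at hd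
      exact hd.symm
  have h0 : (0 : F) ∈ orbF T' := ⟨ww, hwT, by rw [ww10]; exact one_ne_zero, by rw [ww00]; simp⟩
  have hcard : Nat.card (orbF T') = 1 ∨ Nat.card (orbF T') = q := by
    by_cases h : ∃ x ∈ orbF T', x ≠ 0
    · right
      obtain ⟨x, ⟨s, hs, hc, rfl⟩, hx⟩ := h
      have : orbF T' = Set.univ := by
        rw [Set.eq_univ_iff_forall]
        intro y
        by_cases hy : y = 0
        · rw [hy]; exact h0
        obtain ⟨t, ht⟩ := exists_scale hx hy
        have := t.ne_zero
        refine ⟨dg t * s, T'.mul_mem (hdT' t) hs, ?_, ?_⟩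
        · rw [m10, dg10, dg11]; simp [hc]
        · rw [m00, m10, dg00, dg10, dg11, dg01, ← ht]
          generalize s 1 0 = c at hc ⊢
          generalize s 0 0 = a
          simp only [zero_mul, one_mul, zero_add, add_zero, Units.val_inv_eq_inv_val]
          field_simp
      rw [this, Nat.card_congr (Equiv.Set.univ F)]
    · left
      push Not at h
      have : orbF T' = {0} := Set.eq_singleton_iff_unique_mem.mpr ⟨h0, h⟩
      rw [this]; simp
  have hT'c := card_orb T'
  rw [hcb] at hT'c
  have h2T : 2 ∣ Nat.card T' := by
    have h1 : orderOf (⟨ww, hwT⟩ : T') = 2 := by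
      apply orderOf_eq_prime
      · rw [sq]; exact Subtype.ext ww_sq
      · intro h
        have := congrArg (fun s : T' => s.1 1 0) h
        exact one_ne_zero this
    exact (dvd_of_eq h1.symm).trans (orderOf_dvd_natCard (⟨ww, hwT⟩ : T'))
  obtain ⟨k, hk⟩ := h8
  have hidx' := T'.card_mul_index
  rw [card_sl, ← hq] at hidx'
  rcases hcard with h | h
  · rw [h] at hT'c
    rw [hT'c] at hidx'
    have h5 : (q - 1) * (2 * T'.index) = (q - 1) * (q * (q + 1)) := by
      rw [← mul_assoc, ← mul_assoc]; exact hidx'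
    have h6 := Nat.eq_of_mul_eq_mul_left (show 0 < q - 1 by omega) h5
    obtain ⟨m, hm⟩ := hb1
    apply hi2 n
    refine ⟨k * m, ?_⟩
    apply Nat.eq_of_mul_eq_mul_left (show 0 < 2 by omega)
    rw [h6, hm, hk]; ring
  · rw [h] at hT'c
    rw [hT'c] at h2T
    rcases (Nat.Prime.dvd_mul Nat.prime_two).mp h2T with h | h <;> omega

lemma comb2 [Nontrivial V] (h8 : 4 ∣ Nat.card F) (a0 b0 : ℕ)
    (ha1 : a0 ∣ Nat.card F - 1)
    (hb : b0.Prime) (hb1 : b0 ∣ Nat.card F + 1)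
    (hi1 : ∀ v : V, ¬ 2 * a0 ∣ (MulAction.stabilizer (SL2 F) v).index)
    (hi2 : ∀ v : V, ¬ 2 * b0 ∣ (MulAction.stabilizer (SL2 F) v).index)
    (hno : ∀ l : V, l ≠ 1 → ¬ ∀ x : F, uu x • l = l) : False := by
  have hq1 := Finite.one_lt_card (α := F)
  set q := Nat.card F with hq
  let K : V → AddSubgroup F := fun l =>
    { carrier := {x | uu x • l = l}
      add_mem' := by
        intro x y hx hy
        simp only [Set.mem_ofPred_eq] at *
        rw [uu_add, mul_smul, hy, hx]
      zero_mem' := by simp only [Set.mem_ofPred_eq]; rw [uu_zero, one_smul]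
      neg_mem' := by
        intro x hx
        simp only [Set.mem_ofPred_eq] at *
        rw [← uu_neg, inv_smul_eq_iff, hx] }
  have hK : ∀ l x, x ∈ K l ↔ uu x • l = l := fun l x => Iff.rfl
  obtain ⟨l, hl, hmax⟩ : ∃ l : V, l ≠ 1 ∧ ∀ m : V, m ≠ 1 → Nat.card (K m) ≤ Nat.card (K l) := by
    have hne : ({l : V | l ≠ 1}).Nonempty := exists_ne 1
    obtain ⟨l, hl, h⟩ := Set.exists_max_image {l : V | l ≠ 1} (fun l => Nat.card (K l)) (Set.toFinite _) hne
    exact ⟨l, hl, h⟩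
  have hinv : ∀ x, x ∉ K l → uu x • l = l⁻¹ := by
    intro x hx
    apply eq_inv_of_mul_eq_one_right
    by_contra hne
    have h1 := hmax _ hne
    have hle : K l ≤ K (l * uu x • l) := by
      intro y hy
      rw [hK] at hy ⊢
      rw [smul_mul', hy, ← mul_smul, ← uu_add, add_comm, uu_add, mul_smul, hy]
    have hxm : x ∈ K (l * uu x • l) := by
      rw [hK, smul_mul', ← mul_smul, ← uu_add, add_self0, uu_zero, one_smul, mul_comm]
    have h2 : K l = K (l * uu x • l) := by
      apply SetLike.coe_injective
      exact Set.eq_of_subset_of_ncard_le hle h1 (Set.toFinite _)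
    exact hx (h2 ▸ hxm)
  set H := K l with hH
  have hadd : ∀ x y, x ∉ H → y ∉ H → x + y ∈ H := by
    intro x y hx hy
    rw [hK, uu_add, mul_smul, hinv y hy, smul_inv', hinv x hx, inv_inv]
  obtain ⟨y0, hy0⟩ : ∃ y, y ∉ H := by
    by_contra h
    push Not at h
    exact hno l hl h
  have hHi : H.index = 2 := by
    rw [AddSubgroup.index_eq_two_iff]
    refine ⟨y0, fun b => ?_⟩
    by_cases hb : b ∈ H
    · right
      refine ⟨hb, fun h => hy0 ?_⟩
      have := H.sub_mem h hb
      simpa using this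
    · left
      exact ⟨hadd _ _ hb hy0, hb⟩
  have hHc : Nat.card H * 2 = q := by rw [← hHi]; exact H.card_mul_index
  set T := MulAction.stabilizer (SL2 F) l with hT
  have huT : ∀ x, uu x ∈ T ↔ x ∈ H := fun x => Iff.rfl
  have hdiag : ∀ s ∈ T ⊓ bor F, s 0 0 = 1 := by
    rintro s ⟨hs1, hs2⟩
    set t := Units.mk0 _ (bor_ne hs2) with ht
    have hd : s = dg t * uu (s 0 1 / t) := bor_dec hs2 t rfl
    have hconj : ∀ h : F, s * uu h = uu (t ^ 2 * h) * s := by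
      intro h
      rw [hd, mul_assoc, ← uu_add, add_comm, uu_add, ← mul_assoc, dg_uu, mul_assoc]
    have hmap : ∀ h ∈ H, (t : F) ^ 2 * h ∈ H := by
      intro h hh
      rw [← huT, eq_mul_inv_of_mul_eq (hconj h).symm]
      exact T.mul_mem (T.mul_mem hs1 hh) (T.inv_mem hs1)
    have hmap2 : ∀ h, (t : F) ^ 2 * h ∈ H → h ∈ H := by
      intro h hh
      rw [← huT, eq_inv_mul_of_mul_eq (hconj h), ← mul_assoc]
      exact T.mul_mem (T.mul_mem (T.inv_mem hs1) hh) hs1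
    have hall : ∀ y, ((t : F) ^ 2 + 1) * y ∈ H := by
      intro y
      rw [add_mul, one_mul]
      by_cases hy : y ∈ H
      · exact H.add_mem (hmap y hy) hy
      · exact hadd _ _ (fun h => hy (hmap2 y h)) hy
    have h1 : (t : F) ^ 2 + 1 = 0 := by
      by_contra h
      apply hy0
      have := hall (y0 / ((t : F) ^ 2 + 1))
      rwa [mul_div_cancel₀ _ h] at this
    have h2 : ((t : F) + 1) ^ 2 = 0 := by rw [CharTwo.add_sq, one_pow, h1]
    have h3 := pow_eq_zero_iff (two_ne_zero) |>.mp h2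
    have h4 : (t : F) = 1 := by rw [← sub_eq_zero, CharTwo.sub_eq_add, h3]
    exact h4
  have hcb : Nat.card (T ⊓ bor F : Subgroup (SL2 F)) = Nat.card H := by
    symm
    refine Nat.card_congr (Equiv.ofBijective (fun x : H => ⟨uu x.1, x.2, uu_bor x.1⟩) ⟨?_, ?_⟩)
    · intro t t' h
      have h1 := congrArg (fun s : (T ⊓ bor F : Subgroup (SL2 F)) => s.1 0 1) h
      exact Subtype.ext h1
    · rintro ⟨s, hs⟩
      have hd := bor_dec hs.2 1 (hdiag s hs)
      rw [dg_one, one_mul] at hd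
      refine ⟨⟨s 0 1 / (1 : Fˣ), ?_⟩, Subtype.ext hd.symm⟩
      rw [← huT, ← hd]; exact hs.1
  have horb : ∀ x ∈ orbF T, ∀ h ∈ H, h + x ∈ orbF T := by
    rintro _ ⟨s, hs, hc, rfl⟩ h hh
    refine ⟨uu h * s, T.mul_mem hh hs, ?_, ?_⟩
    · rw [m10, uu10, uu11]; simpa using hc
    · rw [m10, m00, uu00, uu01, uu10, uu11]
      generalize s 1 0 = c at hc ⊢
      generalize s 0 0 = a
      simp only [zero_mul, one_mul, zero_add, add_zero]
      field_simp; try ring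
  have hc : Nat.card (orbF T) = 0 ∨ Nat.card (orbF T) = Nat.card H ∨ Nat.card (orbF T) = q := by
    rcases Set.eq_empty_or_nonempty (orbF T) with h | ⟨x, hx⟩
    · left; rw [h]; simp
    right
    by_cases h : ∃ y ∈ orbF T, y - x ∉ H
    · right
      obtain ⟨y, hy, hyx⟩ := h
      have : orbF T = Set.univ := by
        rw [Set.eq_univ_iff_forall]
        intro z
        by_cases hz : z - x ∈ H
        · have := horb x hx _ hz
          simpa using this
        · have h1 := hadd _ _ hz hyx
          have h2 : z - x + (y - x) = z - y := by
            rw [CharTwo.sub_eq_add, CharTwo.sub_eq_add, CharTwo.sub_eq_add]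
            linear_combination add_self0 x
          rw [h2] at h1
          have := horb y hy _ h1
          simpa using this
      rw [this, Nat.card_congr (Equiv.Set.univ F)]
    · left
      push Not at h
      symm
      refine Nat.card_congr (Equiv.ofBijective (fun z : H => ⟨z.1 + x, horb x hx _ z.2⟩) ⟨?_, ?_⟩)
      · intro a b hab
        have := congrArg Subtype.val hab
        exact Subtype.ext (add_right_cancel this)
      · rintro ⟨y, hy⟩
        exact ⟨⟨y - x, h y hy⟩, Subtype.ext (sub_add_cancel y x)⟩
  have hTc := card_orb T
  rw [hcb] at hTc
  have hidx := T.card_mul_index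
  rw [card_sl, ← hq, hTc] at hidx
  obtain ⟨k, hk⟩ := h8
  have hHk : Nat.card H = 2 * k := by omega
  have hk0 : 0 < k := by omega
  obtain ⟨m, hm⟩ := hb1
  obtain ⟨m', hm'⟩ := ha1
  rw [hHk] at hidx
  rcases hc with h | h | h
  · rw [h] at hidx
    apply hi1 l
    refine ⟨m' * (q + 1), ?_⟩
    apply Nat.eq_of_mul_eq_mul_left (show 0 < 2 * k by omega)
    rw [← hT]
    calc 2 * k * T.index = 2 * k * (1 + 0) * T.index := by ring
      _ = _ := by rw [hidx, hm', hk]; ring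
  · rw [h, hHk] at hidx
    have e1 : (2 * k) * ((1 + 2 * k) * T.index) = (2 * k) * (2 * ((q - 1) * (q + 1))) := by
      rw [← mul_assoc, hidx, hk]; ring
    have e2 := Nat.eq_of_mul_eq_mul_left (show 0 < 2 * k by omega) e1
    have d2 : 2 ∣ T.index := by
      have : 2 ∣ (1 + 2 * k) * T.index := ⟨_, e2⟩
      rcases (Nat.Prime.dvd_mul Nat.prime_two).mp this with h | h
      · omega
      · exact h
    have db : b0 ∣ T.index := by
      have : b0 ∣ (1 + 2 * k) * T.index := by
        rw [e2, hm]; exact ⟨2 * ((q - 1) * m), by ring⟩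
      rcases (Nat.Prime.dvd_mul hb).mp this with h | h
      · exfalso
        have h1 : b0 ∣ 2 * (1 + 2 * k) := h.mul_left 2
        have h2 : b0 ∣ q + 1 := ⟨m, hm⟩
        have h3 : 2 * (1 + 2 * k) = (q + 1) + 1 := by omega
        rw [h3] at h1
        exact hb.one_lt.ne' (Nat.dvd_one.mp ((Nat.dvd_add_right h2).mp h1))
      · exact h
    have hodd : Nat.Coprime 2 b0 := by
      rw [Nat.coprime_primes Nat.prime_two hb]
      rintro rfl
      omega
    exact hi2 l (hodd.mul_dvd_of_dvd_of_dvd d2 db)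
  · rw [h] at hidx
    apply hi1 l
    refine ⟨m', ?_⟩
    apply Nat.eq_of_mul_eq_mul_left (show 0 < 2 * k * (1 + q) by positivity)
    rw [← hT, hidx, hm', hk]; ring

theorem comb [Nontrivial V] (h8 : 4 ∣ Nat.card F)
    (hfix : ∀ v : V, (∀ s : SL2 F, s • v = v) → v = 1) (a0 b0 : ℕ)
    (ha1 : a0 ∣ Nat.card F - 1)
    (hb : b0.Prime) (hb1 : b0 ∣ Nat.card F + 1)
    (hi1 : ∀ v : V, ¬ 2 * a0 ∣ (MulAction.stabilizer (SL2 F) v).index)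
    (hi2 : ∀ v : V, ¬ 2 * b0 ∣ (MulAction.stabilizer (SL2 F) v).index)
    (hi3 : ∀ v : V, ∀ a : ℕ, a.Prime → a ∣ Nat.card F - 1 →
      Nat.card F + 1 ∣ (MulAction.stabilizer (SL2 F) v).index →
      ¬ a ∣ (MulAction.stabilizer (SL2 F) v).index) : False := by
  apply comb2 (F := F) (V := V) h8 a0 b0 ha1 hb hb1 hi1 hi2
  intro l hl hu
  exact comb1 h8 hfix b0 hb1 hi2 hi3 l hl hu
end comb


section schur
open scoped commutatorElement
variable {F : Type} [Field F] [Finite F] [CharP F 2]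

lemma gtriv {C : Type} [CommGroup C] (g : F → C) (hadd : ∀ x y, g (x + y) = g x * g y)
    (hinv : ∀ x, x ≠ 0 → g x⁻¹ = g x) (h1 : g 1 = 1) (h8 : 8 ≤ Nat.card F) (z : F) : g z = 1 := by
  classical
  have : Fintype F := Fintype.ofFinite F
  have h0 : g 0 = 1 := by
    have := hadd 0 0
    rw [add_zero] at this
    exact left_eq_mul.mp this
  have hsq : ∀ x, g x * g x = 1 := fun x => by rw [← hadd, add_self0, h0]
  have hA : ∀ z a : F, z ≠ 0 → z + a ≠ 0 → a ≠ 0 → g (z ^ 2 / a) = g z * g a := by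
    intro z a hz hza ha
    have e1 : (z⁻¹ + (z + a)⁻¹) = (z ^ 2 / a + z)⁻¹ := by
      have h5 : z ^ 2 / a + z = z * (z + a) / a := by field_simp
      have h6 : z⁻¹ + (z + a)⁻¹ = (z + z + a) / (z * (z + a)) := by field_simp; ring
      rw [h5, h6, add_self0, zero_add, inv_div]
    have h7 : z ^ 2 / a + z ≠ 0 := by
      have h5 : z ^ 2 / a + z = z * (z + a) / a := by field_simp
      rw [h5]
      exact div_ne_zero (mul_ne_zero hz hza) ha
    have h8 := congrArg g e1
    rw [hinv _ h7, hadd, hadd, hinv _ hz, hinv _ hza, hadd, ← mul_assoc, hsq, one_mul] at h8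
    calc g (z ^ 2 / a) = g (z ^ 2 / a) * g z * g z := by rw [mul_assoc, hsq, mul_one]
      _ = g z * g a := by rw [← h8, mul_comm]
  have hB : ∀ z : F, g (z ^ 2) = g z := by
    intro z
    by_cases hz : z = 0
    · rw [hz]; simp
    by_cases hz1 : z + 1 = 0
    · have : z = 1 := by rw [← sub_eq_zero, CharTwo.sub_eq_add, hz1]
      rw [this]; simp
    have := hA z 1 hz hz1 one_ne_zero
    rwa [div_one, h1, mul_one] at this
  -- choose w
  have hcard : ∀ s : Finset F, s.card < 8 → ∃ x, x ∉ s := by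
    intro s hs
    by_contra h
    push Not at h
    have : s = Finset.univ := Finset.eq_univ_iff_forall.mpr h
    rw [this, Finset.card_univ, ← Nat.card_eq_fintype_card] at hs
    omega
  obtain ⟨w, hw⟩ := hcard {0, 1} (lt_of_le_of_lt Finset.card_le_two (by norm_num))
  simp only [Finset.mem_insert, Finset.mem_singleton, not_or] at hw
  have hw1 : w + 1 ≠ 0 := by
    intro h; apply hw.2; rw [← sub_eq_zero, CharTwo.sub_eq_add, h]
  have hz0 : w ^ 2 + 0 = w ^ 2 := add_zero _
  have hC : ∀ c : F, c ≠ 0 → w * c ≠ 1 → g ((w ^ 2 + 1) * c) = g w := by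
    intro c hc hwc
    have ha : c⁻¹ ≠ 0 := inv_ne_zero hc
    have hs : w + c⁻¹ ≠ 0 := by
      intro h
      apply hwc
      have : w = c⁻¹ := by rw [← sub_eq_zero, CharTwo.sub_eq_add, h]
      rw [this, inv_mul_cancel₀ hc]
    have := hA w c⁻¹ hw.1 hs ha
    rw [div_inv_eq_mul, hinv c hc] at this
    rw [add_mul, one_mul, hadd, this, mul_assoc, hsq, mul_one]
  have hD : ∃ e, ∀ c, c ≠ 0 → c ≠ e → g c = g w := by
    have hw2 : w ^ 2 + 1 ≠ 0 := by
      have : w ^ 2 + 1 = (w + 1) ^ 2 := by rw [CharTwo.add_sq, one_pow]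
      rw [this]; exact pow_ne_zero _ hw1
    refine ⟨(w ^ 2 + 1) / w, fun c hc hce => ?_⟩
    have := hC (c / (w ^ 2 + 1)) (div_ne_zero hc hw2) (by
      intro h; apply hce
      rw [← mul_div_assoc, div_eq_one_iff_eq hw2] at h
      rw [eq_div_iff hw.1, mul_comm, h])
    rwa [mul_div_cancel₀ _ hw2] at this
  obtain ⟨e, he⟩ := hD
  obtain ⟨x, hx⟩ := hcard {0, e} (lt_of_le_of_lt Finset.card_le_two (by norm_num))
  simp only [Finset.mem_insert, Finset.mem_singleton, not_or] at hx
  obtain ⟨y, hy⟩ := hcard {0, e, x, x + e} (lt_of_le_of_lt Finset.card_le_four (by norm_num))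
  simp only [Finset.mem_insert, Finset.mem_singleton, not_or] at hy
  have hgw : g w = 1 := by
    have h3 := hadd x y
    rw [he x hx.1 hx.2, he y hy.1 hy.2.1, hsq, he] at h3
    · exact h3
    · intro h; apply hy.2.2.1
      rw [← sub_eq_zero, CharTwo.sub_eq_add, add_comm, h]
    · intro h; apply hy.2.2.2
      rw [← h, ← add_assoc, add_self0, zero_add]
  by_cases hz : z = 0
  · rw [hz, h0]
  by_cases hze : z = e
  · have h3 : z = x + (x + z) := by rw [← add_assoc, add_self0, zero_add]
    rw [h3, hadd, he x hx.1 hx.2, he (x + z), hsq]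
    · intro h; apply hx.2
      rw [← hze, ← sub_eq_zero, CharTwo.sub_eq_add, h]
    · intro h; apply hx.1
      rw [hze] at h
      exact add_eq_right.mp h
  · rw [he z hz hze, hgw]

variable {E : Type} [Group E] [Finite E] (π : E →* SL2 F)

lemma comm_lift (hz : π.ker ≤ Subgroup.center E) {a a' b b' : E} (ha : π a = π a') (hb : π b = π b') :
    ⁅a, b⁆ = ⁅a', b'⁆ := by
  have h1 : a'⁻¹ * a ∈ Subgroup.center E := hz (by rw [MonoidHom.mem_ker]; simp [ha])
  have h2 : b'⁻¹ * b ∈ Subgroup.center E := hz (by rw [MonoidHom.mem_ker]; simp [hb])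
  obtain ⟨x, hx, rfl⟩ : ∃ x ∈ Subgroup.center E, a = a' * x := ⟨_, h1, by group⟩
  obtain ⟨y, hy, rfl⟩ : ∃ y ∈ Subgroup.center E, b = b' * y := ⟨_, h2, by group⟩
  rw [Subgroup.mem_center_iff] at hx hy
  simp only [commutatorElement_def, mul_inv_rev]
  have hx' : ∀ g, x * g = g * x := fun g => (hx g).symm
  have hy' : ∀ g, y * g = g * y := fun g => (hy g).symm
  calc a' * x * (b' * y) * (x⁻¹ * a'⁻¹) * (y⁻¹ * b'⁻¹)
      = a' * (x * (b' * y)) * x⁻¹ * a'⁻¹ * y⁻¹ * b'⁻¹ := by group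
    _ = a' * b' * (y * a'⁻¹) * y⁻¹ * b'⁻¹ := by rw [hx']; group
    _ = _ := by rw [hy']; group

lemma U_lift (hπ : Function.Surjective π) (hz : π.ker ≤ Subgroup.center E) (h8 : 8 ≤ Nat.card F)
    (a b : E) (x y : F) (ha : π a = uu x) (hb : π b = uu y) : a * b = b * a := by
  choose σ hσ using hπ
  have hcent : ∀ x y : F, ⁅σ (uu x), σ (uu y)⁆ ∈ Subgroup.center E := by
    intro x y; apply hz
    rw [MonoidHom.mem_ker, map_commutatorElement, hσ, hσ, commutatorElement_eq_one_iff_mul_comm,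
      ← uu_add, ← uu_add, add_comm]
  let β : F → F → Subgroup.center E := fun x y => ⟨_, hcent x y⟩
  have hβ : ∀ a b x y, π a = uu x → π b = uu y → ((β x y : Subgroup.center E) : E) = ⁅a, b⁆ := by
    intro a b x y ha hb
    exact comm_lift π hz (by rw [hσ, ha]) (by rw [hσ, hb])
  have hr : ∀ x y z, β x (y + z) = β x y * β x z := by
    intro x y z
    apply Subtype.ext
    rw [hβ (σ (uu x)) (σ (uu y) * σ (uu z)) _ _ (hσ _) (by rw [map_mul, hσ, hσ, uu_add])]
    have h1 := Subgroup.mem_center_iff.mp (hcent x z) (σ (uu y))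
    rw [Subgroup.coe_mul]
    change _ = ⁅σ (uu x), σ (uu y)⁆ * ⁅σ (uu x), σ (uu z)⁆
    generalize hk : ⁅σ (uu x), σ (uu z)⁆ = k at h1 ⊢
    rw [commutatorElement_def] at hk ⊢
    rw [commutatorElement_def]
    have : σ (uu x) * σ (uu z) * (σ (uu x))⁻¹ = k * σ (uu z) := by rw [← hk]; group
    calc _ = σ (uu x) * σ (uu y) * (σ (uu x))⁻¹ * (σ (uu x) * σ (uu z) * (σ (uu x))⁻¹) *
          (σ (uu z))⁻¹ * (σ (uu y))⁻¹ := by group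
      _ = σ (uu x) * σ (uu y) * (σ (uu x))⁻¹ * (k * (σ (uu y))⁻¹) := by rw [this]; group
      _ = _ := by
        have h2 := Subgroup.mem_center_iff.mp (hcent x z) (σ (uu y))⁻¹
        rw [commutatorElement_def, hk] at h2
        rw [← h2]; group
  have hs : ∀ x y, β y x = (β x y)⁻¹ := by
    intro x y
    apply Subtype.ext
    exact (commutatorElement_inv _ _).symm
  have hself : ∀ x, β x x = 1 := fun x => Subtype.ext (commutatorElement_self _)
  have hz0 : ∀ x, β x 0 = 1 := by
    intro x
    have := hr x 0 0
    rw [add_zero] at this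
    exact left_eq_mul.mp this
  have hsc : ∀ (c x y : F), c ≠ 0 → β (c * x) (c * y) = β x y := by
    intro c x y hc
    obtain ⟨t, ht⟩ := exists_scale (F := F) one_ne_zero hc
    rw [mul_one] at ht
    apply Subtype.ext
    have key : ∀ x : F, π (σ (dg t) * σ (uu x) * (σ (dg t))⁻¹) = uu (c * x) := by
      intro x
      rw [map_mul, map_mul, map_inv, hσ, hσ, dg_uu, mul_inv_cancel_right, ht]
    rw [hβ _ _ _ _ (key x) (key y)]
    have h1 : ⁅σ (dg t) * σ (uu x) * (σ (dg t))⁻¹, σ (dg t) * σ (uu y) * (σ (dg t))⁻¹⁆ =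
      σ (dg t) * ⁅σ (uu x), σ (uu y)⁆ * (σ (dg t))⁻¹ := by
      simp only [commutatorElement_def]; group
    rw [h1, Subgroup.mem_center_iff.mp (hcent x y) (σ (dg t)), mul_inv_cancel_right]
  letI : CommGroup (Subgroup.center E) := { (inferInstance : Group (Subgroup.center E)) with
    mul_comm := fun a b => Subtype.ext (Subgroup.mem_center_iff.mp b.2 a) }
  have hg := gtriv (F := F) (fun z => β 1 z) (hr 1) (by
    intro z hz
    have h1 := hsc z 1 z⁻¹ hz
    rw [mul_one, mul_inv_cancel₀ hz, hs] at h1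
    change β 1 z⁻¹ = β 1 z
    rw [← h1]
    apply inv_eq_of_mul_eq_one_right
    rw [← hr, add_self0, hz0]) (hself 1) h8
  have hall : β x y = 1 := by
    by_cases hx : x = 0
    · rw [hx, hs, hz0, inv_one]
    · have := hsc x 1 (y / x) hx
      rw [mul_one, mul_div_cancel₀ _ hx] at this
      rw [this]; exact hg _
  have h1 := hβ a b x y ha hb
  rw [hall] at h1
  exact commutatorElement_eq_one_iff_mul_comm.mp h1.symm

lemma transfer_kill (hπ : Function.Surjective π) (hz : π.ker ≤ Subgroup.center E)
    (hperf : commutator E = ⊤) (H : Subgroup (SL2 F))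
    (hab : ∀ a b : E, π a ∈ H → π b ∈ H → a * b = b * a) (z : E) (hzk : z ∈ π.ker) :
    z ^ H.index = 1 := by
  let D := H.comap π
  letI : CommGroup D := { (inferInstance : Group D) with
    mul_comm := fun a b => Subtype.ext (hab a b a.2 b.2) }
  have h1 := MonoidHom.transfer_eq_pow (MonoidHom.id D) z (by
    intro k g _
    have := Subgroup.mem_center_iff.mp (hz (π.ker.pow_mem hzk k)) g
    rw [mul_assoc, ← this, inv_mul_cancel_left])
  have h2 : MonoidHom.transfer (MonoidHom.id D) z = 1 := by
    have : z ∈ commutator E := by rw [hperf]; trivial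
    exact Abelianization.commutator_subset_ker (MonoidHom.transfer (MonoidHom.id D)) this
  rw [h2] at h1
  have h3 := congrArg Subtype.val h1
  have h4 : D.index = H.index := Subgroup.index_comap_of_surjective H hπ
  rw [← h4]
  exact h3.symm

lemma card_uRange : Nat.card (uHom F).range = Nat.card F := by
  rw [← Nat.card_congr (MonoidHom.ofInjective (uHom_inj (F := F))).toEquiv,
      Nat.card_congr Multiplicative.toAdd]

def dHom (F : Type) [Field F] : Fˣ →* SL2 F where
  toFun := dg
  map_one' := dg_one
  map_mul' := dg_mul

lemma dHom_inj : Function.Injective (dHom F) := fun x y h => by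
  have := congrArg (fun s : SL2 F => s 0 0) h
  exact Units.ext this

lemma exists_nonsplit : ∃ s : SL2 F, orderOf s = Nat.card F + 1 := by
  have hq1 := Finite.one_lt_card (α := F)
  have : Fact (Nat.Prime 2) := ⟨Nat.prime_two⟩
  let K := FiniteField.Extension F 2 2
  have hf : Finite K := Module.finite_of_finite F
  have hc : Nat.card K = Nat.card F ^ 2 := FiniteField.natCard_extension F 2 2
  let b := Module.finBasisOfFinrankEq F K (FiniteField.finrank_extension F 2 2)
  obtain ⟨γ, hγ⟩ := IsCyclic.exists_generator (α := Kˣ)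
  have hγo : orderOf γ = Nat.card F ^ 2 - 1 := by
    rw [orderOf_eq_card_of_forall_mem_zpowers hγ, Nat.card_units, hc]
  have hfac : Nat.card F ^ 2 - 1 = (Nat.card F - 1) * (Nat.card F + 1) := by
    rw [mul_comm, ← Nat.sq_sub_sq, one_pow]
  let x : Kˣ := γ ^ (Nat.card F - 1)
  have hx : orderOf x = Nat.card F + 1 := by
    rw [orderOf_pow_of_dvd (by omega) (by rw [hγo, hfac]; exact Dvd.intro _ rfl), hγo, hfac,
      Nat.mul_div_cancel_left _ (by omega)]
  have hn : Algebra.norm F (x : K) = 1 := by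
    apply (algebraMap F K).injective
    rw [FiniteField.algebraMap_norm_eq_pow, hc, hfac, Nat.mul_div_cancel_left _ (by omega), map_one,
      ← Units.val_pow_eq_pow_val, ← hx, pow_orderOf_eq_one, Units.val_one]
  have hd : (Algebra.leftMulMatrix b (x : K)).det = 1 := by
    rw [← Algebra.norm_eq_matrix_det, hn]
  refine ⟨⟨_, hd⟩, ?_⟩
  have h1 := orderOf_injective (Algebra.leftMulMatrix b).toRingHom.toMonoidHom
    (Algebra.leftMulMatrix_injective b) (x : K)
  rw [orderOf_units, hx] at h1
  rw [← h1]
  exact (orderOf_injective (Matrix.SpecialLinearGroup.coeMonoidHom (ι := Fin 2) (R := F))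
    Subtype.coe_injective _).symm

theorem schur (hπ : Function.Surjective π) (hz : π.ker ≤ Subgroup.center E)
    (hperf : commutator E = ⊤) (h8 : 8 ≤ Nat.card F) (h2 : 2 ∣ Nat.card F) :
    Function.Injective π := by
  have hcyc : ∀ H : Subgroup (SL2 F), IsCyclic H → ∀ a b : E, π a ∈ H → π b ∈ H → a * b = b * a := by
    intro H hH a b ha hb
    have := ((π.subgroupComap H).isMulCommutative_of_isCyclic_of_ker_le_center (by
      intro x hx
      rw [Subgroup.mem_center_iff]
      intro y
      have h1 : x.1 ∈ π.ker := congrArg Subtype.val hx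
      exact Subtype.ext (Subgroup.mem_center_iff.mp (hz h1) y))).is_comm.comm ⟨a, ha⟩ ⟨b, hb⟩
    exact congrArg Subtype.val this
  rw [injective_iff_map_eq_one]
  intro z hzk
  have hq0 : 0 < Nat.card F - 1 := by omega
  set q := Nat.card F with hq
  have k1 : z ^ ((q - 1) * (q + 1)) = 1 := by
    have := transfer_kill π hπ hz hperf (uHom F).range (by
      rintro a b ⟨x, hx⟩ ⟨y, hy⟩
      exact U_lift π hπ hz h8 a b x.toAdd y.toAdd hx.symm hy.symm) z hzk
    have h3 := (uHom F).range.card_mul_index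
    rw [card_uRange, card_sl, ← hq] at h3
    have h4 : (uHom F).range.index = (q - 1) * (q + 1) := by
      apply Nat.eq_of_mul_eq_mul_left (show 0 < q by omega)
      rw [h3]; ring
    rwa [h4] at this
  have k2 : z ^ (q * (q + 1)) = 1 := by
    have := transfer_kill π hπ hz hperf (dHom F).range (hcyc _ (isCyclic_of_surjective (dHom F).rangeRestrict (dHom F).rangeRestrict_surjective)) z hzk
    have h3 := (dHom F).range.card_mul_index
    rw [← Nat.card_congr (MonoidHom.ofInjective (dHom_inj (F := F))).toEquiv, Nat.card_units,
      card_sl, ← hq] at h3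
    have h4 : (dHom F).range.index = q * (q + 1) := by
      apply Nat.eq_of_mul_eq_mul_left (show 0 < q - 1 by omega)
      rw [h3]; ring
    rwa [h4] at this
  have k3 : z ^ ((q - 1) * q) = 1 := by
    obtain ⟨s, hs⟩ := exists_nonsplit (F := F)
    have := transfer_kill π hπ hz hperf (Subgroup.zpowers s) (hcyc _ inferInstance) z hzk
    have h3 := (Subgroup.zpowers s).card_mul_index
    rw [Nat.card_zpowers, hs, card_sl, ← hq] at h3
    have h4 : (Subgroup.zpowers s).index = (q - 1) * q := by
      apply Nat.eq_of_mul_eq_mul_left (show 0 < q + 1 by omega)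
      rw [h3]; ring
    rwa [h4] at this
  have d1 := orderOf_dvd_of_pow_eq_one k1
  have d2 := orderOf_dvd_of_pow_eq_one k2
  have d3 := orderOf_dvd_of_pow_eq_one k3
  have c1 : Nat.Coprime (q - 1) q := by
    have := Nat.coprime_self_add_right (m := q - 1) (n := 1)
    rw [Nat.sub_add_cancel (by omega)] at this
    exact this.mpr (Nat.coprime_one_right _)
  have c2 : Nat.Coprime q (q + 1) := (Nat.coprime_self_add_right).mpr (Nat.coprime_one_right _)
  have c3 : Nat.Coprime (q - 1) (q + 1) := by
    have h : q + 1 = (q - 1) + 2 := by omega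
    rw [h, Nat.coprime_self_add_right, Nat.coprime_comm, Nat.prime_two.coprime_iff_not_dvd]
    omega
  rw [← orderOf_eq_one_iff]
  have e1 : orderOf z ∣ q + 1 := by
    have := Nat.dvd_gcd d1 d2
    rwa [Nat.gcd_mul_right, c1.gcd_eq_one, one_mul] at this
  have e2 : Nat.Coprime ((q - 1) * q) (q + 1) := Nat.Coprime.mul_left c3 c2
  exact Nat.eq_one_of_dvd_coprimes e2 d3 e1
end schur


section sldeg
variable {F : Type} [Field F] [Fintype F] [CharP F 2]

noncomputable def psi (ψ : AddChar F ℂ) (a : F) : Multiplicative F →* ℂˣ :=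
  MonoidHom.toHomUnits (AddChar.toMonoidHom (ψ.mulShift a))

lemma psi_val (ψ : AddChar F ℂ) (a : F) (x : Multiplicative F) :
    (psi ψ a x : ℂ) = ψ (a * x.toAdd) := rfl

lemma exists_prim (F : Type) [Field F] [Fintype F] : ∃ ψ : AddChar F ℂ, ψ.IsPrimitive := by
  obtain ⟨ψ, h⟩ := AddChar.exists_apply_ne_zero.mpr (one_ne_zero (α := F))
  refine ⟨ψ, AddChar.IsPrimitive.of_ne_one ?_⟩
  rintro rfl
  exact h (by simp)

lemma psi_zero (ψ : AddChar F ℂ) : psi ψ 0 = 1 := by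
  apply MonoidHom.ext
  intro x
  apply Units.ext
  rw [psi_val, zero_mul, AddChar.map_zero_eq_one]; rfl

variable {X : Type} [AddCommGroup X] [Module ℂ X] [FiniteDimensional ℂ X]
  (ρ : Representation ℂ (SL2 F) X)

noncomputable def Ea (ψ : AddChar F ℂ) (a : F) : Module.End ℂ X := eop ρ (uHom F) (psi ψ a)

lemma Ea_sum {ψ : AddChar F ℂ} (hψ : ψ.IsPrimitive) : ∑ a : F, Ea ρ ψ a = 1 := by
  classical
  unfold Ea eop
  rw [← Finset.smul_sum, Finset.sum_comm]
  have h1 : ∀ y : Multiplicative F, ∑ x : F, ((psi ψ x y)⁻¹ : ℂˣ).val • ρ (uHom F y) =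
      (if y = 1 then (Fintype.card F : ℂ) else 0) • ρ (uHom F y) := by
    intro y
    rw [← Finset.sum_smul]
    congr 1
    have h2 : ∀ x : F, ((psi ψ x y)⁻¹ : ℂˣ).val = ψ (x * (- y.toAdd)) := by
      intro x
      rw [Units.val_inv_eq_inv_val, psi_val, mul_neg, AddChar.map_neg_eq_inv]
    simp_rw [h2]
    rw [AddChar.sum_mulShift _ hψ]
    by_cases hy : y = 1
    · rw [if_pos hy, if_pos (by rw [hy]; simp)]
    · rw [if_neg hy, if_neg (by rw [neg_eq_zero]; exact hy)]; simp
  rw [Finset.sum_congr rfl (fun y _ => h1 y)]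
  simp only [ite_smul, zero_smul, Finset.sum_ite_eq', Finset.mem_univ, if_true, map_one]
  rw [smul_smul, Fintype.card_multiplicative, inv_mul_cancel₀, one_smul]
  exact_mod_cast Fintype.card_ne_zero

lemma Ea_dg (ψ : AddChar F ℂ) (a : F) (t : Fˣ) : ρ (dg t) * Ea ρ ψ (a * t ^ 2) = Ea ρ ψ a * ρ (dg t) := by
  refine eop_conj ρ (uHom F) _ _ (dg t) (τ := Multiplicative.toAdd.trans
    ((Units.mulLeft (t ^ 2)).trans Multiplicative.ofAdd)) ?_ ?_
  · intro n
    have := dg_uu t n.toAdd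
    exact this
  · intro n
    apply Units.ext
    rw [psi_val, psi_val]
    congr 1
    change a * t ^ 2 * n.toAdd = a * ((t ^ 2 : Fˣ) * n.toAdd)
    push_cast; ring

lemma Ea_idem (ψ : AddChar F ℂ) (a : F) : Ea ρ ψ a * Ea ρ ψ a = Ea ρ ψ a := eop_idem ..

lemma Ea_tr (ψ : AddChar F ℂ) (a : F) (ha : a ≠ 0) :
    LinearMap.trace ℂ X (Ea ρ ψ a) = LinearMap.trace ℂ X (Ea ρ ψ 1) := by
  obtain ⟨t, ht⟩ := exists_scale (F := F) one_ne_zero ha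
  rw [mul_one] at ht
  have h := Ea_dg ρ ψ 1 t
  rw [one_mul, ht] at h
  have h2 : Ea ρ ψ a = ρ (dg t)⁻¹ * (Ea ρ ψ 1 * ρ (dg t)) := by
    rw [← h, ← mul_assoc, ← map_mul, inv_mul_cancel, map_one, one_mul]
  rw [h2, LinearMap.trace_mul_comm, mul_assoc, ← map_mul, mul_inv_cancel, map_one, mul_one]

noncomputable def rk (ψ : AddChar F ℂ) (a : F) : ℕ := Module.finrank ℂ (LinearMap.range (Ea ρ ψ a))

lemma rk_zero {ψ : AddChar F ℂ} {a : F} (h : rk ρ ψ a = 0) : Ea ρ ψ a = 0 := by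
  unfold rk at h
  rw [Submodule.finrank_eq_zero] at h
  exact LinearMap.range_eq_bot.mp h

lemma dim_eq {ψ : AddChar F ℂ} (hψ : ψ.IsPrimitive) :
    Module.finrank ℂ X = rk ρ ψ 0 + (Nat.card F - 1) * rk ρ ψ 1 := by
  classical
  have h := congrArg (LinearMap.trace ℂ X) (Ea_sum ρ hψ)
  rw [map_sum, LinearMap.trace_one, Fintype.sum_eq_add_sum_compl 0] at h
  have h1 : ∀ a ∈ ({0}ᶜ : Finset F), LinearMap.trace ℂ X (Ea ρ ψ a) = rk ρ ψ 1 := by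
    intro a ha
    rw [Ea_tr ρ ψ a (by simpa using ha), trace_idem _ (Ea_idem ..)]; rfl
  rw [Finset.sum_congr rfl h1, Finset.sum_const, Finset.card_compl, Finset.card_singleton,
    trace_idem _ (Ea_idem ..), nsmul_eq_mul] at h
  rw [Nat.card_eq_fintype_card]
  have h2 : (Module.finrank ℂ X : ℂ) = ((rk ρ ψ 0 + (Fintype.card F - 1) * rk ρ ψ 1 : ℕ) : ℂ) := by
    rw [← h]; push_cast; rfl
  exact_mod_cast h2

lemma dvd_of_E0 (h : eop ρ (uHom F) 1 = 0) : Nat.card F - 1 ∣ Module.finrank ℂ X := by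
  obtain ⟨ψ, hψ⟩ := exists_prim F
  rw [dim_eq ρ hψ]
  have : rk ρ ψ 0 = 0 := by
    unfold rk Ea
    rw [psi_zero, h]; simp
  rw [this, zero_add]
  exact Dvd.intro _ rfl

def adj (s : SL2 F) : SL2 F := mk4 (s 1 1) (s 0 1) (s 1 0) (s 0 0) (by linear_combination sl_det s)

lemma adj_mul (s t : SL2 F) : adj (s * t) = adj t * adj s := by
  unfold adj
  apply sl_ext <;> grind

lemma adj_uu (x : F) : adj (uu x) = uu x := by
  unfold adj
  apply sl_ext <;> grind

lemma E_uu_l (ψ : AddChar F ℂ) (a x : F) : Ea ρ ψ a * ρ (uu x) = ψ (a * x) • Ea ρ ψ a :=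
  eop_right ρ (uHom F) (psi ψ a) (Multiplicative.ofAdd x)

lemma E_uu_r (ψ : AddChar F ℂ) (a x : F) : ρ (uu x) * Ea ρ ψ a = ψ (a * x) • Ea ρ ψ a :=
  eop_left ρ (uHom F) (psi ψ a) (Multiplicative.ofAdd x)

lemma uu_conj (s : SL2 F) (y : F) (hs : s 1 0 = 0) : uu (s 0 0 ^ 2 * y) * s = s * uu y := by
  have hdet := sl_det s
  rw [hs, mul_zero, sub_zero] at hdet
  apply sl_ext
  · rw [m00, m00, uu00, uu01, uu00, uu10, hs]; ring
  · rw [m01, m01, uu00, uu01, uu01, uu11]; linear_combination (s 0 0 * y) * hdet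
  · rw [m10, m10, uu10, uu11, uu00, uu10, hs]; ring
  · rw [m11, m11, uu10, uu11, uu01, uu11, hs]; ring

lemma E_adj {ψ : AddChar F ℂ} (hψ : ψ.IsPrimitive) (s : SL2 F) :
    Ea ρ ψ 1 * ρ s * Ea ρ ψ 1 = Ea ρ ψ 1 * ρ (adj s) * Ea ρ ψ 1 := by
  have hb : ∀ s : SL2 F, s 1 0 = 0 → s 0 0 ≠ 1 → Ea ρ ψ 1 * ρ s * Ea ρ ψ 1 = 0 := by
    intro s hs hne
    have hdet := sl_det s
    rw [hs, mul_zero, sub_zero] at hdet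
    obtain ⟨y, hy⟩ : ∃ y, ψ.mulShift (s 0 0 ^ 2 - 1) y ≠ 1 := by
      have := hψ (a := s 0 0 ^ 2 - 1) (by
        rw [sub_ne_zero]
        intro h
        apply hne
        have h2 : (s 0 0 + 1) ^ 2 = 0 := by rw [CharTwo.add_sq, one_pow, h, add_self0]
        have h3 := pow_eq_zero_iff (two_ne_zero) |>.mp h2
        rw [← sub_eq_zero, CharTwo.sub_eq_add, h3])
      rwa [AddChar.ne_one_iff] at this
    apply eop_vanish ρ (uHom F) (psi ψ 1) s (Multiplicative.ofAdd (s 0 0 ^ 2 * y)) (Multiplicative.ofAdd y)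
    · exact uu_conj s y hs
    · intro h
      apply hy
      have h1 := congrArg Units.val h
      rw [psi_val, psi_val] at h1
      simp only [one_mul, toAdd_ofAdd] at h1
      rw [AddChar.mulShift_apply, sub_mul, one_mul, AddChar.map_sub_eq_div, h1, div_self]
      exact (AddChar.val_isUnit ψ _).ne_zero
  by_cases hc : s 1 0 = 0
  · by_cases h1 : s 0 0 = 1
    · have : adj s = s := by
        have hd := sl_det s
        unfold adj
        apply sl_ext <;> grind
      rw [this]
    · rw [hb s hc h1, hb (adj s) hc]
      have hd := sl_det s
      unfold adj
      rw [k00]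
      grind
  · have key : ∀ s : SL2 F, ∀ c : Fˣ, s 1 0 = c → Ea ρ ψ 1 * ρ s * Ea ρ ψ 1 =
        (ψ ((s 0 0 + s 1 1) / c)) • (Ea ρ ψ 1 * ρ (ww * dg c) * Ea ρ ψ 1) := by
      intro s c h
      conv_lhs => rw [bruhat s c h]
      rw [map_mul, mul_assoc (Ea ρ ψ 1), mul_assoc (ρ _), E_uu_r, mul_assoc (uu _), map_mul, mul_smul_comm,
        mul_smul_comm, ← mul_assoc, ← mul_assoc, E_uu_l, smul_mul_assoc, smul_mul_assoc, smul_smul, add_div,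
        AddChar.map_add_eq_mul, one_mul, one_mul, mul_comm]
    rw [key s (Units.mk0 _ hc) rfl, key (adj s) (Units.mk0 _ hc) rfl]
    congr 2
    unfold adj
    rw [k00, k11, add_comm]

lemma E_mid (ψ : AddChar F ℂ) (s t : SL2 F) :
    (Ea ρ ψ 1 * ρ s * Ea ρ ψ 1) * (Ea ρ ψ 1 * ρ t * Ea ρ ψ 1) =
      (Fintype.card F : ℂ)⁻¹ • ∑ x : Multiplicative F, ((psi ψ 1 x)⁻¹ : ℂˣ).val •
        (Ea ρ ψ 1 * ρ (s * uHom F x * t) * Ea ρ ψ 1) := by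
  have h1 : (Ea ρ ψ 1 * ρ s * Ea ρ ψ 1) * (Ea ρ ψ 1 * ρ t * Ea ρ ψ 1) =
      Ea ρ ψ 1 * ρ s * Ea ρ ψ 1 * (ρ t * Ea ρ ψ 1) := by
    rw [← mul_assoc, ← mul_assoc, mul_assoc (Ea ρ ψ 1 * ρ s), Ea_idem]
    simp only [mul_assoc]
  rw [h1]
  conv_lhs => enter [1, 2]; unfold Ea eop
  rw [mul_smul_comm, smul_mul_assoc, Finset.mul_sum, Finset.sum_mul, Fintype.card_multiplicative]
  congr 1
  apply Finset.sum_congr rfl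
  intro x _
  rw [map_mul, map_mul, mul_smul_comm, smul_mul_assoc]
  simp only [mul_assoc]

lemma rk_one {ψ : AddChar F ℂ} (hψ : ψ.IsPrimitive) (h : Irr ρ) : rk ρ ψ 1 ≤ 1 := by
  apply h.rank_le_one _ (Ea_idem ..)
  intro s t
  rw [E_mid, E_adj ρ hψ s, E_adj ρ hψ t, E_mid]
  congr 1
  apply Finset.sum_congr rfl
  intro x _
  rw [E_adj ρ hψ, adj_mul, adj_mul]
  have : adj (uHom F x) = uHom F x := adj_uu _
  rw [this, mul_assoc (adj t)]

theorem sl_dims (h : Irr ρ) : Module.finrank ℂ X = 1 ∨ Module.finrank ℂ X = Nat.card F - 1 ∨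
    Module.finrank ℂ X = Nat.card F ∨ Module.finrank ℂ X = Nat.card F + 1 := by
  classical
  have hq1 := Finite.one_lt_card (α := F)
  obtain ⟨ψ, hψ⟩ := exists_prim F
  have hd := dim_eq ρ hψ
  have hr := rk_one ρ hψ h
  have := h.nontriv
  rcases Nat.lt_or_ge (rk ρ ψ 1) 1 with h1 | h1
  · left
    have hE : ∀ a, a ≠ 0 → Ea ρ ψ a = 0 := by
      intro a ha
      apply rk_zero
      have := Ea_tr ρ ψ a ha
      rw [trace_idem _ (Ea_idem ..), trace_idem _ (Ea_idem ..)] at this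
      have h2 : rk ρ ψ a = rk ρ ψ 1 := by exact_mod_cast this
      omega
    have h0 : Ea ρ ψ 0 = 1 := by
      rw [← Ea_sum ρ hψ]
      symm
      exact Fintype.sum_eq_single 0 (fun a ha => hE a ha)
    have hu : ∀ x : F, ρ (uu x) = 1 := by
      intro x
      have := E_uu_r ρ ψ 0 x
      rwa [h0, mul_one, zero_mul, AddChar.map_zero_eq_one, one_smul] at this
    have hker : ρ.ker = ⊤ := by
      apply sl_gen
      · exact hu
      · intro x
        have h2 := ww_uu (-x)
        rw [neg_neg] at h2
        rw [MonoidHom.mem_ker, ← mul_inv_eq_iff_eq_mul.mpr h2, map_mul, map_mul, hu, mul_one, ← map_mul,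
          mul_inv_cancel, map_one]
    have htriv : ∀ s, ρ s = 1 := fun s => by
      have : s ∈ ρ.ker := by rw [hker]; trivial
      exact this
    obtain ⟨v, hv⟩ := exists_ne (0 : X)
    rcases h.eq (Submodule.span ℂ {v}) (by intro g x hx; rw [htriv]; exact hx) with h3 | h3
    · rw [Submodule.span_singleton_eq_bot] at h3
      exact absurd h3 hv
    · rw [← finrank_top, ← h3, finrank_span_singleton hv]
  have h1' : rk ρ ψ 1 = 1 := by omega
  rw [h1', mul_one] at hd
  right
  by_cases h0 : rk ρ ψ 0 = 0
  · left; omega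
  suffices Module.finrank ℂ X ≤ Nat.card F + 1 by omega
  obtain ⟨γ, hγ⟩ := IsCyclic.exists_generator (α := Fˣ)
  set W := LinearMap.range (Ea ρ ψ 0) with hW
  have hcom : ∀ t, ρ (dg t) * Ea ρ ψ 0 = Ea ρ ψ 0 * ρ (dg t) := by
    intro t
    have := Ea_dg ρ ψ 0 t
    rwa [zero_mul] at this
  have hinv : ∀ x ∈ W, ρ (dg γ) x ∈ W := by
    rintro _ ⟨y, rfl⟩
    exact ⟨ρ (dg γ) y, (LinearMap.congr_fun (hcom γ) y).symm⟩
  have hWn : Nontrivial W := Module.nontrivial_of_finrank_pos (R := ℂ) (Nat.pos_of_ne_zero h0)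
  obtain ⟨c, hc⟩ := Module.End.exists_eigenvalue ((ρ (dg γ)).restrict hinv)
  obtain ⟨⟨v, hvW⟩, hv, hv0⟩ := hc.exists_hasEigenvector
  have hvv : ρ (dg γ) v = c • v := by
    have := Module.End.mem_eigenspace_iff.mp hv
    exact congrArg Subtype.val this
  have hv0' : v ≠ 0 := fun hh => hv0 (Subtype.ext hh)
  have hdg : ∀ t, ∃ c : ℂ, ρ (dg t) v = c • v := by
    intro t
    obtain ⟨k, rfl⟩ := (mem_powers_iff_mem_zpowers.mpr (hγ t))
    refine ⟨c ^ k, ?_⟩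
    have : ∀ k : ℕ, ρ (dg (γ ^ k)) v = c ^ k • v := by
      intro k
      induction k with
      | zero => rw [pow_zero, pow_zero, dg_one, map_one, one_smul]; rfl
      | succ k ih =>
        rw [pow_succ, dg_mul, map_mul, Module.End.mul_apply, hvv, map_smul, ih, smul_smul, pow_succ, mul_comm]
    exact this k
  have hu : ∀ x : F, ρ (uu x) v = v := by
    intro x
    obtain ⟨y, rfl⟩ := hvW
    have := E_uu_r ρ ψ 0 x
    rw [zero_mul, AddChar.map_zero_eq_one, one_smul] at this
    exact LinearMap.congr_fun this y
  let φ : Option F → X := fun o => o.elim v (fun x => ρ (uu x) (ρ ww v))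
  have horb : ∀ s, ρ s v ∈ Submodule.span ℂ (Set.range φ) := by
    intro s
    by_cases hs : s 1 0 = 0
    · obtain ⟨c, hc⟩ := hdg (Units.mk0 _ (bor_ne hs))
      rw [bor_dec hs (Units.mk0 _ (bor_ne hs)) rfl, map_mul, Module.End.mul_apply, hu, hc]
      exact Submodule.smul_mem _ _ (Submodule.subset_span ⟨none, rfl⟩)
    · obtain ⟨c, hc⟩ := hdg (Units.mk0 _ hs)
      rw [bruhat s (Units.mk0 _ hs) rfl, map_mul, map_mul, map_mul, Module.End.mul_apply, hu,
        Module.End.mul_apply, hc, map_smul]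
      exact Submodule.smul_mem _ _ (Submodule.subset_span ⟨some _, rfl⟩)
  have hspan : Submodule.span ℂ (Set.range fun s => ρ s v) = ⊤ := by
    rcases h.eq (Submodule.span ℂ (Set.range fun s => ρ s v)) (by
      intro g x hx
      induction hx using Submodule.span_induction with
      | mem x hx =>
        obtain ⟨s, rfl⟩ := hx
        apply Submodule.subset_span
        exact ⟨g * s, by simp only [map_mul, Module.End.mul_apply]⟩
      | zero => rw [map_zero]; exact Submodule.zero_mem _
      | add x y _ _ hx hy => rw [map_add]; exact Submodule.add_mem _ hx hy
      | smul a x _ hx => rw [map_smul]; exact Submodule.smul_mem _ _ hx) with h3 | h3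
    · exfalso; apply hv0'
      have : v ∈ Submodule.span ℂ (Set.range fun s => ρ s v) :=
        Submodule.subset_span ⟨1, by simp⟩
      rw [h3] at this
      exact (Submodule.mem_bot ℂ).mp this
    · exact h3
  have htop : Submodule.span ℂ (Set.range φ) = ⊤ := by
    rw [eq_top_iff, ← hspan, Submodule.span_le]
    rintro _ ⟨s, rfl⟩
    exact horb s
  have := finrank_range_le_card (R := ℂ) φ
  rw [Set.finrank, htop, finrank_top, Fintype.card_option, ← Nat.card_eq_fintype_card] at this
  exact this

end sldeg


section cusp
variable {F : Type} [Field F] [Fintype F] [CharP F 2]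

def tr2 (s : SL2 F) : F := s 0 0 + s 1 1

def Ell (x : F) : Prop := ∀ t : F, t ≠ 0 → t + t⁻¹ ≠ x

lemma tr2_uu (s : SL2 F) (k : F) : tr2 (s * uu k) = tr2 s + s 1 0 * k := by
  unfold tr2
  rw [m00, m11, uu00, uu10, uu01, uu11]; ring

noncomputable instance : Fintype (SL2 F) := Fintype.ofFinite _

lemma ZE0 {X : Type} [AddCommGroup X] [Module ℂ X] (ρ : Representation ℂ (SL2 F) X)
    (c : F → ℂ) (h0 : ∑ y, c y = 0) (h1 : ∀ t : F, t ≠ 0 → c (t + t⁻¹) = 0) :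
    (∑ s, c (tr2 s) • ρ s) * eop ρ (uHom F) 1 = 0 := by
  set e := eop ρ (uHom F) 1 with he
  have hue : ∀ s (k : F), ρ (s * uu k) * e = ρ s * e := by
    intro s k
    have := eop_left ρ (uHom F) 1 (Multiplicative.ofAdd k)
    rw [MonoidHom.one_apply, Units.val_one, one_smul] at this
    rw [map_mul, mul_assoc]
    congr 1
  have hk : ∀ k : F, (∑ s, c (tr2 s) • ρ s) * e = ∑ s, c (tr2 s + s 1 0 * k) • (ρ s * e) := by
    intro k
    rw [Finset.sum_mul]
    symm
    apply Fintype.sum_equiv (Equiv.mulRight (uu k))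
    intro s
    rw [Equiv.coe_mulRight, tr2_uu, smul_mul_assoc, hue]
  have hsum : ∑ k : F, (∑ s, c (tr2 s) • ρ s) * e = 0 := by
    rw [Finset.sum_congr rfl (fun k _ => hk k), Finset.sum_comm]
    apply Finset.sum_eq_zero
    intro s _
    rw [← Finset.sum_smul]
    by_cases hs : s 1 0 = 0
    · have hd := sl_det s
      rw [hs, mul_zero, sub_zero] at hd
      have h2 : tr2 s = s 0 0 + (s 0 0)⁻¹ := by
        unfold tr2
        congr 1
        exact eq_inv_of_mul_eq_one_right hd
      have h3 : c (tr2 s) = 0 := by rw [h2]; exact h1 _ (bor_ne hs)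
      rw [Finset.sum_eq_zero, zero_smul]
      intro k _
      rw [hs, zero_mul, add_zero, h3]
    · have : ∑ k : F, c (tr2 s + s 1 0 * k) = ∑ y, c y := by
        apply Fintype.sum_equiv ((Equiv.mulLeft₀ (s 1 0) hs).trans (Equiv.addLeft (tr2 s)))
        intro k; rfl
      rw [this, h0, zero_smul]
  rw [Finset.sum_const, ← Nat.cast_smul_eq_nsmul ℂ] at hsum
  exact (smul_eq_zero.mp hsum).resolve_left (by
    rw [Finset.card_univ]; exact_mod_cast Fintype.card_ne_zero)

theorem cusp {H : Type} [Group H] [Finite H] (ι : SL2 F →* H) (hι : Function.Injective ι)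
    (c : F → ℂ) (h0 : ∑ y, c y = 0) (h1 : ∀ t : F, t ≠ 0 → c (t + t⁻¹) = 0) (x : F) (hx : c x ≠ 0)
    (l : H →* ℂˣ) (hconj : ∀ h, ∃ σ : SL2 F ≃ SL2 F, (∀ s, h * ι s = ι (σ s) * h) ∧
      ∀ s, c (tr2 (σ s)) = (l h).val * c (tr2 s)) :
    ∃ d ∈ charDegrees H, Nat.card F - 1 ∣ d ∧ ∀ h, (l h) ^ d = 1 := by
  classical
  have hs0 : tr2 (mk4 x 1 (-1) 0 (by ring)) = x := by unfold tr2; rw [k00, k11, add_zero]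
  obtain ⟨X, _, _, _, ρ, hirr, hZ⟩ := faith2 ι (fun s => c (tr2 s)) (ι (mk4 x 1 (-1) 0 (by ring))) (by
    simp only [hι.eq_iff]
    rw [Finset.sum_ite_eq']
    simp only [Finset.mem_univ, if_true]
    rwa [hs0])
  set Z := ∑ s, c (tr2 s) • ρ (ι s) with hZd
  have hcomm : ∀ h, Z * ρ h = ((l h).val) • (ρ h * Z) := by
    intro h
    obtain ⟨σ, hσ1, hσ2⟩ := hconj h
    rw [hZd, Finset.sum_mul, Finset.mul_sum, Finset.smul_sum]
    symm
    apply Fintype.sum_equiv σ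
    intro s
    rw [smul_mul_assoc, ← map_mul, ← hσ1, mul_smul_comm, map_mul, hσ2, smul_smul]
  refine ⟨_, br1 hirr, ?_, ?_⟩
  · apply dvd_of_E0 (ρ.comp ι)
    exact hirr.cancel Z hZ (fun h => ⟨_, hcomm h⟩) _ (ZE0 (ρ.comp ι) c h0 h1)
  · intro h
    have hker := hirr.ker_bot Z hZ (fun h => ⟨_, hcomm h⟩)
    have hdet : LinearMap.det Z ≠ 0 := by
      intro h; exact (LinearMap.bot_lt_ker_of_det_eq_zero h).ne' hker
    have hdet2 : LinearMap.det (ρ h) ≠ 0 := by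
      have : ρ h * ρ h⁻¹ = 1 := by rw [← map_mul, mul_inv_cancel, map_one]
      have h3 := congrArg LinearMap.det this
      rw [map_mul, map_one] at h3
      exact left_ne_zero_of_mul_eq_one h3
    have h4 := congrArg LinearMap.det (hcomm h)
    rw [map_mul, LinearMap.det_smul, map_mul] at h4
    apply Units.ext
    rw [Units.val_pow_eq_pow_val, Units.val_one]
    have h5 : (1 - (l h).val ^ Module.finrank ℂ X) * (LinearMap.det (ρ h) * LinearMap.det Z) = 0 := by
      linear_combination h4
    rcases mul_eq_zero.mp h5 with h6 | h6
    · exact (sub_eq_zero.mp h6).symm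
    · exact absurd h6 (mul_ne_zero hdet2 hdet)

def wp (F : Type) [Field F] [CharP F 2] : F →+ F where
  toFun z := z ^ 2 + z
  map_zero' := by simp
  map_add' x y := by rw [CharTwo.add_sq]; ring

lemma wp_apply (z : F) : wp F z = z ^ 2 + z := rfl

lemma ell_of (y : F) (hy : (y ^ 2)⁻¹ ∉ (wp F).range) : Ell y := by
  rintro t ht rfl
  apply hy
  by_cases h : t + t⁻¹ = 0
  · exact ⟨0, by rw [h]; simp⟩
  · refine ⟨t / (t + t⁻¹), ?_⟩
    rw [wp_apply]
    have h1 : t * (t + t⁻¹) = t ^ 2 + 1 := by field_simp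
    have h2 : t ^ 2 + t * (t + t⁻¹) = 1 := by rw [h1, ← add_assoc, add_self0, zero_add]
    generalize t + t⁻¹ = y at *
    field_simp
    linear_combination h2

lemma wp_proper (F : Type) [Field F] [Fintype F] [CharP F 2] : ∃ w : F, w ∉ (wp F).range := by
  by_contra h
  push Not at h
  have hs : Function.Surjective (wp F) := h
  have hi := Finite.injective_iff_surjective.mpr hs
  have : wp F 0 = wp F 1 := by rw [map_zero, wp_apply, one_pow, add_self0]
  exact zero_ne_one (hi this)

lemma exists_ell (w : F) (hw : w ∉ (wp F).range) : ∃ y, Ell y ∧ w = (y ^ 2)⁻¹ := by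
  obtain ⟨t, ht⟩ := exists_sqrt (w⁻¹)
  have : w = (t ^ 2)⁻¹ := by rw [ht, inv_inv]
  exact ⟨t, ell_of t (this ▸ hw), this⟩

lemma ell_two (h4 : 3 ≤ Nat.card F) : ∃ x y : F, Ell x ∧ Ell y ∧ x ≠ y := by
  classical
  obtain ⟨w, hw⟩ := wp_proper F
  obtain ⟨z, hz⟩ : ∃ z : F, z ∉ ({0, 1} : Finset F) := by
    by_contra h
    push Not at h
    have : ({0, 1} : Finset F) = Finset.univ := Finset.eq_univ_iff_forall.mpr h
    have h2 := Finset.card_le_two (a := (0 : F)) (b := 1)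
    rw [this, Finset.card_univ, ← Nat.card_eq_fintype_card] at h2
    omega
  simp only [Finset.mem_insert, Finset.mem_singleton, not_or] at hz
  have hw2 : w + wp F z ∉ (wp F).range := by
    intro h; apply hw
    have := (wp F).range.sub_mem h ⟨z, rfl⟩
    rwa [add_sub_cancel_right] at this
  obtain ⟨x, hx, hx2⟩ := exists_ell w hw
  obtain ⟨y, hy, hy2⟩ := exists_ell _ hw2
  refine ⟨x, y, hx, hy, ?_⟩
  rintro rfl
  rw [← hx2, add_eq_left, wp_apply] at hy2
  have : z * (z + 1) = 0 := by rw [← hy2]; ring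
  rcases mul_eq_zero.mp this with h | h
  · exact hz.1 h
  · apply hz.2; rw [← sub_eq_zero, CharTwo.sub_eq_add, h]

lemma ell_move (α : F ≃+* F) (hα : α ≠ 1) : ∃ x, Ell x ∧ α x ≠ x := by
  by_contra h
  push Not at h
  apply hα
  obtain ⟨w, hw⟩ := wp_proper F
  have h1 : ∀ w, w ∉ (wp F).range → α w = w := by
    intro w hw
    obtain ⟨y, hy, rfl⟩ := exists_ell w hw
    rw [map_inv₀, map_pow, h y hy]
  ext p
  change α p = p
  by_cases hp : p ∈ (wp F).range
  · have h2 : w + p ∉ (wp F).range := by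
      intro h; apply hw
      have := (wp F).range.sub_mem h hp
      rwa [add_sub_cancel_right] at this
    have h3 := h1 _ h2
    rw [map_add, h1 w hw] at h3
    exact add_left_cancel h3
  · exact h1 p hp

lemma sl_cusp (h4 : 3 ≤ Nat.card F) : ∃ d ∈ charDegrees (SL2 F), Nat.card F - 1 ∣ d := by
  classical
  obtain ⟨x, y, hx, hy, hxy⟩ := ell_two h4
  obtain ⟨d, hd, h, -⟩ := cusp (F := F) (MonoidHom.id _) Function.injective_id
    (fun z => (if z = x then 1 else 0) - (if z = y then 1 else 0)) (by
      rw [Finset.sum_sub_distrib]; simp) (by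
      intro t ht
      rw [if_neg (hx t ht), if_neg (hy t ht), sub_zero]) x (by simp [hxy]) 1 (by
      intro h
      refine ⟨(MulAut.conj h).toEquiv, ?_, ?_⟩
      · intro s; simp
      · intro s
        have : tr2 ((MulAut.conj h).toEquiv s) = tr2 s := by
          change tr2 (h * s * h⁻¹) = tr2 s
          unfold tr2
          rw [m00, m11, m00, m01, m10, m11, i00, i01, i10, i11]
          linear_combination (s 0 0 + s 1 1) * sl_det h
        simp only [this, MonoidHom.one_apply, Units.val_one, one_mul])
  exact ⟨d, hd, h⟩
end cusp


section autsl
variable {F : Type} [Field F] [Fintype F] [CharP F 2]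

def smap (α : F ≃+* F) : SL2 F →* SL2 F := Matrix.SpecialLinearGroup.map (α : F →+* F)

lemma s00 (α : F ≃+* F) (s : SL2 F) : smap α s 0 0 = α (s 0 0) := rfl
lemma s01 (α : F ≃+* F) (s : SL2 F) : smap α s 0 1 = α (s 0 1) := rfl
lemma s10 (α : F ≃+* F) (s : SL2 F) : smap α s 1 0 = α (s 1 0) := rfl
lemma s11 (α : F ≃+* F) (s : SL2 F) : smap α s 1 1 = α (s 1 1) := rfl

def Std (σ : SL2 F ≃* SL2 F) : Prop :=
  ∃ α : F ≃+* F, ∃ P : SL2 F, ∀ s, σ s = P * smap α s * P⁻¹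

lemma std_conj (Q : SL2 F) (σ : SL2 F ≃* SL2 F) (h : Std (σ.trans (MulAut.conj Q))) : Std σ := by
  obtain ⟨α, P, h⟩ := h
  refine ⟨α, Q⁻¹ * P, fun s => ?_⟩
  have := h s
  rw [MulEquiv.trans_apply, MulAut.conj_apply] at this
  have h2 : σ s = Q⁻¹ * (Q * σ s * Q⁻¹) * Q := by group
  rw [h2, this]; group

lemma c2 : (2 : F) = 0 := CharTwo.two_eq_zero

lemma vv_ww (x : F) : vv x = ww * uu x * ww := by
  have := c2 (F := F)
  apply sl_ext <;> grind

lemma std_C (σ : SL2 F ≃* SL2 F) (β : F → F) (h : ∀ x, σ (uu x) = uu (β x)) (hw : σ ww = ww) :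
    Std σ := by
  have two := c2 (F := F)
  have hv : ∀ x, σ (vv x) = vv (β x) := by
    intro x
    rw [vv_ww, map_mul, map_mul, hw, h, ← vv_ww]
  have hinj : Function.Injective β := by
    intro x y hxy
    apply uu_inj
    apply σ.injective
    rw [h, h, hxy]
  have hadd : ∀ x y, β (x + y) = β x + β y := by
    intro x y
    apply uu_inj
    rw [← h, uu_add, uu_add, map_mul, h, h]
  have h0 : β 0 = 0 := by
    have := hadd 0 0
    rw [add_zero] at this
    simpa using this
  have b1 : β 1 ≠ 0 := fun e => one_ne_zero (hinj (e.trans h0.symm))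
  have hd : ∀ t : Fˣ, σ (dg t) = uu (β t) * vv (β (t : F)⁻¹) * uu (β t) * ww := by
    intro t
    rw [dg_eq, map_mul, map_mul, map_mul, h, hv, hw]
  have hpr : ∀ t : Fˣ, β t * β (t : F)⁻¹ = 1 := by
    intro t
    have e1 : σ (dg t) * uu (β 1) = uu (β (t ^ 2 * 1)) * σ (dg t) := by
      rw [← h, ← h, ← map_mul, ← map_mul, dg_uu]
    have e2 := congrArg (fun s : SL2 F => s 1 1) e1
    simp only [m11, uu01, uu11, uu10] at e2
    have e3 : σ (dg t) 1 0 = 0 := by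
      have : σ (dg t) 1 0 * β 1 = 0 := by linear_combination e2
      exact (mul_eq_zero.mp this).resolve_right b1
    rw [hd] at e3
    simp only [m10, m11, uu00, uu01, uu10, uu11, vv10, vv11, ww00, ww10] at e3
    linear_combination e3 - two
  have h00 : ∀ t : Fˣ, σ (dg t) 0 0 = β t := by
    intro t
    rw [hd]
    simp only [m00, m01, m10, m11, uu00, uu01, uu10, uu11, vv10, vv11, vv00, vv01, ww00, ww10]
    linear_combination (β t) * hpr t + (β t) * two
  have h10 : ∀ t : Fˣ, σ (dg t) 1 0 = 0 := by
    intro t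
    rw [hd]
    simp only [m10, m11, uu00, uu01, uu10, uu11, vv10, vv11, ww00, ww10]
    linear_combination hpr t + two
  have hone : β 1 = 1 := by
    have := h00 1
    rw [dg_one, map_one, o00] at this
    exact this.symm
  have hmul : ∀ x y, β (x * y) = β x * β y := by
    intro x y
    by_cases hx : x = 0
    · rw [hx, zero_mul, h0, zero_mul]
    by_cases hy : y = 0
    · rw [hy, mul_zero, h0, mul_zero]
    have e := h00 (Units.mk0 x hx * Units.mk0 y hy)
    rw [dg_mul, map_mul, m00, h10, h00, h00] at e
    simp only [Units.val_mul, Units.val_mk0] at e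
    rw [← e]; ring
  let b : F →+* F := { toFun := β, map_one' := hone, map_mul' := hmul, map_zero' := h0, map_add' := hadd }
  let α : F ≃+* F := RingEquiv.ofBijective b ⟨hinj, Finite.injective_iff_surjective.mp hinj⟩
  refine ⟨α, 1, fun s => ?_⟩
  rw [one_mul, inv_one, mul_one]
  have hT : MonoidHom.eqLocus σ.toMonoidHom (smap α) = ⊤ := by
    apply sl_gen2
    · intro x
      show σ (uu x) = smap α (uu x)
      rw [h]
      have e0 := map_zero α
      have e1 := map_one α
      apply sl_ext
      · rw [s00, uu00, uu00, e1]
      · rw [s01, uu01, uu01]; rfl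
      · rw [s10, uu10, uu10, e0]
      · rw [s11, uu11, uu11, e1]
    · show σ ww = smap α ww
      rw [hw]
      apply sl_ext
      · rw [s00, ww00, map_zero]
      · rw [s01, ww01, map_neg, map_one]
      · rw [s10, ww10, map_one]
      · rw [s11, ww11, map_zero]
  have : s ∈ MonoidHom.eqLocus σ.toMonoidHom (smap α) := by rw [hT]; trivial
  exact this

lemma bor_ne_top : bor F ≠ ⊤ := by
  intro h
  have : (ww : SL2 F) ∈ bor F := by rw [h]; trivial
  rw [mem_bor, ww10] at this
  exact one_ne_zero this

lemma std_B2 (σ : SL2 F ≃* SL2 F) (β : F → F) (h : ∀ x, σ (uu x) = uu (β x)) (h1 : (σ ww) 0 0 = 0) :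
    Std σ := by
  have two := c2 (F := F)
  have hm : σ ww * σ ww = 1 := by rw [← map_mul, ww_sq, map_one]
  generalize hs : σ ww = m at *
  have hdet := sl_det m
  have hc : m 1 0 ≠ 0 := by
    intro e; rw [e, h1] at hdet; simp at hdet
  have e10 := congrArg (fun s : SL2 F => s 1 0) hm
  simp only [m10, o10, h1] at e10
  have h11 : m 1 1 = 0 := by
    have : m 1 0 * m 1 1 = 0 := by linear_combination e10
    exact (mul_eq_zero.mp this).resolve_left hc
  obtain ⟨d, hd⟩ := exists_scale (one_ne_zero (α := F)) hc
  have dn := d.ne_zero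
  rw [h1, h11] at hdet
  have h01 : m 0 1 = - (m 1 0)⁻¹ := by
    field_simp; linear_combination -hdet
  apply std_conj (dg d)
  apply std_C _ (fun x => d ^ 2 * β x)
  · intro x
    rw [MulEquiv.trans_apply, MulAut.conj_apply, h, dg_uu]; group
  · rw [MulEquiv.trans_apply, MulAut.conj_apply, hs, mul_inv_eq_iff_eq_mul]
    rw [mul_one] at hd
    apply sl_ext
    · rw [m00, m00, h1, dg01, dg10, ww00]; ring
    · rw [m01, m01, h11, h01, dg00, dg01, dg11, ww00, ww01, ← hd]; field_simp; ring
    · rw [m10, m10, h1, dg00, dg10, dg11, ww10, ww11, ← hd]; field_simp; ring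
    · rw [m11, m11, h11, dg01, dg10, dg11, ww11, ww10]; ring

lemma std_B (σ : SL2 F ≃* SL2 F) (β : F → F) (h : ∀ x, σ (uu x) = uu (β x)) : Std σ := by
  have hb : σ ww 1 0 ≠ 0 := by
    intro e
    have hT : (bor F).comap σ.toMonoidHom = ⊤ := by
      apply sl_gen2
      · intro x
        show σ (uu x) ∈ bor F
        rw [h]; exact uu_bor _
      · exact e
    apply bor_ne_top (F := F)
    rw [eq_top_iff]
    intro s _
    have : σ.symm s ∈ (bor F).comap σ.toMonoidHom := by rw [hT]; trivial
    have h2 : σ (σ.symm s) ∈ bor F := this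
    rwa [σ.apply_symm_apply] at h2
  apply std_conj (uu (- (σ ww 0 0 / σ ww 1 0)))
  apply std_B2 _ β
  · intro x
    rw [MulEquiv.trans_apply, MulAut.conj_apply, h, mul_inv_eq_iff_eq_mul, ← uu_add, ← uu_add, add_comm]
  · rw [MulEquiv.trans_apply, MulAut.conj_apply, uu_neg]
    simp only [m00, m01, uu00, uu01, uu10, uu11]
    field_simp; ring

lemma std_A (σ : SL2 F ≃* SL2 F) (x0 : F) (hx0 : x0 ≠ 0) (h : σ (uu 1) = uu x0) : Std σ := by
  have two := c2 (F := F)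
  apply std_B σ (fun x => σ (uu x) 0 1)
  intro x
  have e : σ (uu x) * uu x0 = uu x0 * σ (uu x) := by
    rw [← h, ← map_mul, ← map_mul, ← uu_add, ← uu_add, add_comm]
  generalize σ (uu x) = s at *
  have e1 := congrArg (fun s : SL2 F => s 1 1) e
  have e2 := congrArg (fun s : SL2 F => s 0 1) e
  simp only [m11, m01, uu01, uu11, uu10, uu00] at e1 e2
  have e3 : s 1 0 = 0 := by
    have : s 1 0 * x0 = 0 := by linear_combination e1
    exact (mul_eq_zero.mp this).resolve_right hx0
  have e4 : s 0 0 = s 1 1 := by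
    have : (s 0 0 - s 1 1) * x0 = 0 := by linear_combination e2
    exact sub_eq_zero.mp ((mul_eq_zero.mp this).resolve_right hx0)
  have hd := sl_det s
  rw [e3, e4] at hd
  have e5 : s 1 1 = 1 := by
    have : (s 1 1 - 1) ^ 2 = 0 := by linear_combination hd - (s 1 1 - 1) * two
    exact sub_eq_zero.mp (pow_eq_zero_iff (by norm_num) |>.mp this)
  apply sl_ext
  · rw [e4, e5, uu00]
  · rw [uu01]
  · rw [e3, uu10]
  · rw [e5, uu11]

theorem std_all (σ : SL2 F ≃* SL2 F) : Std σ := by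
  have two := c2 (F := F)
  have hs : σ (uu 1) * σ (uu 1) = 1 := by
    rw [← map_mul, ← uu_add, add_self0, uu_zero, map_one]
  have hn : σ (uu 1) ≠ 1 := by
    intro e
    have : uu (1 : F) = uu 0 := by rw [uu_zero]; exact σ.injective (by rw [e, map_one])
    exact one_ne_zero (uu_inj this)
  generalize hm : σ (uu 1) = s at *
  have hinv : s = s⁻¹ := eq_inv_of_mul_eq_one_left hs
  have e4 : s 0 0 = s 1 1 := by
    rw [← i00, ← hinv]
  have hd := sl_det s
  by_cases hc : s 1 0 = 0
  · rw [hc, e4] at hd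
    have e5 : s 1 1 = 1 := by
      have : (s 1 1 - 1) ^ 2 = 0 := by linear_combination hd - (s 1 1 - 1) * two
      exact sub_eq_zero.mp (pow_eq_zero_iff (by norm_num) |>.mp this)
    have e6 : s = uu (s 0 1) := by
      apply sl_ext
      · rw [e4, e5, uu00]
      · rw [uu01]
      · rw [hc, uu10]
      · rw [e5, uu11]
    apply std_A σ (s 0 1) _ (hm.trans e6)
    intro e
    apply hn
    rw [e6, e, uu_zero]
  · have hP : (0 : F) * (s 0 0 + 1) - (s 1 0)⁻¹ * (s 1 0) = 1 := by
      field_simp; linear_combination -two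
    apply std_conj (mk4 0 (s 1 0)⁻¹ (s 1 0) (s 0 0 + 1) hP)
    apply std_A _ (s 1 0)⁻¹ (inv_ne_zero hc)
    rw [MulEquiv.trans_apply, MulAut.conj_apply, hm, mul_inv_eq_iff_eq_mul]
    have e01 : s 0 1 = (s 0 0 * s 1 1 - 1) / s 1 0 := by
      field_simp; linear_combination -hd
    apply sl_ext
    · simp only [m00, m01, m10, m11, k00, k01, k10, k11, uu00, uu01, uu10, uu11]
      field_simp; ring
    · simp only [m00, m01, m10, m11, k00, k01, k10, k11, uu00, uu01, uu10, uu11]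
      rw [e4]; field_simp; linear_combination -two
    · simp only [m00, m01, m10, m11, k00, k01, k10, k11, uu00, uu01, uu10, uu11]
      linear_combination (s 1 0 * s 0 0) * two
    · simp only [m00, m01, m10, m11, k00, k01, k10, k11, uu00, uu01, uu10, uu11]
      linear_combination (-1) * hd + s 0 0 * s 1 1 * two - two - e4
end autsl


section T
variable {F : Type} [Field F] [Fintype F] [CharP F 2]

lemma tr2_conj (P s : SL2 F) : tr2 (P * s * P⁻¹) = tr2 s := by
  unfold tr2
  rw [m00, m11, m00, m01, m10, m11, i00, i01, i10, i11]
  linear_combination (s 0 0 + s 1 1) * sl_det P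

lemma tr2_smap (α : F ≃+* F) (s : SL2 F) : tr2 (smap α s) = α (tr2 s) := by
  unfold tr2; rw [s00, s11, map_add]

lemma tr2_surj (x : F) : ∃ s : SL2 F, tr2 s = x :=
  ⟨mk4 x (-1) 1 0 (by ring), by unfold tr2; rw [k00, k11, add_zero]⟩

lemma smap_mul (α β : F ≃+* F) (s : SL2 F) : smap (α * β) s = smap α (smap β s) := rfl

lemma smap_one (s : SL2 F) : smap (1 : F ≃+* F) s = s := by
  apply sl_ext <;> rfl

theorem exists_a {H : Type} [Group H] (ι : SL2 F →* H) (hι : Function.Injective ι)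
    (hn : ι.range.Normal) (hz : ∀ h : H, (∀ s, h * ι s = ι s * h) → h = 1) :
    ∃ a : H →* (F ≃+* F), (∀ g, ∃ P, ∀ s, g * ι s = ι (P * smap (a g) s * P⁻¹) * g) ∧
      a.ker = ι.range ∧ ∀ g P, a g = 1 → (∀ s, g * ι s = ι (P * smap (a g) s * P⁻¹) * g) → g = ι P := by
  have hex : ∀ g : H, ∃ (α : F ≃+* F) (P : SL2 F), ∀ s, g * ι s = ι (P * smap α s * P⁻¹) * g := by
    intro g
    let e := MonoidHom.ofInjective hι
    let σ : SL2 F ≃* SL2 F := (e.trans (MulAut.conjNormal g)).trans e.symm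
    have hσ : ∀ s, ι (σ s) = g * ι s * g⁻¹ := by
      intro s
      have h1 : e (σ s) = MulAut.conjNormal g (e s) := e.apply_symm_apply _
      have h2 := congrArg Subtype.val h1
      exact h2
    obtain ⟨α, P, h⟩ := std_all σ
    refine ⟨α, P, fun s => ?_⟩
    rw [← h, hσ]; group
  have huniq : ∀ (g : H) (α β : F ≃+* F) (P Q : SL2 F),
      (∀ s, g * ι s = ι (P * smap α s * P⁻¹) * g) → (∀ s, g * ι s = ι (Q * smap β s * Q⁻¹) * g) →
      α = β := by
    intro g α β P Q h1 h2
    ext x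
    obtain ⟨s, rfl⟩ := tr2_surj x
    have h3 := hι (mul_right_cancel ((h1 s).symm.trans (h2 s)))
    have h4 := congrArg tr2 h3
    rwa [tr2_conj, tr2_conj, tr2_smap, tr2_smap] at h4
  choose a P h using hex
  have hmul : ∀ g k, a (g * k) = a g * a k := by
    intro g k
    apply huniq (g * k) _ _ (P (g * k)) (P g * smap (a g) (P k)) (h _)
    intro s
    rw [mul_assoc, h k, ← mul_assoc, h g, smap_mul, map_mul (smap (a g)), map_mul (smap (a g)), map_inv (smap (a g)), mul_assoc, mul_inv_rev]
    simp only [mul_assoc]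
  have hc : ∀ g Q, a g = 1 → (∀ s, g * ι s = ι (Q * smap (a g) s * Q⁻¹) * g) → g = ι Q := by
    intro g Q hg hQ
    have : (ι Q)⁻¹ * g = 1 := by
      apply hz
      intro s
      have := hQ s
      rw [hg, smap_one, map_mul, map_mul, map_inv] at this
      rw [mul_assoc, this]; group
    rw [inv_mul_eq_one] at this
    exact this.symm
  refine ⟨MonoidHom.mk' a hmul, fun g => ⟨P g, h g⟩, ?_, hc⟩
  ext g
  rw [MonoidHom.mem_ker]
  constructor
  · intro hg
    have hg : a g = 1 := hg
    exact ⟨P g, (hc g _ hg (h g)).symm⟩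
  · rintro ⟨p, rfl⟩
    apply huniq (ι p) _ _ (P (ι p)) p (h _)
    intro s
    rw [smap_one, ← map_mul, ← map_mul]; congr 1; group

lemma exists_chi {F : Type} [Field F] [Fintype F] : ∃ χ : Fˣ →* ℂˣ, Function.Injective χ := by
  obtain ⟨g, hg⟩ := IsCyclic.exists_generator (α := Fˣ)
  have hn : Nat.card Fˣ ≠ 0 := Nat.card_pos.ne'
  have hp := Complex.isPrimitiveRoot_exp (Nat.card Fˣ) hn
  have hu := hp.isUnit_unit hn
  have ho : orderOf g = Nat.card Fˣ := orderOf_eq_card_of_forall_mem_zpowers hg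
  have ho2 : orderOf (hp.isUnit hn).unit = Nat.card Fˣ := hu.eq_orderOf.symm
  refine ⟨monoidHomOfForallMemZpowers hg (g' := (hp.isUnit hn).unit) (by rw [ho, ho2]), ?_⟩
  rw [injective_iff_map_eq_one]
  intro x hx
  obtain ⟨k, rfl⟩ := hg x
  simp only [map_zpow, monoidHomOfForallMemZpowers_apply_gen] at hx ⊢
  rw [← orderOf_dvd_iff_zpow_eq_one] at hx ⊢
  rwa [ho, ← ho2]

lemma sl_center (z : SL2 F) (h : ∀ s, z * s = s * z) : z = 1 := by
  have two := c2 (F := F)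
  have e1 := congrArg (fun s : SL2 F => s 1 1) (h (uu 1))
  have e2 := congrArg (fun s : SL2 F => s 0 1) (h (uu 1))
  have e3 := congrArg (fun s : SL2 F => s 0 0) (h (vv 1))
  simp only [m11, m01, m00, uu01, uu11, uu10, uu00, vv00, vv10, vv01] at e1 e2 e3
  have f1 : z 1 0 = 0 := by linear_combination e1
  have f2 : z 0 1 = 0 := by linear_combination e3
  have f3 : z 0 0 = z 1 1 := by linear_combination e2
  have hd := sl_det z
  rw [f1, f3] at hd
  have e5 : z 1 1 = 1 := by
    have : (z 1 1 - 1) ^ 2 = 0 := by linear_combination hd - (z 1 1 - 1) * two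
    exact sub_eq_zero.mp (pow_eq_zero_iff (by norm_num) |>.mp this)
  apply sl_ext
  · rw [f3, e5, o00]
  · rw [f2, o01]
  · rw [f1, o10]
  · rw [e5, o11]

lemma exists_noninv (α : F ≃+* F) (h8 : 8 ≤ Nat.card F) : ∃ s : Fˣ, α s * (s : F) ≠ 1 := by
  classical
  have two := c2 (F := F)
  by_contra hc
  push Not at hc
  have key : ∀ s : F, s ≠ 0 → s ≠ 1 → s ^ 2 + s + 1 = 0 := by
    intro s h0 h1
    have h2 : 1 + s ≠ 0 := by
      intro e; apply h1; linear_combination e - two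
    have e1 := hc (Units.mk0 s h0)
    have e2 := hc (Units.mk0 _ h2)
    simp only [Units.val_mk0, map_add, map_one] at e1 e2
    linear_combination (s) * e2 - (1 + s) * e1
  have hex : ∀ T : Finset F, T.card < 8 → ∃ t, t ∉ T := by
    intro T hT
    by_contra hcon
    push Not at hcon
    have : T = Finset.univ := Finset.eq_univ_iff_forall.mpr hcon
    rw [this, Finset.card_univ, ← Nat.card_eq_fintype_card] at hT
    omega
  obtain ⟨s, hs⟩ := hex {0, 1} (lt_of_le_of_lt Finset.card_le_two (by norm_num))
  obtain ⟨t, ht⟩ := hex {0, 1, s, s + 1} (lt_of_le_of_lt Finset.card_le_four (by norm_num))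
  simp only [Finset.mem_insert, Finset.mem_singleton, not_or] at hs ht
  have k1 := key s hs.1 hs.2
  have k2 := key t ht.1 ht.2.1
  have : (t - s) * (t - (s + 1)) = 0 := by
    linear_combination k2 + k1 - (s * t + t + 1) * two
  rcases mul_eq_zero.mp this with h | h
  · exact ht.2.2.1 (sub_eq_zero.mp h)
  · exact ht.2.2.2 (sub_eq_zero.mp h)

theorem T1 {H : Type} [Group H] [Finite H] (h8 : 8 ≤ Nat.card F) (ι : SL2 F →* H)
    (hι : Function.Injective ι)
    (hn : ι.range.Normal) (hz : ∀ h : H, (∀ s, h * ι s = ι s * h) → h = 1) :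
    ∃ d ∈ charDegrees H, (Nat.card F + 1) * ι.range.index ∣ d := by
  obtain ⟨a, ha, -, hc⟩ := exists_a ι hι hn hz
  obtain ⟨χ, hχ⟩ := exists_chi (F := F)
  have hidx : ((bor F).map ι).index = (Nat.card F + 1) * ι.range.index := by
    rw [Subgroup.index_map, (MonoidHom.ker_eq_bot_iff ι).mpr hι, sup_bot_eq, index_bor]
  rw [← hidx]
  apply deg_index (ι.comp (bor F).subtype) (hι.comp (bor F).subtype_injective) (χ.comp (borDiag F))
  · rintro _ ⟨b, hb, rfl⟩
    refine ⟨(MulAut.conj (⟨b, hb⟩ : bor F)).toEquiv, ?_, ?_⟩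
    · intro n
      simp only [MonoidHom.comp_apply, MulEquiv.toEquiv_eq_coe, EquivLike.coe_coe, MulAut.conj_apply]
      rw [← map_mul, ← map_mul]; congr 1
      simp
    · intro n
      simp only [MulEquiv.toEquiv_eq_coe, EquivLike.coe_coe, MulAut.conj_apply, map_mul, map_inv]
      rw [mul_comm (_ * _), ← mul_assoc, inv_mul_cancel, one_mul]
  · intro g hg
    obtain ⟨P, hP⟩ := ha g
    by_cases hPb : P ∈ bor F
    · have h1 : a g ≠ 1 := by
        intro e
        apply hg
        exact ⟨P, hPb, (hc g P e hP).symm⟩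
      obtain ⟨x, hx⟩ : ∃ x, a g x ≠ x := by
        by_contra hcon
        push Not at hcon
        exact h1 (RingEquiv.ext hcon)
      have x0 : x ≠ 0 := by rintro rfl; exact hx (map_zero _)
      have hmem : P * smap (a g) (dg (Units.mk0 x x0)) * P⁻¹ ∈ bor F := by
        apply (bor F).mul_mem ((bor F).mul_mem hPb _) ((bor F).inv_mem hPb)
        rw [mem_bor, s10, dg10, map_zero]
      refine ⟨⟨_, hmem⟩, ⟨_, dg_bor (Units.mk0 x x0)⟩, (hP _).symm, ?_⟩
      intro e
      apply hx
      have e2 := congrArg Units.val (hχ e)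
      rw [borDiag_val, borDiag_val] at e2
      simp only [m00, m01, i00, i10, s00, s01, s10, s11, dg00, dg01, dg10, dg11, map_zero, Units.val_mk0] at e2
      have := sl_det P
      have h10 := mem_bor.mp hPb
      rw [h10] at this e2
      linear_combination e2 - (a g x) * this
    · have hc0 : P 1 0 ≠ 0 := hPb
      obtain ⟨s, hs⟩ := exists_noninv (a g) h8
      have s0 := s.ne_zero
      have as0 : a g s ≠ 0 := by
        intro e; exact s0 ((a g).injective (e.trans (map_zero _).symm))
      have hmd : (s : F) * (s : F)⁻¹ - (a g).symm (P 1 1 * (a g s - (a g s)⁻¹) / P 1 0) * 0 = 1 := by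
        rw [mul_inv_cancel₀ s0]; ring
      have hdet := sl_det P
      set m := mk4 (s : F) ((a g).symm (P 1 1 * (a g s - (a g s)⁻¹) / P 1 0)) 0 (s : F)⁻¹ hmd with hm
      have q00 : smap (a g) m 0 0 = a g s := by rw [s00, hm, k00]
      have q01 : smap (a g) m 0 1 = P 1 1 * (a g s - (a g s)⁻¹) / P 1 0 := by
        rw [s01, hm, k01, RingEquiv.apply_symm_apply]
      have q10 : smap (a g) m 1 0 = 0 := by rw [s10, hm, k10, map_zero]
      have q11 : smap (a g) m 1 1 = (a g s)⁻¹ := by rw [s11, hm, k11, map_inv₀]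
      have hmem : P * smap (a g) m * P⁻¹ ∈ bor F := by
        rw [mem_bor]
        simp only [m10, m11, i00, i10, q00, q01, q10, q11]
        field_simp; ring
      refine ⟨⟨_, hmem⟩, ⟨m, by rw [mem_bor, hm, k10]⟩, (hP _).symm, ?_⟩
      intro e
      apply hs
      have e2 := congrArg Units.val (hχ e)
      rw [borDiag_val, borDiag_val] at e2
      simp only [m00, m01, i00, i10, q00, q01, q10, q11] at e2
      have e3 : (P 0 0 * a g s + P 0 1 * 0) * P 1 1 + (P 0 0 * (P 1 1 * (a g s - (a g s)⁻¹) / P 1 0) + P 0 1 * (a g s)⁻¹) * -P 1 0 = (a g s)⁻¹ := by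
        field_simp; linear_combination hdet
      rw [e3, hm, k00] at e2
      have := mul_inv_cancel₀ as0
      rwa [e2] at this

lemma aut_comm {F : Type} [Field F] [Fintype F] (α β : F ≃+* F) : α * β = β * α := by
  obtain ⟨g, hg⟩ := IsCyclic.exists_generator (α := Fˣ)
  have hp : ∀ γ : F ≃+* F, ∃ n : ℕ, ∀ x : F, x ≠ 0 → γ x = x ^ n := by
    intro γ
    have : Units.map (γ : F →* F) g ∈ Subgroup.zpowers g := hg _
    rw [← mem_powers_iff_mem_zpowers] at this
    obtain ⟨n, hn⟩ := this
    refine ⟨n, fun x hx => ?_⟩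
    have h2 := hg (Units.mk0 x hx)
    rw [← mem_powers_iff_mem_zpowers] at h2
    obtain ⟨k, hk⟩ := h2
    have hk' : (g : F) ^ k = x := congrArg Units.val hk
    have hn' : (g : F) ^ n = γ g := congrArg Units.val hn
    rw [← hk', map_pow, ← hn', ← pow_mul, ← pow_mul, mul_comm]
  obtain ⟨n, hn⟩ := hp α
  obtain ⟨m, hm⟩ := hp β
  ext x
  show α (β x) = β (α x)
  by_cases hx : x = 0
  · rw [hx]; simp
  rw [hm x hx, hn x hx, map_pow, map_pow, hn x hx, hm x hx, ← pow_mul, ← pow_mul, mul_comm]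

instance {F : Type} [Field F] [Fintype F] : Finite (F ≃+* F) :=
  Finite.of_injective (fun α : F ≃+* F => (α : F → F)) DFunLike.coe_injective

theorem T2 {H : Type} [Group H] [Finite H] (ι : SL2 F →* H)
    (hι : Function.Injective ι)
    (hn : ι.range.Normal) (hz : ∀ h : H, (∀ s, h * ι s = ι s * h) → h = 1) (r : ℕ) (hr : r.Prime)
    (hri : r ∣ ι.range.index) :
    ∃ d ∈ charDegrees H, r ∣ d ∧ Nat.card F - 1 ∣ d := by
  classical
  have := Fintype.ofFinite H
  obtain ⟨a, ha, hk, -⟩ := exists_a ι hι hn hz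
  rw [← hk, Subgroup.index_ker] at hri
  have : Fact r.Prime := ⟨hr⟩
  obtain ⟨⟨γ, δ, hδ⟩, hγ⟩ := exists_prime_orderOf_dvd_card' r hri
  have hγ' : orderOf γ = r := by
    rw [← hγ]; exact (Subgroup.orderOf_coe (⟨γ, ⟨δ, hδ⟩⟩ : a.range))
  have hγ1 : γ ≠ 1 := by
    rintro rfl
    rw [orderOf_one] at hγ'
    exact hr.one_lt.ne hγ'
  obtain ⟨x, hx, hmove⟩ := ell_move γ hγ1
  letI : CommGroup (F ≃+* F) := { (inferInstance : Group (F ≃+* F)) with mul_comm := aut_comm }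
  let X : Subgroup (F ≃+* F) :=
    { carrier := {g | g x = x}
      one_mem' := rfl
      mul_mem' := by
        intro g h (hg : g x = x) (hh : h x = x)
        show g (h x) = x
        rw [hh, hg]
      inv_mem' := by
        intro g (hg : g x = x)
        show g.symm x = x
        rw [RingEquiv.symm_apply_eq, hg] }
  have hX : (QuotientGroup.mk γ : (F ≃+* F) ⧸ X) ≠ 1 := by
    intro e
    rw [QuotientGroup.eq_one_iff] at e
    exact hmove e
  obtain ⟨χ, hχ⟩ := CommGroup.exists_apply_ne_one_of_hasEnoughRootsOfUnity ((F ≃+* F) ⧸ X) ℂ hX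
  let l : H →* ℂˣ := (χ.comp (QuotientGroup.mk' X)).comp a
  have hl1 : l δ ≠ 1 := by
    show χ (QuotientGroup.mk (a δ)) ≠ 1
    rw [hδ]; exact hχ
  have hlr : (l δ) ^ r = 1 := by
    rw [← map_pow]
    show χ (QuotientGroup.mk (a (δ ^ r))) = 1
    rw [map_pow, hδ, ← hγ', pow_orderOf_eq_one]
    exact map_one χ
  have hstab : ∀ g, a g x = x → l g = 1 := by
    intro g hg
    show χ (QuotientGroup.mk (a g)) = 1
    rw [(QuotientGroup.eq_one_iff (N := X) (a g)).mpr hg, map_one]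
  let c : F → ℂ := fun y => ∑ g : H, if a g x = y then (l g : ℂ) else 0
  have h0 : ∑ y, c y = 0 := by
    have e1 : ∑ y, c y = ∑ g : H, (l g : ℂ) := by
      rw [Finset.sum_comm]
      apply Finset.sum_congr rfl
      intro g _
      rw [Finset.sum_ite_eq]; simp
    have e2 : ∑ g : H, (l g : ℂ) = (l δ : ℂ) * ∑ g : H, (l g : ℂ) := by
      rw [Finset.mul_sum]
      symm
      apply Fintype.sum_equiv (Equiv.mulLeft δ)
      intro g
      rw [Equiv.coe_mulLeft, map_mul, Units.val_mul]
    rw [e1]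
    by_contra hne
    apply hl1
    ext
    exact mul_right_cancel₀ hne (by rw [← e2, Units.val_one, one_mul])
  have h1 : ∀ t : F, t ≠ 0 → c (t + t⁻¹) = 0 := by
    intro t ht
    apply Finset.sum_eq_zero
    intro g _
    rw [if_neg]
    intro e
    apply hx ((a g).symm t)
    · intro h; apply ht; rw [← (a g).apply_symm_apply t, h, map_zero]
    · apply (a g).injective
      rw [e, map_add, map_inv₀, RingEquiv.apply_symm_apply]
  have hcx : c x ≠ 0 := by
    have : c x = ((Finset.univ.filter (fun g : H => a g x = x)).card : ℂ) := by
      rw [Finset.card_filter]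
      push_cast
      apply Finset.sum_congr rfl
      intro g _
      split_ifs with h
      · rw [hstab g h]; rfl
      · rfl
    rw [this]
    norm_cast
    apply Finset.card_ne_zero_of_mem (a := 1)
    simp
  obtain ⟨d, hd, hd1, hd2⟩ := cusp ι hι c h0 h1 x hcx l (by
    intro h
    obtain ⟨P, hP⟩ := ha h
    have hinj : Function.Injective (fun s => P * smap (a h) s * P⁻¹) := by
      intro s t hst
      apply hι
      have : h * ι s = h * ι t := by rw [hP, hP]; exact congrArg (fun z => ι z * h) hst
      exact mul_left_cancel this
    refine ⟨Equiv.ofBijective _ ⟨hinj, Finite.injective_iff_surjective.mp hinj⟩, hP, ?_⟩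
    intro s
    show c (tr2 (P * smap (a h) s * P⁻¹)) = _
    rw [tr2_conj, tr2_smap]
    show (∑ g : H, _) = (l h).val * ∑ g : H, _
    rw [Finset.mul_sum]
    symm
    apply Fintype.sum_equiv (Equiv.mulLeft h)
    intro g
    have e1 : a (h * g) x = a h (a g x) := by rw [map_mul]; rfl
    rw [Equiv.coe_mulLeft, e1, map_mul, EmbeddingLike.apply_eq_iff_eq, Units.val_mul]
    split_ifs <;> simp)
  refine ⟨d, hd, ?_, hd1⟩
  have ho : orderOf (l δ) = r := orderOf_eq_prime hlr hl1
  rw [← ho]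
  exact orderOf_dvd_of_pow_eq_one (hd2 δ)

end T


section asm
variable {F : Type} [Field F] [Fintype F] [CharP F 2]

lemma k4 {G : Type} [Group G] (h4 : (charGraph G).CliqueFree 4) {n : ℕ} (hn : n ∈ charDegrees G)
    (T : Finset ℕ) (hT : ∀ p ∈ T, p.Prime ∧ p ∣ n) : T.card ≤ 3 := by
  classical
  by_contra hc
  push Not at hc
  obtain ⟨U, hU, hU4⟩ := Finset.exists_subset_card_eq (show 4 ≤ T.card from hc)
  have hm : ∀ p ∈ U, p ∈ charPrimes G := fun p hp => ⟨(hT p (hU hp)).1, n, hn, (hT p (hU hp)).2⟩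
  apply h4 (U.attach.map ⟨fun p => (⟨p.1, hm p.1 p.2⟩ : charPrimes G), by
    intro a b hab
    exact Subtype.ext (congrArg (fun z : charPrimes G => (z : ℕ)) hab)⟩)
  constructor
  · intro x hx y hy hxy
    rw [Finset.mem_coe, Finset.mem_map] at hx hy
    obtain ⟨a, -, rfl⟩ := hx
    obtain ⟨b, -, rfl⟩ := hy
    have hne : a.1 ≠ b.1 := fun e => hxy (Subtype.ext e)
    have ha := hT a.1 (hU a.2)
    have hb := hT b.1 (hU b.2)
    exact ⟨hne, n, hn, ((Nat.coprime_primes ha.1 hb.1).mpr hne).mul_dvd_of_dvd_of_dvd ha.2 hb.2⟩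
  · rw [Finset.card_map, Finset.card_attach, hU4]

lemma k4' {G : Type} [Group G] (h4 : (charGraph G).CliqueFree 4) {n m : ℕ} (hn : n ∈ charDegrees G)
    (hm : m.primeFactors.card = 3) (hmn : m ∣ n) {p : ℕ} (hp : p.Prime) (hpn : p ∣ n) : p ∣ m := by
  classical
  by_contra hc
  have := k4 h4 hn (insert p m.primeFactors) (by
    intro r hr
    rcases Finset.mem_insert.mp hr with rfl | hr
    · exact ⟨hp, hpn⟩
    · exact ⟨Nat.prime_of_mem_primeFactors hr, (Nat.dvd_of_mem_primeFactors hr).trans hmn⟩)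
  rw [Finset.card_insert_of_notMem (fun h => hc (Nat.dvd_of_mem_primeFactors h)), hm] at this
  omega

lemma cop {q p : ℕ} (hq : 2 ∣ q) (hq0 : 0 < q) (hp : p.Prime) (h1 : p ∣ q - 1) (h2 : p ∣ q + 1) : False := by
  have h3 : p ∣ 2 := by
    have := Nat.dvd_sub h2 h1
    rwa [show q + 1 - (q - 1) = 2 by omega] at this
  have h4 : p = 2 := (Nat.prime_dvd_prime_iff_eq hp Nat.prime_two).mp h3
  subst h4
  omega

theorem step1 {G H : Type} [Group G] [Finite G] [Group H] [Finite H] (h4 : (charGraph G).CliqueFree 4)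
    (h8 : 8 ≤ Nat.card F) (h2 : 2 ∣ Nat.card F)
    (hA : (Nat.card F - 1).primeFactors.card = 3) (hB : (Nat.card F + 1).primeFactors.card = 3)
    (π : G →* H) (hπ : Function.Surjective π) (ι : SL2 F →* H) (hι : Function.Injective ι)
    (hn : ι.range.Normal) (hz : ∀ h : H, (∀ s, h * ι s = ι s * h) → h = 1) : ι.range = ⊤ := by
  rw [← Subgroup.index_eq_one]
  by_contra hne
  obtain ⟨r, hr, hri⟩ := Nat.exists_prime_and_dvd hne
  obtain ⟨d1, hd1, hd1'⟩ := T1 h8 ι hι hn hz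
  obtain ⟨d2, hd2, hd2', hd2''⟩ := T2 ι hι hn hz r hr hri
  have r1 := k4' h4 (inflate π hπ hd1) hB ((Dvd.intro _ rfl).trans hd1') hr
    (hri.trans ((Dvd.intro_left _ rfl).trans hd1'))
  have r2 := k4' h4 (inflate π hπ hd2) hA hd2'' hr hd2'
  exact cop h2 (by omega) hr r2 r1

lemma sl_plus (h8 : 8 ≤ Nat.card F) : ∃ d ∈ charDegrees (SL2 F), Nat.card F + 1 ∣ d := by
  obtain ⟨d, hd, h⟩ := T1 h8 (MonoidHom.id (SL2 F)) Function.injective_id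
    (by rw [MonoidHom.range_eq_top_of_surjective _ Function.surjective_id]; infer_instance) (fun z hz => sl_center z hz)
  exact ⟨d, hd, (Dvd.intro _ rfl).trans h⟩

open scoped commutatorElement in
lemma sl_perfect (h8 : 8 ≤ Nat.card F) : commutator (SL2 F) = ⊤ := by
  classical
  have two := c2 (F := F)
  obtain ⟨t, ht⟩ : ∃ t : F, t ∉ ({0, 1} : Finset F) := by
    by_contra hcon
    push Not at hcon
    have h := Finset.eq_univ_iff_forall.mpr hcon
    have h2 : ({0, 1} : Finset F).card ≤ 2 := Finset.card_le_two
    rw [h, Finset.card_univ, ← Nat.card_eq_fintype_card] at h2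
    omega
  simp only [Finset.mem_insert, Finset.mem_singleton, not_or] at ht
  have ht2 : t ^ 2 - 1 ≠ 0 := by
    intro e
    have : (t - 1) ^ 2 = 0 := by linear_combination e - (t - 1) * two
    exact ht.2 (sub_eq_zero.mp (pow_eq_zero_iff (by norm_num) |>.mp this))
  have hu : ∀ x : F, uu x ∈ commutator (SL2 F) := by
    intro x
    have e : uu x = ⁅dg (Units.mk0 t ht.1), uu (x / (t ^ 2 - 1))⁆ := by
      rw [commutatorElement_def, dg_uu, mul_inv_cancel_right, uu_neg, ← uu_add, Units.val_mk0]
      congr 1; field_simp; ring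
    rw [e]
    exact Subgroup.commutator_mem_commutator trivial trivial
  apply sl_gen _ hu
  intro x
  have e : vv x = ww * uu x * ww⁻¹ := by
    rw [vv_ww]; congr 1; exact eq_inv_of_mul_eq_one_left ww_sq
  rw [e]
  exact (inferInstance : (commutator (SL2 F)).Normal).conj_mem _ (hu x) _

lemma relIndex_dvd' {G : Type} [Group G] [Finite G] (J K : Subgroup G) [K.Normal] : J.relIndex K ∣ J.index := by
  have h1 : K.relIndex J * J.index = (K ⊓ J).index := by
    rw [← Subgroup.inf_relIndex_right]; exact Subgroup.relIndex_mul_index inf_le_right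
  have h2 : J.relIndex K * K.index = (J ⊓ K).index := by
    rw [← Subgroup.inf_relIndex_right]; exact Subgroup.relIndex_mul_index inf_le_right
  have h3 : K.relIndex J * (J ⊔ K).index = K.index := by
    rw [← Subgroup.relIndex_sup_right J K]; exact Subgroup.relIndex_mul_index le_sup_right
  have h4 : K.relIndex J ≠ 0 := (inferInstance : (K.subgroupOf J).FiniteIndex).index_ne_zero
  rw [inf_comm, ← h2, ← h3] at h1
  refine ⟨(J ⊔ K).index, ?_⟩
  apply Nat.eq_of_mul_eq_mul_left (Nat.pos_of_ne_zero h4)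
  rw [h1]; ring

lemma sup_solv {G : Type} [Group G] (H N : Subgroup G) [N.Normal] [Group.IsSolvable H] [Group.IsSolvable N] :
    Group.IsSolvable ↥(H ⊔ N) := by
  let e := QuotientGroup.quotientInfEquivProdNormalQuotient H N
  have h1 : Group.IsSolvable (↥(H ⊔ N) ⧸ N.subgroupOf (H ⊔ N)) := solvable_of_surjective (f := e.toMonoidHom) e.surjective
  apply solvable_of_ker_le_range (Subgroup.inclusion (le_sup_right : N ≤ H ⊔ N)) (QuotientGroup.mk' (N.subgroupOf (H ⊔ N)))
  rw [QuotientGroup.ker_mk', Subgroup.inclusion_range]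

lemma rad_solv (G : Type) [Group G] [Finite G] : Group.IsSolvable (solvableRadical G) := by
  obtain ⟨N, ⟨hN1, hN2⟩, hN⟩ := (Set.toFinite {N : Subgroup G | N.Normal ∧ Group.IsSolvable ↥N}).exists_maximal
    ⟨⊥, inferInstance, inferInstance⟩
  have : solvableRadical G = N := by
    apply le_antisymm
    · apply iSup_le
      rintro ⟨P, hP1, hP2⟩
      have h0 : Group.IsSolvable P := hP2
      have h00 : P.Normal := hP1
      have h1 : Group.IsSolvable ↥(P ⊔ N) := sup_solv P N
      have h2 : (P ⊔ N).Normal := inferInstance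
      exact le_sup_left.trans (hN ⟨h2, h1⟩ le_sup_right)
    · exact le_iSup (fun N : { N : Subgroup G // N.Normal ∧ IsSolvable ↥N } => (N : Subgroup G)) ⟨N, hN1, hN2⟩
  rw [this]; exact hN2

end asm


section split
variable {F : Type} [Field F] [Fintype F] [CharP F 2]

lemma finite_chars {N : Type} [Group N] [Finite N] : Finite (N →* ℂˣ) := by
  have hp : Nat.card N ≠ 0 := Nat.card_pos.ne'
  haveI : NeZero (Nat.card N) := ⟨hp⟩
  have hinj : Function.Injective (fun (l : N →* ℂˣ) (n : N) =>
      (⟨l n, by rw [mem_rootsOfUnity, ← map_pow, pow_card_eq_one', map_one]⟩ :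
        rootsOfUnity (Nat.card N) ℂ)) := by
    intro l m h
    apply MonoidHom.ext
    intro n
    exact congrArg Subtype.val (congrFun h n)
  exact Finite.of_injective _ hinj

lemma exists_char {N : Type} [Group N] [Finite N] [Nontrivial N] [Group.IsSolvable N] :
    ∃ l : N →* ℂˣ, l ≠ 1 := by
  have h1 := Group.IsSolvable.commutator_lt_top_of_nontrivial N
  obtain ⟨n, -, hn⟩ := SetLike.exists_of_lt h1
  have h2 : (Abelianization.of n) ≠ 1 := by
    intro e
    apply hn
    rw [← Abelianization.ker_of]; exact e
  obtain ⟨χ, hχ⟩ := CommGroup.exists_apply_ne_one_of_hasEnoughRootsOfUnity (Abelianization N) ℂ h2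
  refine ⟨χ.comp Abelianization.of, ?_⟩
  intro e
  apply hχ
  exact DFunLike.congr_fun e n

lemma char_inner {N : Type} [Group N] (l : N →* ℂˣ) (m n : N) : l (m * n * m⁻¹) = l n := by
  rw [map_mul, map_mul, map_inv, mul_comm (l m), mul_inv_cancel_right]

lemma fix_triv {G : Type} [Group G] [Finite G] (h8 : 8 ≤ Nat.card F) (h2 : 2 ∣ Nat.card F)
    (π : G →* SL2 F) (K N : Subgroup G) [K.Normal] [N.Normal] (hNK : N ≤ K)
    (hN : ∀ k ∈ K, π k = 1 ↔ k ∈ N)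
    (hK : K.map π = ⊤) (hperf : commutator K = ⊤) (l : N →* ℂˣ)
    (hl : ∀ k ∈ K, ∀ n, l (MulAut.conjNormal k n) = l n) : l = 1 := by
  let L : Subgroup K := (l.ker.map N.subtype).subgroupOf K
  have memL : ∀ k : K, k ∈ L ↔ ∃ h : (k : G) ∈ N, l ⟨k, h⟩ = 1 := by
    intro k
    rw [Subgroup.mem_subgroupOf, Subgroup.mem_map]
    constructor
    · rintro ⟨n, hn, h⟩
      have hk : (k : G) ∈ N := h ▸ n.2
      refine ⟨hk, ?_⟩
      have : n = ⟨k, hk⟩ := Subtype.ext h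
      rw [← this]; exact hn
    · rintro ⟨h, h1⟩
      exact ⟨⟨k, h⟩, h1, rfl⟩
  haveI hLn : L.Normal := by
    constructor
    intro n hn k
    obtain ⟨h, h1⟩ := (memL n).mp hn
    rw [memL]
    refine ⟨(inferInstance : N.Normal).conj_mem _ h _, ?_⟩
    rw [← h1, ← hl k k.2 ⟨n, h⟩]
    rfl
  have hLker : ∀ k ∈ L, (π.comp K.subtype) k = 1 := by
    intro k hk
    obtain ⟨h, -⟩ := (memL k).mp hk
    exact (hN k k.2).mpr h
  let π' : K ⧸ L →* SL2 F := QuotientGroup.lift L (π.comp K.subtype) hLker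
  have hsur : Function.Surjective π' := by
    intro s
    have : s ∈ K.map π := by rw [hK]; trivial
    obtain ⟨k, hk, rfl⟩ := this
    exact ⟨QuotientGroup.mk ⟨k, hk⟩, rfl⟩
  have hcent : π'.ker ≤ Subgroup.center (K ⧸ L) := by
    intro e he
    obtain ⟨k, rfl⟩ := QuotientGroup.mk_surjective e
    have hk : (k : G) ∈ N := (hN k k.2).mp he
    rw [Subgroup.mem_center_iff]
    intro e2
    obtain ⟨k2, rfl⟩ := QuotientGroup.mk_surjective e2
    rw [← QuotientGroup.mk_mul, ← QuotientGroup.mk_mul]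
    rw [← mul_inv_eq_one, ← QuotientGroup.mk_inv, ← QuotientGroup.mk_mul, QuotientGroup.eq_one_iff, memL]
    have hmem : ((k2 * k * (k * k2)⁻¹ : K) : G) = ((MulAut.conjNormal (k2 : G) ⟨k, hk⟩ * (⟨k, hk⟩ : N)⁻¹ : N) : G) := by
      simp [mul_assoc]
    refine ⟨by rw [hmem]; exact SetLike.coe_mem _, ?_⟩
    have e : (⟨((k2 * k * (k * k2)⁻¹ : K) : G), by rw [hmem]; exact SetLike.coe_mem _⟩ : N) =
      MulAut.conjNormal (k2 : G) ⟨k, hk⟩ * (⟨k, hk⟩ : N)⁻¹ := Subtype.ext hmem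
    rw [e, map_mul, map_inv, hl k2 k2.2, mul_inv_cancel]
  have hperf' : commutator (K ⧸ L) = ⊤ := by
    rw [commutator_def]
    have e1 : (⊤ : Subgroup (K ⧸ L)) = (⊤ : Subgroup K).map (QuotientGroup.mk' L) :=
      (Subgroup.map_top_of_surjective _ (QuotientGroup.mk'_surjective L)).symm
    rw [e1, ← Subgroup.map_commutator, ← commutator_def, hperf]
  have hinj := schur π' hsur hcent hperf' h8 h2
  apply MonoidHom.ext
  intro n
  have h3 : π' (QuotientGroup.mk ⟨n, hNK n.2⟩) = π' 1 := by
    rw [map_one]; exact (hN n (hNK n.2)).mpr n.2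
  have h4 := hinj h3
  rw [QuotientGroup.eq_one_iff, memL] at h4
  obtain ⟨_, h5⟩ := h4
  exact h5

open scoped commutatorElement in
theorem split {G : Type} [Group G] [Finite G] (h8 : 8 ≤ Nat.card F) (h4 : 4 ∣ Nat.card F)
    (π : G →* SL2 F) (hπ : Function.Surjective π) (hR : Group.IsSolvable π.ker) (a0 b0 : ℕ)
    (ha1 : a0 ∣ Nat.card F - 1)
    (hb : b0.Prime) (hb1 : b0 ∣ Nat.card F + 1)
    (hi1 : ∀ d ∈ charDegrees G, ¬ 2 * a0 ∣ d)
    (hi2 : ∀ d ∈ charDegrees G, ¬ 2 * b0 ∣ d)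
    (hi3 : ∀ d ∈ charDegrees G, ∀ a : ℕ, a.Prime → a ∣ Nat.card F - 1 →
      Nat.card F + 1 ∣ d → ¬ a ∣ d) : ∃ K : Subgroup G, K.Normal ∧ K ⊓ π.ker = ⊥ ∧ K.map π = ⊤ := by
  obtain ⟨K, ⟨hKn, hK⟩, hmin⟩ := (Set.toFinite {K : Subgroup G | K.Normal ∧ K.map π = ⊤}).exists_minimal
    ⟨⊤, inferInstance, Subgroup.map_top_of_surjective _ hπ⟩
  refine ⟨K, hKn, ?_, hK⟩
  have hperf : commutator K = ⊤ := by
    have h1 : ⁅K, K⁆.map π = ⊤ := by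
      rw [Subgroup.map_commutator, hK, ← commutator_def, sl_perfect h8]
    have h2 : K ≤ ⁅K, K⁆ := hmin ⟨inferInstance, h1⟩ (Subgroup.commutator_le_left K K)
    rw [commutator_def, eq_top_iff]
    intro k _
    have h3 := h2 k.2
    have h4 : Subgroup.map K.subtype ⁅(⊤ : Subgroup K), (⊤ : Subgroup K)⁆ = ⁅K, K⁆ := by
      rw [Subgroup.map_commutator, ← MonoidHom.range_eq_map, Subgroup.range_subtype]
    rw [← h4] at h3
    obtain ⟨k', hk', e⟩ := h3
    rwa [← Subtype.ext e]
  by_contra hne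
  let N : Subgroup G := K ⊓ π.ker
  haveI hNn : N.Normal := inferInstance
  have hNK : N ≤ K := inf_le_left
  haveI : Nontrivial N := (Subgroup.nontrivial_iff_ne_bot N).mpr hne
  haveI : Group.IsSolvable N := solvable_of_solvable_injective (f := Subgroup.inclusion (inf_le_right : N ≤ π.ker)) (Subgroup.inclusion_injective _)
  haveI : Finite (N →* ℂˣ) := finite_chars
  haveI : Nontrivial (N →* ℂˣ) := by
    obtain ⟨l, hl⟩ := exists_char (N := N)
    exact ⟨⟨l, 1, hl⟩⟩
  have hN : ∀ k ∈ K, π k = 1 ↔ k ∈ N := fun k hk => ⟨fun h => ⟨hk, h⟩, fun h => h.2⟩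
  have hsec : ∀ s : SL2 F, ∃ k : G, k ∈ K ∧ π k = s := by
    intro s
    have : s ∈ K.map π := by rw [hK]; trivial
    exact this
  choose sec hsK hsec using hsec
  have hwd : ∀ (l : N →* ℂˣ) (k k' : G), k ∈ K → k' ∈ K → π k = π k' → ∀ n, l (MulAut.conjNormal k n) = l (MulAut.conjNormal k' n) := by
    intro l k k' hk hk' e n
    have hm : k * k'⁻¹ ∈ N := by
      rw [← hN _ (K.mul_mem hk (K.inv_mem hk')), map_mul, map_inv, e, mul_inv_cancel]
    rw [← char_inner l ⟨_, hm⟩ (MulAut.conjNormal k' n)]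
    congr 1
    apply Subtype.ext
    simp [mul_assoc]
  letI act : MulDistribMulAction (SL2 F) (N →* ℂˣ) :=
    { smul := fun s l => l.comp (MulAut.conjNormal (sec s)⁻¹ : MulAut N).toMonoidHom
      one_smul := by
        intro l
        apply MonoidHom.ext
        intro n
        show l (MulAut.conjNormal (sec 1)⁻¹ n) = l n
        rw [hwd l (sec 1)⁻¹ 1 (K.inv_mem (hsK _)) K.one_mem (by rw [map_inv, hsec, inv_one, map_one]), map_one]
        rfl
      mul_smul := by
        intro s t l
        apply MonoidHom.ext
        intro n
        show l (MulAut.conjNormal (sec (s * t))⁻¹ n) = l (MulAut.conjNormal (sec t)⁻¹ (MulAut.conjNormal (sec s)⁻¹ n))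
        rw [← MulAut.mul_apply, ← map_mul]
        apply hwd
        · exact K.inv_mem (hsK _)
        · exact K.mul_mem (K.inv_mem (hsK _)) (K.inv_mem (hsK _))
        · rw [map_inv, map_mul, map_inv, map_inv, hsec, hsec, hsec, mul_inv_rev]
      smul_mul := fun s l m => rfl
      smul_one := fun s => rfl }
  have hsm : ∀ (s : SL2 F) (l : N →* ℂˣ) (k : G), k ∈ K → π k = s⁻¹ → ∀ n, (s • l) n = l (MulAut.conjNormal k n) := by
    intro s l k hk e n
    show l (MulAut.conjNormal (sec s)⁻¹ n) = _
    apply hwd l _ _ (K.inv_mem (hsK _)) hk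
    rw [map_inv, hsec, e]
  have hidx : ∀ l : N →* ℂˣ, ∃ d ∈ charDegrees G, (MulAction.stabilizer (SL2 F) l).index ∣ d := by
    intro l
    let J : Subgroup G :=
      { carrier := {g | ∀ n, l (MulAut.conjNormal g n) = l n}
        one_mem' := by intro n; rw [map_one]; rfl
        mul_mem' := by
          intro g h hg hh n
          rw [map_mul, MulAut.mul_apply, hg, hh]
        inv_mem' := by
          intro g hg n
          rw [← hg, ← MulAut.mul_apply, ← map_mul, mul_inv_cancel, map_one]; rfl }
    obtain ⟨d, hd, hd'⟩ := deg_stab N l J (fun g => Iff.rfl)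
    refine ⟨d, hd, dvd_trans ?_ hd'⟩
    have hs : Function.Surjective (π.comp K.subtype) := fun s => ⟨⟨sec s, hsK s⟩, hsec s⟩
    rw [← Subgroup.index_comap_of_surjective _ hs]
    have : (MulAction.stabilizer (SL2 F) l).comap (π.comp K.subtype) = J.subgroupOf K := by
      ext k
      rw [Subgroup.mem_comap, MulAction.mem_stabilizer_iff, Subgroup.mem_subgroupOf]
      rw [← inv_mem_iff (x := (k : G))]
      constructor
      · intro h n
        rw [← hsm (π k) l (k⁻¹ : G) (K.inv_mem k.2) (map_inv _ _)]
        exact DFunLike.congr_fun h n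
      · intro h
        apply MonoidHom.ext
        intro n
        show (π k • l) n = l n
        rw [hsm _ l (k⁻¹ : G) (K.inv_mem k.2) (map_inv _ _)]
        exact h n
    rw [this]
    exact relIndex_dvd' J K
  apply comb (F := F) (V := (N →* ℂˣ)) h4 ?_ a0 b0 ha1 hb hb1
  · intro l h
    obtain ⟨d, hd, hd'⟩ := hidx l
    exact hi1 d hd (h.trans hd')
  · intro l h
    obtain ⟨d, hd, hd'⟩ := hidx l
    exact hi2 d hd (h.trans hd')
  · intro l a ha h1 h2 h3
    obtain ⟨d, hd, hd'⟩ := hidx l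
    exact hi3 d hd a ha h1 (h2.trans hd') (h3.trans hd')
  · intro l hl
    apply fix_triv h8 ((by norm_num : 2 ∣ 4).trans h4) π K N hNK hN hK hperf
    intro k hk n
    rw [← hsm (π k)⁻¹ l k hk (inv_inv _).symm, hl]

end split


section fin
variable {F : Type} [Field F] [Fintype F] [CharP F 2]

lemma prod_iso {G S : Type} [Group G] [Group S] (π : G →* S) (K R : Subgroup G) (hR : π.ker = R)
    (hK : K.Normal) (h1 : K ⊓ π.ker = ⊥) (h2 : K.map π = ⊤) : Nonempty (G ≃* S × R) := by
  subst hR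
  have hk : Function.Bijective (π.comp K.subtype) := by
    constructor
    · rw [injective_iff_map_eq_one]
      intro k hk
      have : (k : G) ∈ K ⊓ π.ker := ⟨k.2, hk⟩
      rw [h1] at this
      exact Subtype.ext (Subgroup.mem_bot.mp this)
    · intro s
      have : s ∈ K.map π := by rw [h2]; trivial
      obtain ⟨k, hk, rfl⟩ := this
      exact ⟨⟨k, hk⟩, rfl⟩
  have hcomm : ∀ (m : K) (n : π.ker), Commute (K.subtype m) (π.ker.subtype n) := by
    intro m n
    exact Subgroup.commute_of_normal_of_disjoint K π.ker hK inferInstance (disjoint_iff.mpr h1) m n m.2 n.2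
  let φ : K × π.ker →* G := MonoidHom.noncommCoprod K.subtype π.ker.subtype hcomm
  have hφ : Function.Bijective φ := by
    constructor
    · rw [injective_iff_map_eq_one]
      rintro ⟨k, r⟩ h
      have h : (k : G) * r = 1 := h
      have hk1 : (k : G) = (r : G)⁻¹ := eq_inv_of_mul_eq_one_left h
      have : (k : G) ∈ K ⊓ π.ker := ⟨k.2, by rw [hk1]; exact π.ker.inv_mem r.2⟩
      rw [h1, Subgroup.mem_bot] at this
      rw [this, one_mul] at h
      exact Prod.ext (Subtype.ext this) (Subtype.ext h)
    · intro g
      obtain ⟨k, hk⟩ := hk.2 (π g)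
      have hk : π k = π g := hk
      refine ⟨⟨k, ⟨(k : G)⁻¹ * g, ?_⟩⟩, ?_⟩
      · rw [MonoidHom.mem_ker, map_mul, map_inv, hk, inv_mul_cancel]
      · show (k : G) * ((k : G)⁻¹ * g) = g
        group
  exact ⟨(MulEquiv.ofBijective φ hφ).symm.trans
    ((MulEquiv.ofBijective _ hk).prodCongr (MulEquiv.refl _))⟩

lemma rad_comm {G R : Type} [Group G] [Finite G] [Group R] [Finite R] (h4 : (charGraph G).CliqueFree 4)
    (h8 : 8 ≤ Nat.card F) (h2 : 2 ∣ Nat.card F)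
    (hA : (Nat.card F - 1).primeFactors.card = 3) (hB : (Nat.card F + 1).primeFactors.card = 3)
    (e : G ≃* SL2 F × R) (x y : R) : x * y = y * x := by
  apply comm_of_deg
  intro d hd
  by_contra hne
  obtain ⟨p, hp, hpd⟩ := Nat.exists_prime_and_dvd hne
  obtain ⟨d1, hd1, h1⟩ := sl_cusp (F := F) (by omega)
  obtain ⟨d2, hd2, h2'⟩ := sl_plus (F := F) h8
  have p1 := k4' h4 (inflate e.toMonoidHom e.surjective (tensor_deg hd1 hd)) hA (h1.mul_right d) hp (hpd.mul_left _)
  have p2 := k4' h4 (inflate e.toMonoidHom e.surjective (tensor_deg hd2 hd)) hB (h2'.mul_right d) hp (hpd.mul_left _)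
  exact cop h2 (by omega) hp p1 p2

lemma all_degs {G R : Type} [Group G] [Finite G] [Group R] [Finite R]
    (e : G ≃* SL2 F × R) (hc : ∀ x y : R, x * y = y * x) {n : ℕ} (hn : n ∈ charDegrees G) :
    n = 1 ∨ n = Nat.card F - 1 ∨ n = Nat.card F ∨ n = Nat.card F + 1 := by
  have h1 : n ∈ charDegrees (SL2 F × R) := inflate e.symm.toMonoidHom e.symm.surjective hn
  obtain ⟨X, i1, i2, i3, ρ, hρ, rfl⟩ := br2 h1
  have hsc : ∀ r : R, ∃ c : ℂ, ρ (1, r) = c • 1 := by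
    intro r
    apply hρ.scalar
    rintro ⟨s, r'⟩
    rw [← map_mul, ← map_mul, Prod.mk_mul_mk, Prod.mk_mul_mk, hc, one_mul, mul_one]
  apply sl_dims (ρ.comp (MonoidHom.inl (SL2 F) R))
  refine ⟨hρ.nontriv, ?_⟩
  intro W hW
  apply hρ.eq
  rintro ⟨s, r⟩ w hw
  have e1 : ((s, r) : SL2 F × R) = (s, 1) * (1, r) := by rw [Prod.mk_mul_mk, mul_one, one_mul]
  obtain ⟨c, h⟩ := hsc r
  rw [e1, map_mul, h, Module.End.mul_apply, LinearMap.smul_apply, Module.End.one_apply]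
  exact hW s _ (W.smul_mem c hw)

lemma adj_of {G : Type} [Group G] {m n : ℕ} (hn : n ∈ charDegrees G) (hmn : m ∣ n) (p q : charPrimes G)
    (hne : p ≠ q) (hp : (p : ℕ) ∣ m) (hq : (q : ℕ) ∣ m) : (charGraph G).Adj p q :=
  have hne' : (p : ℕ) ≠ q := fun e => hne (Subtype.ext e)
  ⟨hne', n, hn, ((Nat.coprime_primes p.2.1 q.2.1).mpr hne').mul_dvd_of_dvd_of_dvd (hp.trans hmn) (hq.trans hmn)⟩

lemma col {G : Type} [Group G] (S : Set (charPrimes G)) (C : ℕ → Prop)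
    (h : ∀ x ∈ S, ∀ y ∈ S, x ≠ y → (C x ↔ C y) → (charGraph G).Adj x y) :
    (((charGraph G).induce S)ᶜ).Colorable 2 := by
  classical
  refine ⟨SimpleGraph.Coloring.mk (fun x => if C x.1.1 then (0 : Fin 2) else 1) ?_⟩
  intro x y hxy e
  rw [SimpleGraph.compl_adj] at hxy
  apply hxy.2
  apply h x.1 x.2 y.1 y.2 (fun e => hxy.1 (Subtype.ext e))
  by_cases h1 : C x.1.1 <;> by_cases h2 : C y.1.1 <;> simp_all

lemma two_of {q f p : ℕ} (hq : q = 2 ^ f) (hp : p.Prime) (h : p ∣ q) : p = 2 := by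
  rw [hq] at h
  exact (Nat.prime_dvd_prime_iff_eq hp Nat.prime_two).mp (hp.dvd_of_dvd_pow h)

theorem graph_iso {G : Type} [Group G] [Finite G] (q f : ℕ) (hq : q = 2 ^ f) (h2 : 2 ∣ q) (h8 : 8 ≤ q)
    (hA : (q - 1).primeFactors.card = 3) (hB : (q + 1).primeFactors.card = 3)
    (h7 : Nat.card (charPrimes G) = 7)
    (hd : ∀ n ∈ charDegrees G, n = 1 ∨ n = q - 1 ∨ n = q ∨ n = q + 1)
    (d1 : ∃ d ∈ charDegrees G, q - 1 ∣ d) (d2 : ∃ d ∈ charDegrees G, q + 1 ∣ d) :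
    Nonempty (charGraph G ≃g ((⊤ : SimpleGraph (Fin 3)) ⊕g (⊤ : SimpleGraph (Fin 1))) ⊕g
      (⊤ : SimpleGraph (Fin 3))) := by
  classical
  obtain ⟨n1, hn1, hn1'⟩ := d1
  obtain ⟨n2, hn2, hn2'⟩ := d2
  haveI : Finite (charPrimes G) := Nat.finite_of_card_ne_zero (by rw [h7]; norm_num)
  have hsame : ∀ n ∈ charDegrees G, ∀ p r : ℕ, p.Prime → r.Prime → p ∣ n → r ∣ n →
      (p ∣ q - 1 ∧ r ∣ q - 1) ∨ (p = 2 ∧ r = 2) ∨ (p ∣ q + 1 ∧ r ∣ q + 1) := by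
    intro n hn p r hp hr h1 h3
    rcases hd n hn with rfl | rfl | rfl | rfl
    · exact absurd (Nat.dvd_one.mp h1) hp.one_lt.ne'
    · exact Or.inl ⟨h1, h3⟩
    · exact Or.inr (Or.inl ⟨two_of hq hp h1, two_of hq hr h3⟩)
    · exact Or.inr (Or.inr ⟨h1, h3⟩)
  have cAB : ∀ p : ℕ, p.Prime → p ∣ q - 1 → p ∣ q + 1 → False := fun p hp a b =>
    cop h2 (by omega) hp a b
  have c2A : ¬ 2 ∣ q - 1 := by omega
  have c2B : ¬ 2 ∣ q + 1 := by omega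
  have two_mem : 2 ∈ charPrimes G := by
    by_contra hno
    have hsub : charPrimes G ⊆ ((q - 1).primeFactors ∪ (q + 1).primeFactors : Finset ℕ) := by
      rintro p ⟨hp, n, hn, hpn⟩
      rw [Finset.mem_coe, Finset.mem_union]
      rcases hsame n hn p p hp hp hpn hpn with h | h | h
      · exact Or.inl (Nat.mem_primeFactors.mpr ⟨hp, h.1, by omega⟩)
      · exact absurd ⟨h.1 ▸ hp, n, hn, h.1 ▸ hpn⟩ hno
      · exact Or.inr (Nat.mem_primeFactors.mpr ⟨hp, h.1, by omega⟩)
    have h := Set.ncard_le_ncard hsub (Finset.finite_toSet _)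
    rw [Set.ncard_coe_finset, Set.ncard_def, Set.encard, ] at h
    have h3 := Finset.card_union_le (q - 1).primeFactors (q + 1).primeFactors
    have h4 : (ENat.card (charPrimes G)).toNat = 7 := h7
    omega
  let eA := Finset.equivFinOfCardEq hA
  let eB := Finset.equivFinOfCardEq hB
  have mA : ∀ i, ((eA.symm i : ℕ)).Prime ∧ (eA.symm i : ℕ) ∣ q - 1 := fun i =>
    ⟨Nat.prime_of_mem_primeFactors (eA.symm i).2, Nat.dvd_of_mem_primeFactors (eA.symm i).2⟩
  have mB : ∀ i, ((eB.symm i : ℕ)).Prime ∧ (eB.symm i : ℕ) ∣ q + 1 := fun i =>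
    ⟨Nat.prime_of_mem_primeFactors (eB.symm i).2, Nat.dvd_of_mem_primeFactors (eB.symm i).2⟩
  let ψ : (Fin 3 ⊕ Fin 1) ⊕ Fin 3 → charPrimes G :=
    Sum.elim (Sum.elim (fun i => ⟨eA.symm i, (mA i).1, n1, hn1, (mA i).2.trans hn1'⟩) (fun _ => ⟨2, two_mem⟩))
      (fun i => ⟨eB.symm i, (mB i).1, n2, hn2, (mB i).2.trans hn2'⟩)
  have pA : ∀ i, (ψ (Sum.inl (Sum.inl i)) : ℕ) = eA.symm i := fun i => rfl
  have p2 : ∀ i, (ψ (Sum.inl (Sum.inr i)) : ℕ) = 2 := fun i => rfl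
  have pB : ∀ i, (ψ (Sum.inr i) : ℕ) = eB.symm i := fun i => rfl
  have hinj : Function.Injective ψ := by
    intro x y hxy
    have hxy' : (ψ x : ℕ) = ψ y := congrArg _ hxy
    rcases x with (i | i) | i <;> rcases y with (j | j) | j <;> simp only [pA, p2, pB] at hxy'
    · rw [eA.symm.injective (Subtype.ext hxy')]
    · exact absurd (hxy' ▸ (mA i).2) c2A
    · exact (cAB _ (mA i).1 (mA i).2 (hxy' ▸ (mB j).2)).elim
    · exact absurd (hxy' ▸ (mA j).2) c2A
    · rw [Subsingleton.elim i j]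
    · exact absurd (hxy' ▸ (mB j).2) c2B
    · exact (cAB _ (mA j).1 (mA j).2 (hxy' ▸ (mB i).2)).elim
    · exact absurd (hxy' ▸ (mB i).2) c2B
    · rw [eB.symm.injective (Subtype.ext hxy')]
  have hbij : Function.Bijective ψ := by
    apply hinj.bijective_of_nat_card_le
    rw [h7]; simp
  refine ⟨RelIso.symm ⟨Equiv.ofBijective ψ hbij, ?_⟩⟩
  intro x y
  show (charGraph G).Adj (ψ x) (ψ y) ↔ _
  have hne : (charGraph G).Adj (ψ x) (ψ y) → x ≠ y := fun h e => h.ne (congrArg ψ e)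
  have hcl : (charGraph G).Adj (ψ x) (ψ y) →
      ((ψ x : ℕ) ∣ q - 1 ∧ (ψ y : ℕ) ∣ q - 1) ∨ ((ψ x : ℕ) = 2 ∧ (ψ y : ℕ) = 2) ∨
        ((ψ x : ℕ) ∣ q + 1 ∧ (ψ y : ℕ) ∣ q + 1) := by
    rintro ⟨-, n, hn, h⟩
    exact hsame n hn _ _ (ψ x).2.1 (ψ y).2.1 ((Dvd.intro _ rfl).trans h) ((Dvd.intro_left _ rfl).trans h)
  have nA : ∀ i, ¬ ((eA.symm i : ℕ) ∣ q + 1) := fun i h => cAB _ (mA i).1 (mA i).2 h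
  have nB : ∀ i, ¬ ((eB.symm i : ℕ) ∣ q - 1) := fun i h => cAB _ (mB i).1 h (mB i).2
  have nA2 : ∀ i, (eA.symm i : ℕ) ≠ 2 := fun i h => c2A (h ▸ (mA i).2)
  have nB2 : ∀ i, (eB.symm i : ℕ) ≠ 2 := fun i h => c2B (h ▸ (mB i).2)
  rcases x with (i | i) | i <;> rcases y with (j | j) | j <;> simp only [pA, p2, pB] at hcl <;>
    simp only [SimpleGraph.sum_adj, SimpleGraph.top_adj, Bool.false_eq_true]
  · constructor
    · intro h e; exact hne h (by rw [e])
    · intro h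
      exact adj_of hn1 hn1' _ _ (fun e => h (Sum.inl_injective (Sum.inl_injective (hinj e)))) (mA i).2 (mA j).2
  · simp only [iff_false]; intro h; have := hcl h; have := nA i; have := nA2 i; tauto
  · simp only [iff_false]; intro h; have := hcl h; have := nA i; have := nA2 i; have := nB j; tauto
  · simp only [iff_false]; intro h; have := hcl h; have := nA j; have := nA2 j; tauto
  · constructor
    · intro h; exact absurd (by rw [Subsingleton.elim i j]) (hne h)
    · intro h; exact absurd (Subsingleton.elim i j) h
  · simp only [iff_false]; intro h; have := hcl h; have := nB j; have := nB2 j; tauto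
  · simp only [iff_false]; intro h; have := hcl h; have := nA j; have := nA2 j; have := nB i; tauto
  · simp only [iff_false]; intro h; have := hcl h; have := nB i; have := nB2 i; tauto
  · constructor
    · intro h e; exact hne h (by rw [e])
    · intro h
      exact adj_of hn2 hn2' _ _ (fun e => h (Sum.inr_injective (hinj e))) (mB i).2 (mB j).2

end fin


lemma dvd_cases {q f p : ℕ} (hq : q = 2 ^ f) (hp : p.Prime) (h : p ∣ (q - 1) * q * (q + 1)) :
    p ∣ q - 1 ∨ p = 2 ∨ p ∣ q + 1 := by
  rcases (hp.dvd_mul).mp h with h | h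
  · rcases (hp.dvd_mul).mp h with h | h
    · exact Or.inl h
    · exact Or.inr (Or.inl (two_of hq hp h))
  · exact Or.inr (Or.inr h)

lemma adj2 {G : Type} [Group G] {n : ℕ} (hn : n ∈ charDegrees G) (p q : charPrimes G)
    (hne : p ≠ q) (h : (p : ℕ) * q ∣ n) : (charGraph G).Adj p q :=
  ⟨fun e => hne (Subtype.ext e), n, hn, h⟩

lemma nonbip {G : Type} [Group G] (q f N u v : ℕ) (hq : q = 2 ^ f) (h2 : 2 ∣ q) (h8 : 8 ≤ q)
    (hN : N = (q - 1) * q * (q + 1))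
    (huv : (u = q - 1 ∧ v = q + 1) ∨ (u = q + 1 ∧ v = q - 1))
    (d1 : ∃ d ∈ charDegrees G, u ∣ d) (d2 : ∃ d ∈ charDegrees G, v ∣ d)
    (hbip : ¬ (((charGraph G).induce
      {x : ↥(charPrimes G) | (x : ℕ) ∈ N.primeFactors})ᶜ).Colorable 2) :
    ∃ a, a.Prime ∧ a ∣ u ∧ ∀ d ∈ charDegrees G, ¬ 2 * a ∣ d := by
  by_contra hcon
  push Not at hcon
  apply hbip
  obtain ⟨n1, hn1, hn1'⟩ := d1
  obtain ⟨n2, hn2, hn2'⟩ := d2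
  apply col _ (fun p => p ∣ v)
  have hc : ∀ p : ℕ, p.Prime → p ∣ N → ¬ p ∣ v → p = 2 ∨ p ∣ u := by
    intro p hp h hv
    rw [hN] at h
    rcases dvd_cases hq hp h with h | h | h
    · rcases huv with ⟨rfl, rfl⟩ | ⟨rfl, rfl⟩
      · exact Or.inr h
      · exact absurd h hv
    · exact Or.inl h
    · rcases huv with ⟨rfl, rfl⟩ | ⟨rfl, rfl⟩
      · exact absurd h hv
      · exact Or.inr h
  intro x hx y hy hne hxy
  have hxN := Nat.dvd_of_mem_primeFactors hx
  have hyN := Nat.dvd_of_mem_primeFactors hy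
  by_cases hv : (x : ℕ) ∣ v
  · exact adj_of hn2 hn2' _ _ hne hv (hxy.mp hv)
  · have hv2 : ¬ (y : ℕ) ∣ v := fun h => hv (hxy.mpr h)
    rcases hc _ x.2.1 hxN hv with h1 | h1 <;> rcases hc _ y.2.1 hyN hv2 with h3 | h3
    · exact absurd (Subtype.ext (h1.trans h3.symm)) hne
    · obtain ⟨d, hd, h⟩ := hcon y y.2.1 h3
      exact adj2 hd _ _ hne (by rw [h1]; exact h)
    · obtain ⟨d, hd, h⟩ := hcon x x.2.1 h1
      exact adj2 hd _ _ hne (by rw [h3, mul_comm]; exact h)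
    · exact adj_of hn1 hn1' _ _ hne h1 h3

theorem stmt15 (G : Type) [Group G] [Finite G]
    (h4 : (charGraph G).CliqueFree 4)
    (h7 : Nat.card ↥(charPrimes G) = 7)
    (M : Subgroup G) (hM : M.Normal) (hRM : solvableRadical G < M)
    (f : ℕ) (hf : 2 ≤ f)
    (hS : Nonempty (↥(radicalQuotImage M) ≃* PSL2 (GaloisField 2 f)))
    (hcent : Subgroup.centralizer ((radicalQuotImage M) : Set (G ⧸ solvableRadical G)) = ⊥)
    (hbip : ¬ (((charGraph G).induce
      {x : ↥(charPrimes G) | (x : ℕ) ∈ (Nat.card ↥(radicalQuotImage M)).primeFactors})ᶜ).Colorable 2)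
    (hm : (2 ^ f - 1).primeFactors.card = 3)
    (hp : (2 ^ f + 1).primeFactors.card = 3) :
    Nonempty (G ≃* PSL2 (GaloisField 2 f) × ↥(solvableRadical G)) ∧
    (∀ x y : ↥(solvableRadical G), x * y = y * x) ∧
    Nonempty (charGraph G ≃g (((⊤ : SimpleGraph (Fin 3)) ⊕g (⊤ : SimpleGraph (Fin 1))) ⊕g (⊤ : SimpleGraph (Fin 3)))) := by
  classical
  haveI : Fintype (GaloisField 2 f) := Fintype.ofFinite _
  have hq : Nat.card (GaloisField 2 f) = 2 ^ f := GaloisField.card 2 f (by omega)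
  have hf3 : 3 ≤ f := by
    by_contra h
    have : f = 2 := by omega
    subst this
    have h3 : (2 ^ 2 - 1 : ℕ) = 3 := by norm_num
    rw [h3, Nat.Prime.primeFactors Nat.prime_three] at hm
    simp at hm
  obtain ⟨k, rfl⟩ : ∃ k, f = k + 3 := ⟨f - 3, by omega⟩
  set f := k + 3 with hfk
  have hpow : 2 ^ f = 8 * 2 ^ k := by rw [hfk, pow_add]; ring
  have hpos : 0 < 2 ^ k := by positivity
  have h8 : 8 ≤ Nat.card (GaloisField 2 f) := by omega
  have h4d : 4 ∣ Nat.card (GaloisField 2 f) := by omega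
  have h2d : 2 ∣ Nat.card (GaloisField 2 f) := by omega
  rw [← hq] at hm hp
  have hz : Subgroup.center (SL2 (GaloisField 2 f)) = ⊥ := by
    rw [eq_bot_iff]
    intro z hz
    rw [Subgroup.mem_center_iff] at hz
    exact sl_center z (fun s => (hz s).symm)
  have hbij : Function.Bijective (QuotientGroup.mk' (Subgroup.center (SL2 (GaloisField 2 f)))) :=
    ⟨by rw [← MonoidHom.ker_eq_bot_iff, QuotientGroup.ker_mk', hz], QuotientGroup.mk'_surjective _⟩
  let eP : SL2 (GaloisField 2 f) ≃* PSL2 (GaloisField 2 f) := MulEquiv.ofBijective _ hbij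
  obtain ⟨eS⟩ := hS
  let e1 : SL2 (GaloisField 2 f) ≃* radicalQuotImage M := eP.trans eS.symm
  let ι : SL2 (GaloisField 2 f) →* G ⧸ solvableRadical G := (radicalQuotImage M).subtype.comp e1.toMonoidHom
  have hι : Function.Injective ι := (Subtype.val_injective).comp e1.injective
  have hr : ι.range = radicalQuotImage M := by
    ext x
    constructor
    · rintro ⟨s, rfl⟩
      exact (e1 s).2
    · intro hx
      exact ⟨e1.symm ⟨x, hx⟩, by
        show ((e1 (e1.symm ⟨x, hx⟩) : radicalQuotImage M) : G ⧸ solvableRadical G) = x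
        rw [e1.apply_symm_apply]⟩
  have hnorm : ι.range.Normal := by
    rw [hr]
    exact hM.map _ (QuotientGroup.mk'_surjective _)
  have htop : ι.range = ⊤ := by
    refine step1 h4 h8 h2d hm hp (QuotientGroup.mk' (solvableRadical G)) (QuotientGroup.mk'_surjective _) ι hι hnorm ?_
    intro h hh
    have : h ∈ Subgroup.centralizer ((radicalQuotImage M) : Set (G ⧸ solvableRadical G)) := by
      rw [Subgroup.mem_centralizer_iff, ← hr]
      rintro _ ⟨s, rfl⟩
      exact (hh s).symm
    rw [hcent] at this
    exact Subgroup.mem_bot.mp this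
  let eι : SL2 (GaloisField 2 f) ≃* G ⧸ solvableRadical G :=
    MulEquiv.ofBijective ι ⟨hι, MonoidHom.range_eq_top.mp htop⟩
  let π : G →* SL2 (GaloisField 2 f) := eι.symm.toMonoidHom.comp (QuotientGroup.mk' (solvableRadical G))
  have hπ : Function.Surjective π := eι.symm.surjective.comp (QuotientGroup.mk'_surjective _)
  have hker : π.ker = solvableRadical G := by
    ext x
    rw [MonoidHom.mem_ker, ← QuotientGroup.eq_one_iff]
    show eι.symm (x : G ⧸ solvableRadical G) = 1 ↔ _
    rw [EmbeddingLike.map_eq_one_iff]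
  have hsol : Group.IsSolvable π.ker := by rw [hker]; exact rad_solv G
  have hN : Nat.card (radicalQuotImage M) = (Nat.card (GaloisField 2 f) - 1) * Nat.card (GaloisField 2 f) *
      (Nat.card (GaloisField 2 f) + 1) := by
    rw [← card_sl]; exact (Nat.card_congr e1.toEquiv).symm
  have d1 : ∃ d ∈ charDegrees G, Nat.card (GaloisField 2 f) - 1 ∣ d := by
    obtain ⟨d, hd, h⟩ := sl_cusp (F := GaloisField 2 f) (by omega)
    exact ⟨d, inflate π hπ hd, h⟩
  have d2 : ∃ d ∈ charDegrees G, Nat.card (GaloisField 2 f) + 1 ∣ d := by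
    obtain ⟨d, hd, h⟩ := sl_plus (F := GaloisField 2 f) h8
    exact ⟨d, inflate π hπ hd, h⟩
  obtain ⟨a0, ha, ha1, ha2⟩ := nonbip _ f _ _ _ hq h2d h8 hN (Or.inl ⟨rfl, rfl⟩) d1 d2 hbip
  obtain ⟨b0, hb, hb1, hb2⟩ := nonbip _ f _ _ _ hq h2d h8 hN (Or.inr ⟨rfl, rfl⟩) d2 d1 hbip
  have hi3 : ∀ d ∈ charDegrees G, ∀ a, a.Prime → a ∣ Nat.card (GaloisField 2 f) - 1 →
      Nat.card (GaloisField 2 f) + 1 ∣ d → ¬ a ∣ d := fun d hd a hap h1 h3 h5 =>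
    cop h2d (by omega) hap h1 (k4' h4 hd hp h3 hap h5)
  obtain ⟨K, hK, hK1, hK2⟩ := split h8 h4d π hπ hsol a0 b0 ha1 hb hb1 ha2 hb2 hi3
  obtain ⟨e⟩ := prod_iso π K (solvableRadical G) hker hK hK1 hK2
  have hc := rad_comm h4 h8 h2d hm hp e
  exact ⟨⟨e.trans (eP.prodCongr (MulEquiv.refl _))⟩, hc,
    graph_iso _ f hq h2d h8 hm hp h7 (fun n hn => all_degs e hc hn) d1 d2⟩
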